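/- Let p, r ∈ (0,1) with TOEC(p,r) ≠ ∅. Then: (a) for all S, T ∈ TOEC(p,r), E_S and E_T are Lipschitz equivalent if and only if I_S and I_T are in the same ideal class of Z[p]; (b) every ideal class of Z[p] contains I_S for some S ∈ TOEC(p,r). Consequently, the assignment sending the Lipschitz equivalence class of E_S to the ideal class of I_S is a well-defined bijection from the set of Lipschitz equivalence classes of {E_S : S ∈ TOEC(p,r)} onto the set of ideal classes of Z[p]; in particular the number of Lipschitz equivalence classes equals the class number h(Z[p]), and this number is finite. -/

import Mathlib

open MeasureTheory Metric Set Pointwise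

noncomputable section

/-- An iterated function system (IFS) of contracting similarities on `ℝ^d`. -/
structure IFS (d : ℕ) : Type 1 where
  ι : Type
  fin : Fintype ι
  f : ι → EuclideanSpace ℝ (Fin d) → EuclideanSpace ℝ (Fin d)
  r : ι → ℝ
  r_pos : ∀ i, 0 < r i
  r_lt_one : ∀ i, r i < 1
  sim : ∀ i x y, dist (f i x) (f i y) = r i * dist x y

attribute [instance] IFS.fin

namespace IFS

variable {d : ℕ}

/-- `E` is the self-similar set (attractor) of `S`: the unique nonempty compact set
with `E = ⋃ i, S.f i '' E`. -/
def IsAttractor (S : IFS d) (E : Set (EuclideanSpace ℝ (Fin d))) : Prop :=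
  E.Nonempty ∧ IsCompact E ∧ E = ⋃ i, S.f i '' E

open scoped Classical in
/-- The self-similar set generated by `S`. -/
def attractor (S : IFS d) : Set (EuclideanSpace ℝ (Fin d)) :=
  if h : ∃ E, S.IsAttractor E then h.choose else ∅

/-- `O` is an open set witnessing the open set condition for `S`. -/
def OSCSet (S : IFS d) (O : Set (EuclideanSpace ℝ (Fin d))) : Prop :=
  O.Nonempty ∧ IsOpen O ∧ Bornology.IsBounded O ∧
    (∀ i, S.f i '' O ⊆ O) ∧ ∀ i j, i ≠ j → Disjoint (S.f i '' O) (S.f j '' O)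

/-- The open set condition. -/
def OSC (S : IFS d) : Prop := ∃ O, S.OSCSet O

/-- The strong separation condition. -/
def SSC (S : IFS d) : Prop :=
  ∀ i j : S.ι, i ≠ j → Disjoint (S.f i '' S.attractor) (S.f j '' S.attractor)

/-- `r` is the ratio root of `S`: the ratios are commensurable with common root `r`. -/
def IsRatioRoot (S : IFS d) (r : ℝ) : Prop :=
  0 < r ∧ r < 1 ∧
    ∃ lam : S.ι → ℕ, (∀ i, 0 < lam i) ∧ (∀ i, S.r i = r ^ lam i) ∧ Finset.univ.gcd lam = 1

/-- The Hausdorff dimension of the attractor of `S`, as a real number. -/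
def hdim (S : IFS d) : ℝ := (dimH S.attractor).toReal

/-- Membership in the class TOEC: OSC, commensurable ratios, totally disconnected attractor. -/
def MemTOEC (S : IFS d) : Prop :=
  S.OSC ∧ (∃ r, S.IsRatioRoot r) ∧ IsTotallyDisconnected S.attractor

/-- Membership in TOEC(p, r): measure root `p` and ratio root `r`. -/
def MemTOECpr (S : IFS d) (p r : ℝ) : Prop :=
  S.MemTOEC ∧ S.IsRatioRoot r ∧ p = r ^ S.hdim

/-- The natural measure of a set: normalized `s`-dimensional Hausdorff measure, `s = dimH E_S`. -/
def natMeasure (S : IFS d) (F : Set (EuclideanSpace ℝ (Fin d))) : ℝ :=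
  (μH[S.hdim] F / μH[S.hdim] S.attractor).toReal

/-- `F` is an interior separated set of `E_S`. -/
def IsIntSep (S : IFS d) (F : Set (EuclideanSpace ℝ (Fin d))) : Prop :=
  IsCompact F ∧ F ⊆ S.attractor ∧ IsCompact (S.attractor \ F) ∧ ∃ O, S.OSCSet O ∧ F ⊆ O

end IFS

/-- The subring `ℤ[p]` of `ℝ` generated by `ℤ` and `p`. -/
def Zring (p : ℝ) : Subring ℝ := Subring.closure {p}

/-- The underlying set of reals of an ideal of a subring of `ℝ`. -/
def idealSet {R : Subring ℝ} (I : Ideal R) : Set ℝ := (fun x : R => (x : ℝ)) '' (I : Set R)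

/-- The ideal `I_S` of `ℤ[p]` generated by the natural measures of interior separated sets. -/
def IFS.idealOf {d : ℕ} (S : IFS d) (p : ℝ) : Ideal (Zring p) :=
  Ideal.span {x : Zring p | ∃ F, S.IsIntSep F ∧ (x : ℝ) = S.natMeasure F}

/-- Two ideals of a subring `R` of `ℝ` lie in the same ideal class: `a·I = b·J`
for some nonzero `a, b ∈ R`. -/
def SameIdealClass {R : Subring ℝ} (I J : Ideal R) : Prop :=
  ∃ a b : R, a ≠ 0 ∧ b ≠ 0 ∧ (a : ℝ) • idealSet I = (b : ℝ) • idealSet J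

/-- Lipschitz equivalence of subsets of (possibly different) metric spaces. -/
def LipEquiv {X Y : Type*} [MetricSpace X] [MetricSpace Y] (A : Set X) (B : Set Y) : Prop :=
  ∃ (f : X → Y) (L : ℝ), 1 ≤ L ∧ Set.BijOn f A B ∧
    ∀ x ∈ A, ∀ y ∈ A, L⁻¹ * dist x y ≤ dist (f x) (f y) ∧ dist (f x) (f y) ≤ L * dist x y

/-- `P` is a subset of `E` at distance at least `r ^ k` from its complement in `E`. -/
def KSet {α : Type*} [MetricSpace α] (E : Set α) (r : ℝ) (k : ℕ) (P : Set α) : Prop :=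
  P ⊆ E ∧ ∀ x ∈ P, ∀ y ∈ E, y ∉ P → r ^ k ≤ dist x y

namespace KSet

variable {α : Type*} [MetricSpace α] {E P Q : Set α} {r : ℝ} {k l : ℕ}

lemma mono (h : KSet E r k P) (hr0 : 0 < r) (hr1 : r < 1) (hkl : k ≤ l) : KSet E r l P :=
  ⟨h.1, fun x hx y hy hyP => (pow_le_pow_of_le_one hr0.le hr1.le hkl).trans (h.2 x hx y hy hyP)⟩

lemma empty : KSet E r k ∅ := ⟨empty_subset _, fun _ hx => hx.elim⟩

lemma self : KSet E r k E := ⟨Subset.rfl, fun _ _ _ hy hyP => (hyP hy).elim⟩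

lemma union (h : KSet E r k P) (h' : KSet E r k Q) : KSet E r k (P ∪ Q) := by
  refine ⟨union_subset h.1 h'.1, fun x hx y hy hyP => ?_⟩
  rw [mem_union, not_or] at hyP
  rcases hx with hx | hx
  · exact h.2 x hx y hy hyP.1
  · exact h'.2 x hx y hy hyP.2

lemma diff (h : KSet E r k P) (h' : KSet E r k Q) : KSet E r k (P \ Q) := by
  refine ⟨sdiff_subset.trans h.1, fun x hx y hy hyP => ?_⟩
  by_cases hP : y ∈ P
  · have hQ : y ∈ Q := by by_contra hQ; exact hyP ⟨hP, hQ⟩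
    rw [dist_comm]
    exact h'.2 y hQ x (h.1 hx.1) hx.2
  · exact h.2 x hx.1 y hy hP

lemma inter (h : KSet E r k P) (h' : KSet E r k Q) : KSet E r k (P ∩ Q) := by
  have := h.diff (h.diff h')
  rwa [sdiff_sdiff_right_self] at this

lemma iUnion {ι : Sort*} {A : ι → Set α} (h : ∀ i, KSet E r k (A i)) : KSet E r k (⋃ i, A i) := by
  refine ⟨iUnion_subset fun i => (h i).1, fun x hx y hy hyP => ?_⟩
  obtain ⟨i, hi⟩ := mem_iUnion.1 hx
  exact (h i).2 x hi y hy fun hh => hyP (mem_iUnion.2 ⟨i, hh⟩)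

lemma biUnion {ι : Type*} {s : Set ι} {A : ι → Set α} (h : ∀ i ∈ s, KSet E r k (A i)) :
    KSet E r k (⋃ i ∈ s, A i) :=
  iUnion fun i => iUnion fun hi => h i hi

lemma sUnion {s : Set (Set α)} (h : ∀ A ∈ s, KSet E r k A) : KSet E r k (⋃₀ s) := by
  rw [sUnion_eq_biUnion]; exact biUnion h

lemma isClosed (h : KSet E r k P) (hr : 0 < r) (hE : IsClosed E) : IsClosed P := by
  refine isClosed_of_closure_subset fun y hy => ?_
  have hyE : y ∈ E := hE.closure_subset_iff.2 h.1 hy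
  by_contra hyP
  obtain ⟨x, hx, hxy⟩ := Metric.mem_closure_iff.1 hy (r ^ k) (by positivity)
  have := h.2 x hx y hyE hyP
  rw [dist_comm] at this
  linarith

lemma compl (h : KSet E r k P) : KSet E r k (E \ P) := self.diff h

end KSet

/-- `P` and `Q` have finite partitions into corresponding pairs satisfying `T`. -/
inductive Dec {α β : Type*} (T : Set α → Set β → Prop) : Set α → Set β → Prop
  | empty : Dec T ∅ ∅
  | single {P Q} : T P Q → Dec T P Q
  | union {P Q P' Q'} : Dec T P Q → Dec T P' Q' → Disjoint P P' → Disjoint Q Q' →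
      Dec T (P ∪ P') (Q ∪ Q')

namespace Dec

variable {α β : Type*} {T T' : Set α → Set β → Prop} {P : Set α} {Q : Set β}

lemma bind (h : Dec T P Q) (hT : ∀ A B, T A B → A ⊆ P → B ⊆ Q → Dec T' A B) : Dec T' P Q := by
  induction h with
  | empty => exact .empty
  | single h => exact hT _ _ h Subset.rfl Subset.rfl
  | union h h' hd hd' ih ih' =>
    exact .union
      (ih fun A B hAB hA hB =>
        hT A B hAB (hA.trans subset_union_left) (hB.trans subset_union_left))
      (ih' fun A B hAB hA hB =>
        hT A B hAB (hA.trans subset_union_right) (hB.trans subset_union_right)) hd hd'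

lemma mono (h : Dec T P Q) (hT : ∀ A B, T A B → T' A B) : Dec T' P Q :=
  h.bind fun A B hAB _ _ => .single (hT A B hAB)

lemma swap (h : Dec T P Q) : Dec (fun B A => T A B) Q P := by
  induction h with
  | empty => exact .empty
  | single h => exact .single h
  | union h h' hd hd' ih ih' => exact .union ih ih' hd' hd

lemma biUnion {ι : Type*} (s : Finset ι) {A : ι → Set α} {B : ι → Set β}
    (h : ∀ i ∈ s, Dec T (A i) (B i)) (hA : (s : Set ι).PairwiseDisjoint A)
    (hB : (s : Set ι).PairwiseDisjoint B) : Dec T (⋃ i ∈ s, A i) (⋃ i ∈ s, B i) := by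
  classical
  induction s using Finset.induction_on with
  | empty => simpa using Dec.empty
  | insert a s ha ih =>
    rw [Finset.set_biUnion_insert, Finset.set_biUnion_insert]
    refine .union (h a (Finset.mem_insert_self a s))
      (ih (fun i hi => h i (Finset.mem_insert_of_mem hi))
        (hA.subset (by simp)) (hB.subset (by simp))) ?_ ?_
    · refine disjoint_iUnion₂_right.2 fun i hi => hA (by simp) (by simp [hi]) ?_
      rintro rfl; exact ha hi
    · refine disjoint_iUnion₂_right.2 fun i hi => hB (by simp) (by simp [hi]) ?_
      rintro rfl; exact ha hi

lemma exists_family (h : Dec T P Q) : ∃ 𝓒 : Set (Set α × Set β),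
    (∀ c ∈ 𝓒, T c.1 c.2 ∧ c.1 ⊆ P ∧ c.2 ⊆ Q) ∧ (∀ x ∈ P, ∃! c, c ∈ 𝓒 ∧ x ∈ c.1) ∧
    ∀ y ∈ Q, ∃! c, c ∈ 𝓒 ∧ y ∈ c.2 := by
  induction h with
  | empty => exact ⟨∅, by simp, by simp, by simp⟩
  | @single P Q h =>
    refine ⟨{(P, Q)}, by simpa using h, fun x hx => ⟨(P, Q), by simpa using hx, ?_⟩,
      fun x hx => ⟨(P, Q), by simpa using hx, ?_⟩⟩
    · rintro c ⟨hc, -⟩; exact hc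
    · rintro c ⟨hc, -⟩; exact hc
  | @union P Q P' Q' h h' hd hd' ih ih' =>
    obtain ⟨C, h1, h2, h3⟩ := ih
    obtain ⟨C', h1', h2', h3'⟩ := ih'
    refine ⟨C ∪ C', ?_, ?_, ?_⟩
    · rintro c (hc | hc)
      · exact ⟨(h1 c hc).1, (h1 c hc).2.1.trans subset_union_left,
          (h1 c hc).2.2.trans subset_union_left⟩
      · exact ⟨(h1' c hc).1, (h1' c hc).2.1.trans subset_union_right,
          (h1' c hc).2.2.trans subset_union_right⟩
    · rintro x (hx | hx)
      · obtain ⟨c, ⟨hc, hxc⟩, hu⟩ := h2 x hx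
        refine ⟨c, ⟨.inl hc, hxc⟩, ?_⟩
        rintro c' ⟨hc' | hc', hxc'⟩
        · exact hu c' ⟨hc', hxc'⟩
        · exact (disjoint_left.1 hd hx ((h1' c' hc').2.1 hxc')).elim
      · obtain ⟨c, ⟨hc, hxc⟩, hu⟩ := h2' x hx
        refine ⟨c, ⟨.inr hc, hxc⟩, ?_⟩
        rintro c' ⟨hc' | hc', hxc'⟩
        · exact (disjoint_left.1 hd ((h1 c' hc').2.1 hxc') hx).elim
        · exact hu c' ⟨hc', hxc'⟩
    · rintro x (hx | hx)
      · obtain ⟨c, ⟨hc, hxc⟩, hu⟩ := h3 x hx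
        refine ⟨c, ⟨.inl hc, hxc⟩, ?_⟩
        rintro c' ⟨hc' | hc', hxc'⟩
        · exact hu c' ⟨hc', hxc'⟩
        · exact (disjoint_left.1 hd' hx ((h1' c' hc').2.2 hxc')).elim
      · obtain ⟨c, ⟨hc, hxc⟩, hu⟩ := h3' x hx
        refine ⟨c, ⟨.inr hc, hxc⟩, ?_⟩
        rintro c' ⟨hc' | hc', hxc'⟩
        · exact (disjoint_left.1 hd' ((h1 c' hc').2.2 hxc') hx).elim
        · exact hu c' ⟨hc', hxc'⟩

end Dec

lemma exists_nested_point {β : Type*} [MetricSpace β] {F : Set β} (hF : IsCompact F)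
    {c σ : ℝ} (hc : 0 < c) (hσ0 : 0 < σ) (B : ℕ → Set β)
    (hne : ∀ t, (B t).Nonempty) (hanti : ∀ t, B (t + 1) ⊆ B t) (hBF : ∀ t, B t ⊆ F)
    (hsep : ∀ t, ∀ x ∈ B t, ∀ y ∈ F, y ∉ B t → c * σ ^ t ≤ dist x y) :
    ∃ y ∈ F, ∀ t, y ∈ B t := by
  have hcl : ∀ t, IsClosed (B t) := fun t => by
    refine isClosed_of_closure_subset fun y hy => ?_
    have hyE : y ∈ F := hF.isClosed.closure_subset_iff.2 (hBF t) hy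
    by_contra hyP
    obtain ⟨x, hx, hxy⟩ := Metric.mem_closure_iff.1 hy (c * σ ^ t) (by positivity)
    have := hsep t x hx y hyE hyP
    rw [dist_comm] at this
    linarith
  obtain ⟨y, hy⟩ := IsCompact.nonempty_iInter_of_sequence_nonempty_isCompact_isClosed B hanti hne
    (hF.of_isClosed_subset (hcl 0) (hBF 0)) hcl
  rw [mem_iInter] at hy
  exact ⟨y, hBF 0 (hy 0), hy⟩

lemma exists_chain {γ : Type*} (D : ℕ → γ → Prop) (C : ℕ → γ → Set γ) (c0 : γ) (h0 : D 0 c0)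
    (hs : ∀ t c, D t c → ∃ c' ∈ C t c, D (t + 1) c') :
    ∃ N : ℕ → γ, N 0 = c0 ∧ ∀ t, D t (N t) ∧ N (t + 1) ∈ C t (N t) := by
  classical
  let nx : ℕ → γ → γ := fun t c => if h : D t c then (hs t c h).choose else c
  let N : ℕ → γ := fun t => Nat.rec c0 nx t
  have hD : ∀ t, D t (N t) := by
    intro t
    induction t with
    | zero => exact h0
    | succ t ih =>
      change D (t + 1) (nx t (N t))
      simp only [nx, dif_pos ih]
      exact (hs t _ ih).choose_spec.2
  refine ⟨N, rfl, fun t => ⟨hD t, ?_⟩⟩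
  change nx t (N t) ∈ _
  simp only [nx, dif_pos (hD t)]
  exact (hs t _ (hD t)).choose_spec.1

/-- Matching refining partitions of comparable scales give a Lipschitz equivalence. -/
theorem lipEquiv_of_dec {α β : Type*} [MetricSpace α] [MetricSpace β] {E : Set α} {F : Set β}
    (hE : IsCompact E) (hF : IsCompact F) {c K σ : ℝ} (hc : 0 < c) (hσ0 : 0 < σ) (hσ1 : σ < 1)
    (R : ℕ → Set α → Set β → Prop) (h0 : R 0 E F)
    (hstep : ∀ t A B, R t A B → Dec (R (t + 1)) A B)
    (hne : ∀ t A B, R t A B → A.Nonempty ∧ B.Nonempty)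
    (hsub : ∀ t A B, R t A B → A ⊆ E ∧ B ⊆ F)
    (hsepA : ∀ t A B, R t A B → ∀ x ∈ A, ∀ y ∈ E, y ∉ A → c * σ ^ t ≤ dist x y)
    (hsepB : ∀ t A B, R t A B → ∀ x ∈ B, ∀ y ∈ F, y ∉ B → c * σ ^ t ≤ dist x y)
    (hdA : ∀ t A B, R t A B → ∀ x ∈ A, ∀ y ∈ A, dist x y ≤ K * σ ^ t)
    (hdB : ∀ t A B, R t A B → ∀ x ∈ B, ∀ y ∈ B, dist x y ≤ K * σ ^ t) :
    LipEquiv E F := by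
  classical
  have key : ∀ t (q : Set α × Set β), R t q.1 q.2 → ∃ 𝓒 : Set (Set α × Set β),
    (∀ c ∈ 𝓒, R (t + 1) c.1 c.2 ∧ c.1 ⊆ q.1 ∧ c.2 ⊆ q.2) ∧
    (∀ x ∈ q.1, ∃! c, c ∈ 𝓒 ∧ x ∈ c.1) ∧ ∀ y ∈ q.2, ∃! c, c ∈ 𝓒 ∧ y ∈ c.2 :=
    fun t q h => (hstep t _ _ h).exists_family
  choose! 𝓒 h𝓒 h𝓒A h𝓒B using key
  let G : α → β → Prop := fun x y => ∃ N : ℕ → Set α × Set β, N 0 = (E, F) ∧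
    ∀ t, R t (N t).1 (N t).2 ∧ N (t + 1) ∈ 𝓒 t (N t) ∧ x ∈ (N t).1 ∧ y ∈ (N t).2
  have hGx : ∀ x ∈ E, ∃ y ∈ F, G x y := by
    intro x hx
    obtain ⟨N, hN0, hN⟩ := exists_chain (fun t q : _ => R t (q : Set α × Set β).1 q.2 ∧ x ∈ q.1) 𝓒
      (E, F) ⟨h0, hx⟩ (fun t q hq => by
        obtain ⟨q', ⟨h1, h2⟩, -⟩ := h𝓒A t q hq.1 x hq.2
        exact ⟨q', h1, (h𝓒 t q hq.1 q' h1).1, h2⟩)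
    obtain ⟨y, hyF, hy⟩ := exists_nested_point hF hc hσ0 (fun t => (N t).2)
      (fun t => (hne t _ _ (hN t).1.1).2) (fun t => (h𝓒 t _ (hN t).1.1 _ (hN t).2).2.2)
      (fun t => (hsub t _ _ (hN t).1.1).2) (fun t => hsepB t _ _ (hN t).1.1)
    exact ⟨y, hyF, N, hN0, fun t => ⟨(hN t).1.1, (hN t).2, (hN t).1.2, hy t⟩⟩
  have hGy : ∀ y ∈ F, ∃ x ∈ E, G x y := by
    intro y hy
    obtain ⟨N, hN0, hN⟩ := exists_chain (fun t q : _ => R t (q : Set α × Set β).1 q.2 ∧ y ∈ q.2) 𝓒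
      (E, F) ⟨h0, hy⟩ (fun t q hq => by
        obtain ⟨q', ⟨h1, h2⟩, -⟩ := h𝓒B t q hq.1 y hq.2
        exact ⟨q', h1, (h𝓒 t q hq.1 q' h1).1, h2⟩)
    obtain ⟨x, hxE, hx⟩ := exists_nested_point hE hc hσ0 (fun t => (N t).1)
      (fun t => (hne t _ _ (hN t).1.1).1) (fun t => (h𝓒 t _ (hN t).1.1 _ (hN t).2).2.1)
      (fun t => (hsub t _ _ (hN t).1.1).1) (fun t => hsepA t _ _ (hN t).1.1)
    exact ⟨x, hxE, N, hN0, fun t => ⟨(hN t).1.1, (hN t).2, hx t, (hN t).1.2⟩⟩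
  set L : ℝ := max 1 (K / (c * σ)) with hL
  have hL1 : 1 ≤ L := le_max_left _ _
  have hzero : ∀ d : ℝ, 0 ≤ d → (∀ t : ℕ, d ≤ K * σ ^ t) → d = 0 := by
    intro d hd h
    refine le_antisymm ?_ hd
    have : Filter.Tendsto (fun t : ℕ => K * σ ^ t) Filter.atTop (nhds (K * 0)) :=
      (tendsto_pow_atTop_nhds_zero_of_lt_one hσ0.le hσ1).const_mul K
    rw [mul_zero] at this
    exact ge_of_tendsto' this h
  have hG : ∀ x y x' y', G x y → G x' y' →
      dist y y' ≤ L * dist x x' ∧ dist x x' ≤ L * dist y y' := by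
    rintro x y x' y' ⟨N, hN0, hN⟩ ⟨N', hN0', hN'⟩
    by_cases hall : ∀ t, N t = N' t
    · have h1 : dist x x' = 0 := hzero _ dist_nonneg fun t =>
        hdA t _ _ (hN t).1 x (hN t).2.2.1 x' (by rw [hall t]; exact (hN' t).2.2.1)
      have h2 : dist y y' = 0 := hzero _ dist_nonneg fun t =>
        hdB t _ _ (hN t).1 y (hN t).2.2.2 y' (by rw [hall t]; exact (hN' t).2.2.2)
      rw [h1, h2]; simp
    · push Not at hall
      have hfind := Nat.find_spec hall
      have hmin := fun m => @Nat.find_min _ _ hall m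
      generalize Nat.find hall = s at hfind hmin
      rcases s with _ | t
      · exact (hfind (hN0.trans hN0'.symm)).elim
      have heq : N t = N' t := by
        by_contra hh; exact hmin t (Nat.lt_succ_self t) hh
      have hx'A : x' ∉ (N (t + 1)).1 := by
        intro hh
        refine hfind ((h𝓒A t _ (hN t).1 x' (by rw [heq]; exact (hN' t).2.2.1)).unique
          ⟨(hN t).2.1, hh⟩ ⟨?_, (hN' (t + 1)).2.2.1⟩)
        rw [heq]; exact (hN' t).2.1
      have hy'B : y' ∉ (N (t + 1)).2 := by
        intro hh
        refine hfind ((h𝓒B t _ (hN t).1 y' (by rw [heq]; exact (hN' t).2.2.2)).unique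
          ⟨(hN t).2.1, hh⟩ ⟨?_, (hN' (t + 1)).2.2.2⟩)
        rw [heq]; exact (hN' t).2.1
      have hx'E : x' ∈ E := (hsub 0 _ _ (hN' 0).1).1 (hN' 0).2.2.1
      have hy'F : y' ∈ F := (hsub 0 _ _ (hN' 0).1).2 (hN' 0).2.2.2
      have a1 := hsepA _ _ _ (hN (t + 1)).1 x (hN (t + 1)).2.2.1 x' hx'E hx'A
      have b1 := hsepB _ _ _ (hN (t + 1)).1 y (hN (t + 1)).2.2.2 y' hy'F hy'B
      have a2 := hdA _ _ _ (hN t).1 x (hN t).2.2.1 x' (by rw [heq]; exact (hN' t).2.2.1)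
      have b2 := hdB _ _ _ (hN t).1 y (hN t).2.2.2 y' (by rw [heq]; exact (hN' t).2.2.2)
      have hLK : K * σ ^ t ≤ L * (c * σ ^ (t + 1)) := by
        have : K / (c * σ) ≤ L := le_max_right _ _
        rw [div_le_iff₀ (by positivity)] at this
        calc K * σ ^ t ≤ L * (c * σ) * σ ^ t := by gcongr
          _ = _ := by ring
      have hL0 : 0 ≤ L := by linarith
      exact ⟨b2.trans (hLK.trans (by gcongr)), a2.trans (hLK.trans (by gcongr))⟩
  have : Nonempty α := ⟨(hne 0 _ _ h0).1.some⟩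
  have : Nonempty β := ⟨(hne 0 _ _ h0).2.some⟩
  choose! f hfF hfG using hGx
  choose! g hgE hgG using hGy
  refine ⟨f, L, hL1, ⟨fun x hx => hfF x hx, fun x hx x' hx' hxx => ?_, fun y hy => ?_⟩, ?_⟩
  · have := (hG _ _ _ _ (hfG x hx) (hfG x' hx')).2
    rw [hxx, dist_self, mul_zero] at this
    exact dist_le_zero.1 this
  · refine ⟨g y, hgE y hy, ?_⟩
    have := (hG _ _ _ _ (hfG (g y) (hgE y hy)) (hgG y hy)).1
    rw [dist_self, mul_zero] at this
    exact dist_le_zero.1 this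
  · intro x hx y hy
    have := hG _ _ _ _ (hfG x hx) (hfG y hy)
    refine ⟨?_, this.1⟩
    rw [inv_mul_le_iff₀ (by linarith)]
    exact this.2

/-- A block at level `k`: a nonempty separated piece of controlled diameter and measure. -/
def Blk {α : Type*} [MetricSpace α] (E : Set α) (m : Set α → ℝ) (p r C : ℝ) (Φ : Finset ℝ)
    (k : ℕ) (B : Set α) : Prop :=
  KSet E r k B ∧ B.Nonempty ∧ (∀ x ∈ B, ∀ y ∈ B, dist x y ≤ C * r ^ k) ∧ ∃ φ ∈ Φ, m B = p ^ k * φ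

/-- A separated set all of whose separated subsets have measure in `J`. -/
def GK {α : Type*} [MetricSpace α] (E : Set α) (m : Set α → ℝ) (r : ℝ) (J : AddSubgroup ℝ)
    (k : ℕ) (P : Set α) : Prop :=
  KSet E r k P ∧ ∀ l P', P' ⊆ P → KSet E r l P' → m P' ∈ J

/-- Regularity of a set with a measure-like set function, as satisfied by totally disconnected
self-similar sets. -/
structure Reg {α : Type*} [MetricSpace α] (E : Set α) (m : Set α → ℝ) (p r : ℝ) (J : AddSubgroup ℝ)
    (C lo hi κ : ℝ) (Φ : Finset ℝ) : Prop where
  p0 : 0 < p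
  p1 : p < 1
  r0 : 0 < r
  r1 : r < 1
  Jp : ∀ z ∈ J, p * z ∈ J
  Jp' : ∀ z ∈ J, p⁻¹ * z ∈ J
  C0 : 0 < C
  lo0 : 0 < lo
  lohi : lo ≤ hi
  κ0 : 0 < κ
  Φlo : ∀ φ ∈ Φ, lo ≤ φ
  Φhi : ∀ φ ∈ Φ, φ ≤ hi
  add : ∀ k P Q, KSet E r k P → KSet E r k Q → Disjoint P Q → m (P ∪ Q) = m P + m Q
  blocks : ∀ k P, KSet E r k P → ∃ 𝓑 : Finset (Set α), (∀ B ∈ 𝓑, Blk E m p r C Φ k B) ∧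
    (𝓑 : Set (Set α)).PairwiseDisjoint id ∧ ⋃₀ (𝓑 : Set (Set α)) = P
  realize : ∀ z ∈ J, 0 < z → z < κ → ∃ L : ℕ, ∀ k P, KSet E r k P → P.Nonempty →
    ∃ F ⊆ P, GK E m r J (k + L) F ∧ m F = p ^ k * z
  fraction : ∀ ε : ℝ, 0 < ε → ∃ L : ℕ, ∀ k P, KSet E r k P →
    ∃ G ⊆ P, GK E m r J (k + L) G ∧ m P - m G ≤ ε * m P

lemma exists_finset_sums (Φ : Finset ℝ) (N : ℕ) : ∃ Z : Finset ℝ, ∀ (ι : Type _) (s : Finset ι)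
    (f : ι → ℝ), s.card ≤ N → (∀ i ∈ s, f i ∈ Φ) → ∑ i ∈ s, f i ∈ Z := by
  classical
  induction N with
  | zero =>
    refine ⟨{0}, fun ι s f hs _ => ?_⟩
    rw [Nat.le_zero, Finset.card_eq_zero] at hs
    simp [hs]
  | succ N ih =>
    obtain ⟨Z, hZ⟩ := ih
    refine ⟨Z ∪ Finset.image₂ (· + ·) Φ Z, fun ι s f hs hf => ?_⟩
    rcases s.eq_empty_or_nonempty with rfl | ⟨i, hi⟩
    · exact Finset.mem_union_left _ (hZ ι ∅ f (by simp) (by simp))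
    · refine Finset.mem_union_right _ (Finset.mem_image₂.2 ⟨f i, hf i hi, ∑ j ∈ s.erase i, f j,
        hZ ι _ f ?_ fun j hj => hf j (Finset.mem_of_mem_erase hj), Finset.add_sum_erase s f hi⟩)
      rw [Finset.card_erase_of_mem hi]; omega

lemma exists_subset_sum_near {ι : Type*} (s : Finset ι) (f : ι → ℝ) {x ε : ℝ}
    (hf : ∀ i ∈ s, f i ≤ ε) (hx : 0 ≤ x) (hs : x ≤ ∑ i ∈ s, f i) (hε : 0 < ε) :
    ∃ t ⊆ s, ∑ i ∈ t, f i ≤ x ∧ x - ε < ∑ i ∈ t, f i := by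
  classical
  induction s using Finset.induction_on with
  | empty => exact ⟨∅, by simp, by simpa using hx, by simp at hs ⊢; linarith⟩
  | insert a s ha ih =>
    by_cases h : x ≤ ∑ i ∈ s, f i
    · obtain ⟨t, ht, h1, h2⟩ := ih (fun i hi => hf i (Finset.mem_insert_of_mem hi)) h
      exact ⟨t, ht.trans (Finset.subset_insert _ _), h1, h2⟩
    · rw [Finset.sum_insert ha] at hs
      have := hf a (Finset.mem_insert_self a s)
      by_cases h' : f a + ∑ i ∈ s, f i ≤ x
      · exact ⟨insert a s, Finset.Subset.rfl, by rw [Finset.sum_insert ha]; exact h',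
          by rw [Finset.sum_insert ha]; linarith⟩
      · exact ⟨s, Finset.subset_insert _ _, by linarith, by linarith⟩

section basic

variable {α : Type*} [MetricSpace α] {E P Q : Set α} {m : Set α → ℝ} {p r : ℝ} {J : AddSubgroup ℝ}
  {C lo hi κ : ℝ} {Φ : Finset ℝ} {k l : ℕ}

lemma Blk.pos {B : Set α} (h : Reg E m p r J C lo hi κ Φ) (hB : Blk E m p r C Φ k B) :
    p ^ k * lo ≤ m B ∧ m B ≤ p ^ k * hi := by
  obtain ⟨-, -, -, φ, hφ, hm⟩ := hB
  have := h.p0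
  rw [hm]
  exact ⟨by gcongr; exact h.Φlo φ hφ, by gcongr; exact h.Φhi φ hφ⟩

namespace GK

lemma subset (h : GK E m r J k P) (hQP : Q ⊆ P) (hQ : KSet E r l Q) : GK E m r J l Q :=
  ⟨hQ, fun n P' hP' hk => h.2 n P' (hP'.trans hQP) hk⟩

lemma mem (h : GK E m r J k P) : m P ∈ J := h.2 k P Subset.rfl h.1

lemma mono (h : GK E m r J k P) (hr0 : 0 < r) (hr1 : r < 1) (hkl : k ≤ l) : GK E m r J l P :=
  ⟨h.1.mono hr0 hr1 hkl, h.2⟩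

end GK

namespace Reg

variable (h : Reg E m p r J C lo hi κ Φ)
include h

lemma measure_empty : m ∅ = 0 := by
  have := h.add 0 ∅ ∅ KSet.empty KSet.empty (disjoint_empty _)
  rw [union_self] at this
  linarith

lemma hi0 : 0 < hi := h.lo0.trans_le h.lohi

lemma Jpow {z : ℝ} (hz : z ∈ J) (n : ℕ) : p ^ n * z ∈ J := by
  induction n with
  | zero => simpa using hz
  | succ n ih => rw [pow_succ', mul_assoc]; exact h.Jp _ ih

lemma Jpow' {z : ℝ} (hz : z ∈ J) (n : ℕ) : (p ^ n)⁻¹ * z ∈ J := by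
  induction n with
  | zero => simpa using hz
  | succ n ih => rw [pow_succ', mul_inv, mul_assoc]; exact h.Jp' _ ih

lemma add' (hP : KSet E r k P) (hQ : KSet E r l Q) (hd : Disjoint P Q) :
    m (P ∪ Q) = m P + m Q :=
  h.add (max k l) P Q (hP.mono h.r0 h.r1 (le_max_left _ _)) (hQ.mono h.r0 h.r1 (le_max_right _ _))
    hd

lemma sum {ι : Type*} (s : Finset ι) (A : ι → Set α) (hA : ∀ i ∈ s, KSet E r k (A i))
    (hd : (s : Set ι).PairwiseDisjoint A) : m (⋃ i ∈ s, A i) = ∑ i ∈ s, m (A i) := by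
  classical
  induction s using Finset.induction_on with
  | empty => simpa using h.measure_empty
  | insert a s ha ih =>
    rw [Finset.set_biUnion_insert, Finset.sum_insert ha, ← ih
      (fun i hi => hA i (Finset.mem_insert_of_mem hi)) (hd.subset (by simp))]
    refine h.add k _ _ (hA a (Finset.mem_insert_self a s))
      (KSet.biUnion fun i hi => hA i (Finset.mem_insert_of_mem hi)) ?_
    refine disjoint_iUnion₂_right.2 fun i hi => hd (by simp) (by simp [hi]) ?_
    rintro rfl; exact ha hi

lemma sUnion (𝓑 : Finset (Set α)) (hA : ∀ B ∈ 𝓑, KSet E r k B)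
    (hd : (𝓑 : Set (Set α)).PairwiseDisjoint id) : m (⋃₀ (𝓑 : Set (Set α))) = ∑ B ∈ 𝓑, m B := by
  rw [sUnion_eq_biUnion]; exact h.sum 𝓑 id hA hd

lemma nonneg (hP : KSet E r k P) : 0 ≤ m P := by
  obtain ⟨𝓑, h1, h2, rfl⟩ := h.blocks k P hP
  rw [h.sUnion 𝓑 (fun B hB => (h1 B hB).1) h2]
  refine Finset.sum_nonneg fun B hB => le_trans ?_ ((h1 B hB).pos h).1
  have := h.p0
  have := h.lo0
  positivity

lemma diff (hP : KSet E r k P) (hQ : KSet E r l Q) (hQP : Q ⊆ P) : m (P \ Q) = m P - m Q := by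
  have := h.add' (k := max k l) ((hP.mono h.r0 h.r1 (le_max_left _ _)).diff
    (hQ.mono h.r0 h.r1 (le_max_right k l))) hQ disjoint_sdiff_left
  rw [sdiff_union_of_subset hQP] at this
  linarith

lemma mono (hP : KSet E r k P) (hQ : KSet E r l Q) (hQP : Q ⊆ P) : m Q ≤ m P := by
  have h1 := h.diff hP hQ hQP
  have h2 := h.nonneg ((hP.mono h.r0 h.r1 (le_max_left _ _)).diff
    (hQ.mono h.r0 h.r1 (le_max_right k l)))
  linarith

lemma pos (hP : KSet E r k P) (hne : P.Nonempty) : p ^ k * lo ≤ m P := by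
  obtain ⟨𝓑, h1, h2, rfl⟩ := h.blocks k P hP
  obtain ⟨x, B, hB, hx⟩ := hne
  exact ((h1 B hB).pos h).1.trans
    (h.mono hP (h1 B hB).1 (subset_sUnion_of_mem hB))

lemma pos' (hP : KSet E r k P) (hne : P.Nonempty) : 0 < m P :=
  lt_of_lt_of_le (by have := h.p0; have := h.lo0; positivity) (h.pos hP hne)

lemma nonempty (hm : 0 < m P) : P.Nonempty := by
  rw [nonempty_iff_ne_empty]; rintro rfl
  rw [h.measure_empty] at hm; exact lt_irrefl _ hm

lemma good_union (hP : GK E m r J k P) (hQ : GK E m r J l Q) : GK E m r J (max k l) (P ∪ Q) := by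
  have hP' := hP.1.mono h.r0 h.r1 (le_max_left k l)
  have hQ' := hQ.1.mono h.r0 h.r1 (le_max_right k l)
  refine ⟨hP'.union hQ', fun n P' hP'' hn => ?_⟩
  have e1 := hn.mono h.r0 h.r1 (le_max_left n (max k l))
  have e2 := hP'.mono h.r0 h.r1 (le_max_right n (max k l))
  have := h.add' (e1.inter e2) (e1.diff e2) (disjoint_sdiff_right.mono_left inter_subset_right)
  rw [inter_union_sdiff] at this
  rw [this]
  refine J.add_mem (hP.2 _ _ inter_subset_right (e1.inter e2)) (hQ.2 _ _ ?_ (e1.diff e2))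
  rintro x ⟨hx, hxP⟩
  exact (hP'' hx).resolve_left hxP

lemma good_biUnion {ι : Type*} (s : Finset ι) (A : ι → Set α) (hA : ∀ i ∈ s, GK E m r J k (A i)) :
    GK E m r J k (⋃ i ∈ s, A i) := by
  classical
  induction s using Finset.induction_on with
  | empty =>
    simp only [Finset.notMem_empty, iUnion_of_empty, iUnion_empty]
    refine ⟨KSet.empty, fun l P' hP' _ => ?_⟩
    rw [subset_empty_iff.1 hP', h.measure_empty]; exact J.zero_mem
  | insert a s ha ih =>
    rw [Finset.set_biUnion_insert]
    have := h.good_union (hA a (Finset.mem_insert_self a s))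
      (ih fun i hi => hA i (Finset.mem_insert_of_mem hi))
    rwa [max_self] at this

lemma card_blocks (𝓑 : Finset (Set α)) (hB : ∀ B ∈ 𝓑, Blk E m p r C Φ k B)
    (hd : (𝓑 : Set (Set α)).PairwiseDisjoint id) :
    𝓑.card * (p ^ k * lo) ≤ m (⋃₀ (𝓑 : Set (Set α))) ∧
      m (⋃₀ (𝓑 : Set (Set α))) ≤ 𝓑.card * (p ^ k * hi) := by
  rw [h.sUnion 𝓑 (fun B hB' => (hB B hB').1) hd]
  constructor
  · rw [← nsmul_eq_mul]
    exact Finset.card_nsmul_le_sum _ _ _ fun B hB' => ((hB B hB').pos h).1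
  · rw [← nsmul_eq_mul]
    exact Finset.sum_le_card_nsmul _ _ _ fun B hB' => ((hB B hB').pos h).2

lemma realize_finset (Z : Finset ℝ) : ∃ L : ℕ, ∀ z ∈ Z, z ∈ J → 0 < z → z < κ →
    ∀ k P, KSet E r k P → P.Nonempty → ∃ F ⊆ P, GK E m r J (k + L) F ∧ m F = p ^ k * z := by
  classical
  have : ∀ z : ℝ, ∃ L : ℕ, z ∈ J → 0 < z → z < κ →
    ∀ k P, KSet E r k P → P.Nonempty → ∃ F ⊆ P, GK E m r J (k + L) F ∧ m F = p ^ k * z := by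
    intro z
    by_cases hz : z ∈ J ∧ 0 < z ∧ z < κ
    · obtain ⟨L, hL⟩ := h.realize z hz.1 hz.2.1 hz.2.2
      exact ⟨L, fun _ _ _ => hL⟩
    · exact ⟨0, fun h1 h2 h3 => (hz ⟨h1, h2, h3⟩).elim⟩
  choose L hL using this
  refine ⟨Z.sup L, fun z hz h1 h2 h3 k P hP hne => ?_⟩
  obtain ⟨F, hF, hG, hm⟩ := hL z h1 h2 h3 k P hP hne
  exact ⟨F, hF, hG.mono h.r0 h.r1 (Nat.add_le_add_left (Finset.le_sup hz) k), hm⟩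

lemma exists_pow_lt {x : ℝ} (hx : 0 < x) (y : ℝ) : ∃ M : ℕ, ∀ n ≥ M, p ^ n * y < x := by
  have ht : Filter.Tendsto (fun n : ℕ => p ^ n * y) Filter.atTop (nhds (0 * y)) :=
    (tendsto_pow_atTop_nhds_zero_of_lt_one h.p0.le h.p1).mul_const y
  rw [zero_mul] at ht
  exact Filter.eventually_atTop.1 (ht.eventually (gt_mem_nhds hx))

lemma split {x y : ℝ} (hxJ : x ∈ J) (hx : 0 < x) (hy : 0 < y) :
    ∃ L : ℕ, ∀ k B, GK E m r J k B → m B = p ^ k * (x + y) →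
      ∃ B' ⊆ B, KSet E r (k + L) B' ∧ m B' = p ^ k * x := by
  classical
  have p0 := h.p0
  have lo0 := h.lo0
  obtain ⟨M, hM⟩ := h.exists_pow_lt hy hi
  replace hM := hM M le_rfl
  obtain ⟨M', hM'⟩ := h.exists_pow_lt (x := κ * p ^ M) (mul_pos h.κ0 (by positivity)) hi
  obtain ⟨M1, hMM1, hM1⟩ : ∃ M1, M ≤ M1 ∧ p ^ M1 * hi < κ * p ^ M :=
    ⟨max M M', le_max_left _ _, hM' _ (le_max_right _ _)⟩
  obtain ⟨N, hN⟩ := exists_nat_ge ((x + y) / (p ^ M1 * lo))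
  obtain ⟨Z, hZ⟩ := exists_finset_sums Φ N
  obtain ⟨L, hL⟩ := h.realize_finset (Z.image fun s => (p ^ M)⁻¹ * (x - p ^ M1 * s))
  refine ⟨max M1 (M + L), fun k B hB hmB => ?_⟩
  have hpk : 0 < p ^ k := by positivity
  have hBne : B.Nonempty := h.nonempty (by rw [hmB]; positivity)
  obtain ⟨𝓑, h1, h2, h3⟩ := h.blocks (k + M) B (hB.1.mono h.r0 h.r1 (Nat.le_add_right _ _))
  obtain ⟨R, hR𝓑⟩ : 𝓑.Nonempty := by
    rw [Finset.nonempty_iff_ne_empty]; rintro rfl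
    simp at h3; rw [← h3] at hBne; exact not_nonempty_empty hBne
  have hRB : R ⊆ B := by rw [← h3]; exact subset_sUnion_of_mem hR𝓑
  have hRk := h1 R hR𝓑
  have hmR : m R < p ^ k * y := by
    refine (hRk.pos h).2.trans_lt ?_
    rw [pow_add, mul_assoc]
    exact mul_lt_mul_of_pos_left hM hpk
  have hBR : KSet E r (k + M1) (B \ R) :=
    ((hB.1.mono h.r0 h.r1 (Nat.le_add_right _ _)).diff hRk.1).mono h.r0 h.r1 (by omega)
  have hmBR : m (B \ R) = m B - m R := h.diff hB.1 hRk.1 hRB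
  obtain ⟨𝓓, d1, d2, d3⟩ := h.blocks (k + M1) (B \ R) hBR
  have hsum := h.sUnion 𝓓 (fun D hD => (d1 D hD).1) d2
  rw [d3] at hsum
  obtain ⟨𝓣, hT, ht1, ht2⟩ := exists_subset_sum_near 𝓓 m (x := p ^ k * x)
    (ε := p ^ (k + M1) * hi) (fun D hD => ((d1 D hD).pos h).2) (by positivity)
    (by rw [← hsum, hmBR, hmB]; linarith) (by have := h.hi0; positivity)
  have hd' : (𝓣 : Set (Set α)).PairwiseDisjoint id := d2.subset (by exact_mod_cast hT)
  have hT1 : ∀ D ∈ 𝓣, Blk E m p r C Φ (k + M1) D := fun D hD => d1 D (hT hD)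
  have hsT := h.sUnion 𝓣 (fun D hD => (hT1 D hD).1) hd'
  have hcT := (h.card_blocks 𝓣 hT1 hd').1
  set G := ⋃₀ (𝓣 : Set (Set α)) with hG
  have hGK : KSet E r (k + M1) G := KSet.sUnion fun D hD => (hT1 D hD).1
  have hGBR : G ⊆ B \ R := by
    rw [← d3]; exact sUnion_subset_sUnion (by exact_mod_cast hT)
  rw [← hsT] at ht1 ht2
  have hmG : m G ∈ J := hB.2 _ _ (hGBR.trans sdiff_subset) hGK
  rcases ht1.eq_or_lt with heq | hlt
  · exact ⟨G, hGBR.trans sdiff_subset, hGK.mono h.r0 h.r1 (by omega), heq⟩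
  · choose! φ hφ hφm using fun D hD => (hT1 D hD).2.2.2
    have hGφ : m G = p ^ k * (p ^ M1 * ∑ D ∈ 𝓣, φ D) := by
      rw [hsT, Finset.mul_sum, Finset.mul_sum]
      exact Finset.sum_congr rfl fun D hD => by rw [hφm D hD, pow_add, mul_assoc]
    have hcard : 𝓣.card ≤ N := by
      have : (𝓣.card : ℝ) ≤ (x + y) / (p ^ M1 * lo) := by
        rw [le_div_iff₀ (by positivity)]
        have e : (𝓣.card : ℝ) * (p ^ (k + M1) * lo) ≤ p ^ k * (x + y) := by
          refine hcT.trans (ht1.trans ?_); gcongr; linarith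
        refine le_of_mul_le_mul_left ?_ hpk
        rw [pow_add] at e
        linarith
      exact_mod_cast this.trans hN
    set z := (p ^ M)⁻¹ * (x - p ^ M1 * ∑ D ∈ 𝓣, φ D) with hz
    have hzm : p ^ (k + M) * z = p ^ k * x - m G := by
      rw [hGφ, hz, pow_add]; field_simp
    have hzJ : z ∈ J := by
      have e : z = (p ^ (k + M))⁻¹ * (p ^ k * x - m G) := by
        rw [← hzm, inv_mul_cancel_left₀ (by positivity)]
      rw [e]
      exact h.Jpow' (J.sub_mem (h.Jpow hxJ k) hmG) _
    have hz0 : 0 < z := by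
      have : 0 < p ^ (k + M) * z := by rw [hzm]; linarith
      exact (mul_pos_iff_of_pos_left (by positivity)).1 this
    have hzκ : z < κ := by
      have e : p ^ (k + M) * z < p ^ (k + M) * κ := by
        rw [hzm]
        have : p ^ (k + M1) * hi < p ^ (k + M) * κ := by
          rw [pow_add, pow_add, mul_assoc, mul_assoc]
          refine mul_lt_mul_of_pos_left ?_ hpk
          linarith
        linarith
      exact lt_of_mul_lt_mul_left e (by positivity)
    obtain ⟨F, hFR, hF, hmF⟩ := hL z (Finset.mem_image_of_mem _ (hZ _ 𝓣 φ hcard hφ)) hzJ hz0 hzκ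
      (k + M) R hRk.1 hRk.2.1
    have hdis : Disjoint G F := (disjoint_sdiff_left.mono_left hGBR).mono_right hFR
    refine ⟨G ∪ F, union_subset (hGBR.trans sdiff_subset) (hFR.trans hRB),
      (hGK.mono h.r0 h.r1 (by omega)).union (hF.1.mono h.r0 h.r1 (by omega)), ?_⟩
    rw [h.add' hGK hF.1 hdis, hmF, hzm]; ring

end Reg

end basic

lemma exists_finset_minimal {γ : Type*} [PartialOrder γ] [WellQuasiOrderedLE γ] (S : Set γ) :
    ∃ T : Finset γ, (∀ t ∈ T, t ∈ S) ∧ ∀ s ∈ S, ∃ t ∈ T, t ≤ s := by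
  have hf : {t | Minimal (· ∈ S) t}.Finite :=
    WellQuasiOrderedLE.finite_of_isAntichain (setOfPred_minimal_antichain _)
  refine ⟨hf.toFinset, fun t ht => ((hf.mem_toFinset).1 ht).1, fun s hs => ?_⟩
  obtain ⟨t, hts, ht⟩ := (Set.isPWO_of_wellQuasiOrderedLE S).exists_le_minimal hs
  exact ⟨t, (hf.mem_toFinset).2 ht, hts⟩

lemma wellQuasiOrderedLE_multiset (ι : Type*) [Finite ι] : WellQuasiOrderedLE (Multiset ι) := by
  classical
  refine ⟨fun f => ?_⟩
  obtain ⟨i, j, hij, hle⟩ := (wellQuasiOrdered_le (α := ι →₀ ℕ)) (fun n => Multiset.toFinsupp (f n))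
  exact ⟨i, j, hij, Finsupp.orderIsoMultiset.symm.le_iff_le.1 hle⟩

lemma Multiset.exists_le_map_eq {ι κ : Type*} (f : ι → κ) (s : Multiset ι) (u : Multiset κ)
    (h : u ≤ s.map f) : ∃ t ≤ s, t.map f = u := by
  classical
  induction s using Multiset.induction_on generalizing u with
  | empty => exact ⟨0, le_rfl, by rw [Multiset.map_zero, Multiset.le_zero] at h; simp [h]⟩
  | cons a s ih =>
    rw [Multiset.map_cons] at h
    by_cases ha : f a ∈ u
    · obtain ⟨t, ht, hu⟩ := ih (u.erase (f a)) (Multiset.erase_le_iff_le_cons.2 h)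
      exact ⟨a ::ₘ t, Multiset.cons_le_cons a ht, by rw [Multiset.map_cons, hu,
        Multiset.cons_erase ha]⟩
    · obtain ⟨t, ht, hu⟩ := ih u ((Multiset.le_cons_of_notMem ha).1 h)
      exact ⟨t, ht.trans (Multiset.le_cons_self s a), hu⟩

lemma Finset.exists_subset_map_eq {ι κ : Type*} (f : ι → κ) (s : Finset ι) (u : Multiset κ)
    (h : u ≤ s.val.map f) : ∃ t ⊆ s, t.val.map f = u := by
  obtain ⟨t, ht, hu⟩ := Multiset.exists_le_map_eq f s.val u h
  exact ⟨⟨t, Multiset.nodup_of_le ht s.nodup⟩, Finset.val_le_iff.1 ht, hu⟩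

lemma sUnion_eq_union_sdiff {γ : Type*} [DecidableEq (Set γ)] {s t : Finset (Set γ)} (hts : t ⊆ s) :
    ⋃₀ (s : Set (Set γ)) = ⋃₀ (t : Set (Set γ)) ∪ ⋃₀ ((s \ t : Finset (Set γ)) : Set (Set γ)) := by
  rw [← sUnion_union, ← Finset.coe_union, Finset.union_sdiff_of_subset hts]

lemma disjoint_sUnion_sdiff {γ : Type*} [DecidableEq (Set γ)] {s t : Finset (Set γ)} (hts : t ⊆ s)
    (hd : (s : Set (Set γ)).PairwiseDisjoint id) :
    Disjoint (⋃₀ (t : Set (Set γ))) (⋃₀ ((s \ t : Finset (Set γ)) : Set (Set γ))) := by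
  refine disjoint_sUnion_left.2 fun a ha => disjoint_sUnion_right.2 fun b hb => ?_
  rw [Finset.mem_coe, Finset.mem_sdiff] at hb
  exact hd (hts ha) hb.1 (by rintro rfl; exact hb.2 ha)

namespace Reg

variable {α β : Type*} [MetricSpace α] [MetricSpace β] {E : Set α} {F : Set β} {m : Set α → ℝ}
  {m' : Set β → ℝ} {p r : ℝ} {J : AddSubgroup ℝ} {C lo hi κ : ℝ} {Φ : Finset ℝ}

omit [MetricSpace α] in
lemma partition (h' : Reg F m' p r J C lo hi κ Φ) (n : ℕ) (M : Multiset ℝ) (hn : M.card = n)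
    (hM : ∀ x ∈ M, x ∈ J ∧ 0 < x) :
    ∃ L : ℕ, ∀ k' B, GK F m' r J k' B → ∀ (𝓐 : Finset (Set α)) (x : Set α → ℝ),
      𝓐.val.map x = M → m' B = p ^ k' * M.sum → (𝓐 : Set (Set α)).PairwiseDisjoint id →
      Dec (fun A' B' => A' ∈ 𝓐 ∧ GK F m' r J (k' + L) B' ∧ m' B' = p ^ k' * x A')
        (⋃₀ (𝓐 : Set (Set α))) B := by
  classical
  have p0 := h'.p0
  induction n generalizing M with
  | zero =>
    rw [Multiset.card_eq_zero] at hn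
    subst hn
    refine ⟨0, fun k' B hB 𝓐 x h𝓐 hm _ => ?_⟩
    have h1 : 𝓐 = ∅ := by simpa using h𝓐
    have h2 : B = ∅ := by
      by_contra hne
      have := h'.pos' hB.1 (nonempty_iff_ne_empty.2 hne)
      simp at hm; linarith
    subst h1; subst h2
    simpa using Dec.empty
  | succ n ih =>
    obtain ⟨z, M1, rfl, hM1⟩ := Multiset.card_eq_succ_iff.1 hn
    have hz := hM z (Multiset.mem_cons_self z M1)
    have hM1' : ∀ x ∈ M1, x ∈ J ∧ 0 < x := fun x hx => hM x (Multiset.mem_cons_of_mem hx)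
    have hsplit : ∀ (𝓐 : Finset (Set α)) (x : Set α → ℝ), 𝓐.val.map x = z ::ₘ M1 →
        ∃ A0 ∈ 𝓐, x A0 = z ∧ (𝓐.erase A0).val.map x = M1 := by
      intro 𝓐 x hx
      obtain ⟨A0, hA0, hxz⟩ := Multiset.mem_map.1 (hx ▸ Multiset.mem_cons_self z M1)
      refine ⟨A0, hA0, hxz, ?_⟩
      rw [← Multiset.cons_erase hA0, Multiset.map_cons, hxz] at hx
      rw [Finset.erase_val]
      exact (Multiset.cons_inj_right z).1 hx
    rcases Multiset.empty_or_exists_mem M1 with rfl | ⟨w, hw⟩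
    · refine ⟨0, fun k' B hB 𝓐 x h𝓐 hm _ => ?_⟩
      obtain ⟨A0, hA0, hxz, h0⟩ := hsplit 𝓐 x h𝓐
      have h1 : 𝓐 = {A0} := by
        have : 𝓐.erase A0 = ∅ := Finset.val_eq_zero.1 (Multiset.map_eq_zero.1 h0)
        rw [← Finset.insert_erase hA0, this]; rfl
      rw [h1]
      simp only [Finset.coe_singleton, sUnion_singleton]
      exact .single ⟨by simp, hB, by simpa [hxz] using hm⟩
    · have hs : 0 < M1.sum := by
        obtain ⟨M2, rfl⟩ := Multiset.exists_cons_of_mem hw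
        rw [Multiset.sum_cons]
        have h1 := (hM1' w (Multiset.mem_cons_self _ _)).2
        have h2 : 0 ≤ M2.sum := Multiset.sum_nonneg fun x hx =>
          (hM1' x (Multiset.mem_cons_of_mem hx)).2.le
        linarith
      obtain ⟨L1, hL1⟩ := h'.split hz.1 hz.2 hs
      obtain ⟨L2, hL2⟩ := ih (M1.map fun x => (p ^ L1)⁻¹ * x) (by simpa using hM1) (by
        intro x hx
        obtain ⟨y, hy, rfl⟩ := Multiset.mem_map.1 hx
        exact ⟨h'.Jpow' (hM1' y hy).1 _, by have := (hM1' y hy).2; positivity⟩)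
      refine ⟨L1 + L2, fun k' B hB 𝓐 x h𝓐 hm hd => ?_⟩
      obtain ⟨A0, hA0, hxz, h0⟩ := hsplit 𝓐 x h𝓐
      rw [Multiset.sum_cons] at hm
      obtain ⟨B', hB'B, hB', hmB'⟩ := hL1 k' B hB hm
      have hGB' : GK F m' r J (k' + (L1 + L2)) B' := hB.subset hB'B
        (hB'.mono h'.r0 h'.r1 (by omega))
      have hGB2 : GK F m' r J (k' + L1) (B \ B') := hB.subset sdiff_subset
        ((hB.1.mono h'.r0 h'.r1 (by omega)).diff hB')
      have hmB2 : m' (B \ B') = p ^ (k' + L1) * (M1.map fun x => (p ^ L1)⁻¹ * x).sum := by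
        rw [h'.diff hB.1 hB' hB'B, hm, hmB', Multiset.sum_map_mul_left, Multiset.map_id', pow_add]
        field_simp
        ring
      have hdec := hL2 (k' + L1) (B \ B') hGB2 (𝓐.erase A0) (fun A => (p ^ L1)⁻¹ * x A)
        (by rw [← h0, Multiset.map_map]; rfl) hmB2 (hd.subset (by simp))
      have e1 : ⋃₀ (𝓐 : Set (Set α)) = A0 ∪ ⋃₀ ((𝓐.erase A0 : Finset (Set α)) : Set (Set α)) := by
        conv_lhs => rw [← Finset.insert_erase hA0]
        rw [Finset.coe_insert, sUnion_insert]
      rw [e1, ← union_sdiff_cancel hB'B]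
      refine .union (.single ⟨hA0, hGB', by rw [hmB', hxz]⟩) (hdec.mono ?_) ?_ disjoint_sdiff_right
      · rintro A' B'' ⟨hA', hB'', hmm⟩
        refine ⟨Finset.mem_of_mem_erase hA', by rw [← add_assoc]; exact hB'', ?_⟩
        rw [hmm, pow_add]; field_simp
      · refine disjoint_sUnion_right.2 fun A hA => hd hA0 (Finset.mem_of_mem_erase hA) ?_
        rintro rfl
        exact (Finset.notMem_erase _ 𝓐) hA

/-- Splitting an exact pair so that the pieces of the first member are blocks. -/
lemma half_step (h : Reg E m p r J C lo hi κ Φ) (h' : Reg F m' p r J C lo hi κ Φ) :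
    ∃ L : ℕ, ∀ k k' A B, GK E m r J k A → GK F m' r J k' B → m A * p ^ k' = m' B * p ^ k →
      Dec (fun A' B' => Blk E m p r C Φ k A' ∧ GK E m r J k A' ∧ GK F m' r J (k' + L) B' ∧
        m A' * p ^ k' = m' B' * p ^ k) A B := by
  classical
  have p0 := h.p0
  have := wellQuasiOrderedLE_multiset {φ // φ ∈ Φ}
  let val : {φ // φ ∈ Φ} → ℝ := Subtype.val
  have hval : ∀ φ, 0 < val φ := fun φ => h.lo0.trans_le (h.Φlo _ φ.2)
  have hsum0 : ∀ u : Multiset {φ // φ ∈ Φ}, (u.map val).sum = 0 → u = 0 := by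
    intro u hu
    rcases Multiset.empty_or_exists_mem u with h0 | ⟨w, hw⟩
    · exact h0
    · obtain ⟨u2, rfl⟩ := Multiset.exists_cons_of_mem hw
      rw [Multiset.map_cons, Multiset.sum_cons] at hu
      have h2 : 0 ≤ (u2.map val).sum := Multiset.sum_nonneg fun x hx => by
        obtain ⟨y, -, rfl⟩ := Multiset.mem_map.1 hx
        exact (hval y).le
      have := hval w
      linarith
  obtain ⟨T, hTS, hT⟩ := exists_finset_minimal
    {q : Multiset {φ // φ ∈ Φ} × Multiset {φ // φ ∈ Φ} |
      (q.1.map val).sum = (q.2.map val).sum ∧ q ≠ 0 ∧ ∀ φ ∈ q.1, val φ ∈ J}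
  have hpart : ∀ q : Multiset {φ // φ ∈ Φ} × Multiset {φ // φ ∈ Φ}, ∃ L : ℕ, q ∈ T →
      ∀ k' B, GK F m' r J k' B → ∀ (𝓐 : Finset (Set α)) (x : Set α → ℝ),
      𝓐.val.map x = q.1.map val → m' B = p ^ k' * (q.1.map val).sum →
      (𝓐 : Set (Set α)).PairwiseDisjoint id →
      Dec (fun A' B' => A' ∈ 𝓐 ∧ GK F m' r J (k' + L) B' ∧ m' B' = p ^ k' * x A')
        (⋃₀ (𝓐 : Set (Set α))) B := by
    intro q
    by_cases hq : q ∈ T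
    · obtain ⟨L, hL⟩ := partition (α := α) h' _ (q.1.map val) rfl (fun x hx => by
        obtain ⟨y, hy, rfl⟩ := Multiset.mem_map.1 hx
        exact ⟨(hTS q hq).2.2 y hy, hval y⟩)
      exact ⟨L, fun _ => hL⟩
    · exact ⟨0, fun h => (hq h).elim⟩
  choose L hL using hpart
  refine ⟨T.sup L, fun k k' A B hA hB hAB => ?_⟩
  have claim : ∀ (n : ℕ) (𝓐 : Finset (Set α)) (𝓑 : Finset (Set β))
      (x : Set α → {φ // φ ∈ Φ}) (y : Set β → {φ // φ ∈ Φ}), 𝓐.card = n →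
      (∀ A ∈ 𝓐, Blk E m p r C Φ k A ∧ GK E m r J k A ∧ m A = p ^ k * val (x A)) →
      (∀ B ∈ 𝓑, GK F m' r J k' B ∧ m' B = p ^ k' * val (y B)) →
      (𝓐 : Set (Set α)).PairwiseDisjoint id → (𝓑 : Set (Set β)).PairwiseDisjoint id →
      ((𝓐.val.map x).map val).sum = ((𝓑.val.map y).map val).sum →
      Dec (fun A' B' => Blk E m p r C Φ k A' ∧ GK E m r J k A' ∧ GK F m' r J (k' + T.sup L) B' ∧
        m A' * p ^ k' = m' B' * p ^ k) (⋃₀ (𝓐 : Set (Set α))) (⋃₀ (𝓑 : Set (Set β))) := by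
    intro n
    induction n using Nat.strong_induction_on with
    | _ n ih =>
    intro 𝓐 𝓑 x y hn h𝓐 h𝓑 hdA hdB hs
    rcases 𝓐.eq_empty_or_nonempty with rfl | ⟨A1, hA1⟩
    · have : 𝓑.val.map y = 0 := hsum0 _ (by rw [← hs]; simp)
      have : 𝓑 = ∅ := by simpa using this
      subst this
      simpa using Dec.empty
    · obtain ⟨q, hqT, hq⟩ := hT (𝓐.val.map x, 𝓑.val.map y) ⟨hs, fun h0 => by
          have : 𝓐.val.map x = 0 := congrArg Prod.fst h0
          rw [Multiset.map_eq_zero, Finset.val_eq_zero] at this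
          subst this; simp at hA1, fun φ hφ => by
          obtain ⟨A, hA, rfl⟩ := Multiset.mem_map.1 hφ
          have e : val (x A) = (p ^ k)⁻¹ * m A := by
            rw [(h𝓐 A hA).2.2, inv_mul_cancel_left₀ (by positivity)]
          rw [e]
          exact h.Jpow' (h𝓐 A hA).2.1.mem k⟩
      obtain ⟨hq1, hq2, -⟩ := hTS q hqT
      obtain ⟨𝓐0, h𝓐0, ha0⟩ := Finset.exists_subset_map_eq x 𝓐 q.1 hq.1
      obtain ⟨𝓑0, h𝓑0, hb0⟩ := Finset.exists_subset_map_eq y 𝓑 q.2 hq.2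
      have hq10 : q.1 ≠ 0 := by
        intro h0
        refine hq2 (Prod.ext h0 (hsum0 _ ?_))
        rw [← hq1, h0]; simp
      have hsub : ∀ 𝓑1 ⊆ 𝓑, GK F m' r J k' (⋃₀ (𝓑1 : Set (Set β))) := by
        intro 𝓑1 h1
        have := h'.good_biUnion 𝓑1 id fun i hi => (h𝓑 i (h1 hi)).1
        rw [sUnion_eq_biUnion]; exact this
      have hm0 : m' (⋃₀ (𝓑0 : Set (Set β))) = p ^ k' * (q.1.map val).sum := by
        rw [h'.sUnion 𝓑0 (fun D hD => (h𝓑 D (h𝓑0 hD)).1.1) (hdB.subset (by exact_mod_cast h𝓑0)),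
          hq1, ← hb0, Multiset.map_map]
        change _ = p ^ k' * ∑ D ∈ 𝓑0, val (y D)
        rw [Finset.mul_sum]
        exact Finset.sum_congr rfl fun D hD => (h𝓑 D (h𝓑0 hD)).2
      have dec1 := hL q hqT k' _ (hsub 𝓑0 h𝓑0) 𝓐0 (fun A => val (x A))
        (by rw [← ha0, Multiset.map_map]; rfl) hm0 (hdA.subset (by exact_mod_cast h𝓐0))
      have hc : (𝓐 \ 𝓐0).card < n := by
        rw [← hn]
        refine Finset.card_lt_card (Finset.ssubset_iff_subset_ne.2 ⟨Finset.sdiff_subset, ?_⟩)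
        intro h0
        refine hq10 ?_
        rw [← ha0]
        have : 𝓐0 = ∅ := by
          rw [Finset.sdiff_eq_self_iff_disjoint] at h0
          exact Finset.disjoint_self_iff_empty _ |>.1 (h0.mono_left h𝓐0)
        rw [this]; rfl
      have hvA : 𝓐.val.map x = 𝓐0.val.map x + (𝓐 \ 𝓐0).val.map x := by
        rw [← Multiset.map_add]
        congr 1
        rw [Finset.sdiff_val]
        exact (add_tsub_cancel_of_le (Finset.val_le_iff.2 h𝓐0)).symm
      have hvB : 𝓑.val.map y = 𝓑0.val.map y + (𝓑 \ 𝓑0).val.map y := by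
        rw [← Multiset.map_add]
        congr 1
        rw [Finset.sdiff_val]
        exact (add_tsub_cancel_of_le (Finset.val_le_iff.2 h𝓑0)).symm
      have dec2 := ih _ hc (𝓐 \ 𝓐0) (𝓑 \ 𝓑0) x y rfl
        (fun A hA => h𝓐 A (Finset.sdiff_subset hA)) (fun D hD => h𝓑 D (Finset.sdiff_subset hD))
        (hdA.subset (by simp)) (hdB.subset (by simp)) (by
          rw [hvA, hvB, ha0, hb0] at hs
          simp only [Multiset.map_add, Multiset.sum_add] at hs
          linarith)
      rw [sUnion_eq_union_sdiff h𝓐0, sUnion_eq_union_sdiff h𝓑0]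
      refine .union (dec1.mono ?_) dec2 (disjoint_sUnion_sdiff h𝓐0 hdA) (disjoint_sUnion_sdiff h𝓑0 hdB)
      rintro A' B' ⟨hA', hB', hmm⟩
      have hA'' := h𝓐 A' (h𝓐0 hA')
      refine ⟨hA''.1, hA''.2.1,
        hB'.mono h'.r0 h'.r1 (Nat.add_le_add_left (Finset.le_sup hqT) k'), ?_⟩
      rw [hA''.2.2, hmm]; ring
  obtain ⟨𝓐, a1, a2, a3⟩ := h.blocks k A hA.1
  obtain ⟨𝓑, b1, b2, b3⟩ := h'.blocks k' B hB.1
  rcases isEmpty_or_nonempty {φ // φ ∈ Φ} with hemp | ⟨⟨φ0⟩⟩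
  · have hA0 : 𝓐 = ∅ := by
      rw [Finset.eq_empty_iff_forall_notMem]
      intro D hD
      obtain ⟨φ, hφ, -⟩ := (a1 D hD).2.2.2
      exact hemp.false ⟨φ, hφ⟩
    have hB0 : 𝓑 = ∅ := by
      rw [Finset.eq_empty_iff_forall_notMem]
      intro D hD
      obtain ⟨φ, hφ, -⟩ := (b1 D hD).2.2.2
      exact hemp.false ⟨φ, hφ⟩
    subst hA0; subst hB0
    rw [← a3, ← b3]
    simpa using Dec.empty
  · have ha : ∀ D, ∃ φ : {φ // φ ∈ Φ}, D ∈ 𝓐 → m D = p ^ k * val φ := by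
      intro D
      by_cases hD : D ∈ 𝓐
      · obtain ⟨φ, hφ, hm⟩ := (a1 D hD).2.2.2
        exact ⟨⟨φ, hφ⟩, fun _ => hm⟩
      · exact ⟨φ0, fun h => (hD h).elim⟩
    have hb : ∀ D, ∃ φ : {φ // φ ∈ Φ}, D ∈ 𝓑 → m' D = p ^ k' * val φ := by
      intro D
      by_cases hD : D ∈ 𝓑
      · obtain ⟨φ, hφ, hm⟩ := (b1 D hD).2.2.2
        exact ⟨⟨φ, hφ⟩, fun _ => hm⟩
      · exact ⟨φ0, fun h => (hD h).elim⟩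
    choose x hx using ha
    choose y hy using hb
    rw [← a3, ← b3]
    refine claim _ 𝓐 𝓑 x y rfl (fun D hD => ⟨a1 D hD, hA.subset ?_ (a1 D hD).1, hx D hD⟩)
      (fun D hD => ⟨hB.subset ?_ (b1 D hD).1, hy D hD⟩) a2 b2 ?_
    · rw [← a3]; exact subset_sUnion_of_mem hD
    · rw [← b3]; exact subset_sUnion_of_mem hD
    · have e1 : m A = p ^ k * ((𝓐.val.map x).map val).sum := by
        rw [← a3, h.sUnion 𝓐 (fun D hD => (a1 D hD).1) a2, Multiset.map_map]
        change _ = p ^ k * ∑ D ∈ 𝓐, val (x D)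
        rw [Finset.mul_sum]
        exact Finset.sum_congr rfl hx
      have e2 : m' B = p ^ k' * ((𝓑.val.map y).map val).sum := by
        rw [← b3, h'.sUnion 𝓑 (fun D hD => (b1 D hD).1) b2, Multiset.map_map]
        change _ = p ^ k' * ∑ D ∈ 𝓑, val (y D)
        rw [Finset.mul_sum]
        exact Finset.sum_congr rfl hy
      rw [e1, e2] at hAB
      have : p ^ k * p ^ k' ≠ 0 := by positivity
      refine mul_left_cancel₀ this ?_
      linarith

/-- An exact pair decomposes into exact pairs at comparable deeper levels. -/
lemma full_step (h : Reg E m p r J C lo hi κ Φ) (h' : Reg F m' p r J C lo hi κ Φ) :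
    ∃ L0 : ℕ, ∀ k k' A B, GK E m r J k A → GK F m' r J k' B → m A * p ^ k' = m' B * p ^ k →
      A.Nonempty → B.Nonempty →
      Dec (fun A' B' => GK E m r J (k + L0) A' ∧ GK F m' r J (k' + L0) B' ∧
        m A' * p ^ k' = m' B' * p ^ k ∧ A'.Nonempty ∧ B'.Nonempty ∧
        (∀ x ∈ A', ∀ y ∈ A', dist x y ≤ C * r ^ k) ∧
        ∀ x ∈ B', ∀ y ∈ B', dist x y ≤ C * r ^ k') A B := by
  obtain ⟨L1, hL1⟩ := half_step h h'
  obtain ⟨L2, hL2⟩ := half_step h' h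
  have p0 := h.p0
  refine ⟨L1 + L2, fun k k' A B hA hB hAB _ _ => (hL1 k k' A B hA hB hAB).bind ?_⟩
  rintro A1 B1 ⟨hb1, hA1, hB1, hm1⟩ - -
  have hm1' : m' B1 * p ^ k = m A1 * p ^ (k' + L1) * (p ^ L1)⁻¹ := by
    rw [pow_add, ← hm1]; field_simp
  have := (hL2 (k' + L1) (k + L1) B1 A1 hB1 (hA1.mono h.r0 h.r1 (by omega)) (by
    rw [pow_add, pow_add, ← mul_assoc, ← mul_assoc, ← hm1])).swap
  refine this.bind ?_
  rintro A2 B2 ⟨hb2, hB2, hA2, hm2⟩ hA21 -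
  have hm2' : m A2 * p ^ k' = m' B2 * p ^ k := by
    rw [pow_add, pow_add, ← mul_assoc, ← mul_assoc] at hm2
    exact (mul_right_cancel₀ (by positivity) hm2).symm
  refine .single ⟨by rw [← add_assoc]; exact hA2, hB2.mono h.r0 h.r1 (by omega), hm2', ?_, hb2.2.1,
    fun x hx y hy => hb1.2.2.1 x (hA21 hx) y (hA21 hy), fun x hx y hy => ?_⟩
  · refine h.nonempty ?_
    have := h'.pos' hB2.1 hb2.2.1
    have : 0 < m A2 * p ^ k' := by rw [hm2']; positivity
    exact (mul_pos_iff_of_pos_right (by positivity)).1 this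
  · refine (hb2.2.2.1 x hx y hy).trans ?_
    have := h.r0
    have := h.C0
    gcongr ?_ * ?_
    exact pow_le_pow_of_le_one h.r0.le h.r1.le (by omega)

end Reg

lemma Dec.of_card_eq {α β : Type*} {T : Set α → Set β → Prop} (𝓧 : Finset (Set α))
    (𝓨 : Finset (Set β)) (hc : 𝓧.card = 𝓨.card) (hX : (𝓧 : Set (Set α)).PairwiseDisjoint id)
    (hY : (𝓨 : Set (Set β)).PairwiseDisjoint id) (hT : ∀ X ∈ 𝓧, ∀ Y ∈ 𝓨, T X Y) :
    Dec T (⋃₀ (𝓧 : Set (Set α))) (⋃₀ (𝓨 : Set (Set β))) := by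
  let e := Finset.equivOfCardEq hc
  have := Dec.biUnion (T := T) (Finset.univ : Finset 𝓧) (A := fun X => X.1) (B := fun X => (e X).1)
    (fun X _ => .single (hT _ X.2 _ (e X).2))
    (fun X _ Y _ h => hX X.2 Y.2 fun hh => h (Subtype.ext hh))
    (fun X _ Y _ h => hY (e X).2 (e Y).2 fun hh => h (e.injective (Subtype.ext hh)))
  convert this using 1
  · ext x; simp
  · ext x
    simp only [mem_sUnion, Finset.mem_coe, Finset.mem_univ, iUnion_true, mem_iUnion]
    constructor
    · rintro ⟨Y, hY, hx⟩
      exact ⟨e.symm ⟨Y, hY⟩, by simpa using hx⟩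
    · rintro ⟨X, hx⟩
      exact ⟨_, (e X).2, hx⟩

/-- A pair of pieces of the same scale with comparable measures. -/
def FlexP {α β : Type*} [MetricSpace α] [MetricSpace β] (E : Set α) (F : Set β) (m : Set α → ℝ)
    (m' : Set β → ℝ) (p r D V : ℝ) (n : ℕ) (A : Set α) (B : Set β) : Prop :=
  (KSet E r n A ∧ A.Nonempty ∧ (∀ x ∈ A, ∀ y ∈ A, dist x y ≤ D * r ^ n) ∧ m A ≤ V * p ^ n) ∧
  (KSet F r n B ∧ B.Nonempty ∧ (∀ x ∈ B, ∀ y ∈ B, dist x y ≤ D * r ^ n) ∧ m' B ≤ V * p ^ n)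

/-- A pair of good pieces whose normalized measures agree. -/
def ExP {α β : Type*} [MetricSpace α] [MetricSpace β] (E : Set α) (F : Set β) (m : Set α → ℝ)
    (m' : Set β → ℝ) (p r : ℝ) (J : AddSubgroup ℝ) (k k' : ℕ) (A : Set α) (B : Set β) : Prop :=
  GK E m r J k A ∧ GK F m' r J k' B ∧ m A * p ^ k' = m' B * p ^ k ∧ A.Nonempty ∧ B.Nonempty

namespace Reg

variable {α β : Type*} [MetricSpace α] [MetricSpace β] {E : Set α} {F : Set β} {m : Set α → ℝ}
  {m' : Set β → ℝ} {p r : ℝ} {J : AddSubgroup ℝ} {C lo hi κ : ℝ} {Φ : Finset ℝ}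

lemma split_number (h : Reg E m p r J C lo hi κ Φ) {n c N : ℕ} {P : Set α} (hP : KSet E r n P)
    (h1 : m P ≤ N * (p ^ n * lo)) (h2 : N * (p ^ (n + c) * hi) ≤ m P) :
    ∃ 𝓧 : Finset (Set α), 𝓧.card = N ∧ (𝓧 : Set (Set α)).PairwiseDisjoint id ∧
      ⋃₀ (𝓧 : Set (Set α)) = P ∧ ∀ X ∈ 𝓧, KSet E r (n + c) X ∧ X.Nonempty ∧
        (∀ x ∈ X, ∀ y ∈ X, dist x y ≤ C * r ^ n) ∧ m X ≤ p ^ n * hi := by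
  classical
  have p0 := h.p0
  have lo0 := h.lo0
  have hi0 := h.hi0
  obtain ⟨𝓑, b1, b2, b3⟩ := h.blocks n P hP
  have hcB : 𝓑.card ≤ N := by
    have := (h.card_blocks 𝓑 b1 b2).1
    rw [b3] at this
    have := le_of_mul_le_mul_right (this.trans h1) (by positivity)
    exact_mod_cast this
  have hsub : ∀ B, ∃ 𝓓 : Finset (Set α), B ∈ 𝓑 → (∀ D ∈ 𝓓, Blk E m p r C Φ (n + c) D) ∧
      (𝓓 : Set (Set α)).PairwiseDisjoint id ∧ ⋃₀ (𝓓 : Set (Set α)) = B := by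
    intro B
    by_cases hB : B ∈ 𝓑
    · obtain ⟨𝓓, hh⟩ := h.blocks (n + c) B ((b1 B hB).1.mono h.r0 h.r1 (Nat.le_add_right _ _))
      exact ⟨𝓓, fun _ => hh⟩
    · exact ⟨∅, fun hh => (hB hh).elim⟩
  choose 𝓓 h𝓓 using hsub
  have down : ∀ j (𝓧 : Finset (Set α)), 𝓧.card = N + j → (𝓧 : Set (Set α)).PairwiseDisjoint id →
      ⋃₀ (𝓧 : Set (Set α)) = P →
      (∀ X ∈ 𝓧, KSet E r (n + c) X ∧ X.Nonempty ∧ ∃ B ∈ 𝓑, X ⊆ B) →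
      ∃ 𝓧 : Finset (Set α), 𝓧.card = N ∧ (𝓧 : Set (Set α)).PairwiseDisjoint id ∧
      ⋃₀ (𝓧 : Set (Set α)) = P ∧ ∀ X ∈ 𝓧, KSet E r (n + c) X ∧ X.Nonempty ∧ ∃ B ∈ 𝓑, X ⊆ B := by
    intro j
    induction j with
    | zero => exact fun 𝓧 x1 x2 x3 x4 => ⟨𝓧, x1, x2, x3, x4⟩
    | succ j ih =>
      intro 𝓧 x1 x2 x3 x4
      choose! f hf hf' using fun X hX => (x4 X hX).2.2
      obtain ⟨X, hX, Y, hY, hXY, hfXY⟩ := Finset.exists_ne_map_eq_of_card_lt_of_maps_to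
        (s := 𝓧) (t := 𝓑) (by omega) hf
      have hdXY : Disjoint X Y := x2 hX hY hXY
      have hYX : Y ∈ 𝓧.erase X := Finset.mem_erase.2 ⟨hXY.symm, hY⟩
      have hmem : ∀ Z ∈ (𝓧.erase X).erase Y, Z ∈ 𝓧 ∧ Z ≠ X ∧ Z ≠ Y := fun Z hZ => by
        simp only [Finset.mem_erase] at hZ; tauto
      have hdZ : ∀ Z ∈ (𝓧.erase X).erase Y, Disjoint (X ∪ Y) Z := fun Z hZ => by
        obtain ⟨z1, z2, z3⟩ := hmem Z hZ
        exact disjoint_union_left.2 ⟨x2 hX z1 z2.symm, x2 hY z1 z3.symm⟩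
      have hnot : X ∪ Y ∉ (𝓧.erase X).erase Y := fun hZ => by
        have := disjoint_self.1 (hdZ _ hZ)
        exact ((x4 X hX).2.1.mono subset_union_left).ne_empty this
      refine ih (insert (X ∪ Y) ((𝓧.erase X).erase Y)) ?_ ?_ ?_ ?_
      · rw [Finset.card_insert_of_notMem hnot, Finset.card_erase_of_mem hYX,
          Finset.card_erase_of_mem hX]
        have hpos : 0 < (𝓧.erase X).card := Finset.card_pos.2 ⟨Y, hYX⟩
        rw [Finset.card_erase_of_mem hX] at hpos
        omega
      · rw [Finset.coe_insert]
        refine PairwiseDisjoint.insert (x2.subset (by intro Z hZ; exact (hmem Z hZ).1)) ?_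
        intro Z hZ _
        exact hdZ Z hZ
      · rw [Finset.coe_insert, sUnion_insert, union_assoc, ← sUnion_insert, ← sUnion_insert,
          ← Finset.coe_insert, ← Finset.coe_insert, Finset.insert_erase hYX,
          Finset.insert_erase hX, x3]
      · intro Z hZ
        rcases Finset.mem_insert.1 hZ with rfl | hZ
        · refine ⟨(x4 X hX).1.union (x4 Y hY).1, (x4 X hX).2.1.mono subset_union_left, f X,
            hf X hX, union_subset (hf' X hX) ?_⟩
          rw [hfXY]; exact hf' Y hY
        · exact x4 Z (hmem Z hZ).1
  set 𝓧0 := 𝓑.biUnion 𝓓 with h𝓧0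
  have t1 : ∀ X ∈ 𝓧0, Blk E m p r C Φ (n + c) X ∧ ∃ B ∈ 𝓑, X ⊆ B ∧ X ∈ 𝓓 B := by
    intro X hX
    obtain ⟨B, hB, hXB⟩ := Finset.mem_biUnion.1 hX
    refine ⟨(h𝓓 B hB).1 X hXB, B, hB, ?_, hXB⟩
    rw [← (h𝓓 B hB).2.2]; exact subset_sUnion_of_mem hXB
  have t2 : (𝓧0 : Set (Set α)).PairwiseDisjoint id := by
    intro X hX Y hY hXY
    obtain ⟨-, B, hB, hXB, hX'⟩ := t1 X hX
    obtain ⟨-, B', hB', hYB, hY'⟩ := t1 Y hY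
    by_cases hBB : B = B'
    · subst hBB
      exact (h𝓓 B hB).2.1 hX' hY' hXY
    · exact (b2 hB hB' hBB).mono hXB hYB
  have t3 : ⋃₀ (𝓧0 : Set (Set α)) = P := by
    apply Subset.antisymm
    · refine sUnion_subset fun X hX => ?_
      obtain ⟨-, B, hB, hXB, -⟩ := t1 X hX
      rw [← b3]; exact hXB.trans (subset_sUnion_of_mem hB)
    · intro x hx
      rw [← b3] at hx
      obtain ⟨B, hB, hxB⟩ := hx
      rw [← (h𝓓 B hB).2.2] at hxB
      obtain ⟨X, hX, hxX⟩ := hxB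
      exact ⟨X, Finset.mem_coe.2 (Finset.mem_biUnion.2 ⟨B, hB, hX⟩), hxX⟩
  have t4 : N ≤ 𝓧0.card := by
    have := (h.card_blocks 𝓧0 (fun X hX => (t1 X hX).1) t2).2
    rw [t3] at this
    have := le_of_mul_le_mul_right (h2.trans this) (by positivity)
    exact_mod_cast this
  obtain ⟨𝓧, x1, x2, x3, x4⟩ := down (𝓧0.card - N) 𝓧0 (by omega) t2 t3 fun X hX => by
    obtain ⟨a, B, hB, hXB, -⟩ := t1 X hX
    exact ⟨a.1, a.2.1, B, hB, hXB⟩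
  refine ⟨𝓧, x1, x2, x3, fun X hX => ?_⟩
  obtain ⟨y1, y2, B, hB, hXB⟩ := x4 X hX
  exact ⟨y1, y2, fun x hx y hy => (b1 B hB).2.2.1 x (hXB hx) y (hXB hy),
    (h.mono (b1 B hB).1 y1 hXB).trans ((b1 B hB).pos h).2⟩

lemma flex_step (h : Reg E m p r J C lo hi κ Φ) (h' : Reg F m' p r J C lo hi κ Φ) {c : ℕ}
    (hc : 4 * (p ^ c * hi) ≤ lo) (D : ℝ) {V : ℝ} (hV : 0 < V) :
    ∃ N0 m0 : ℕ, ∀ N ≥ N0, ∀ n P Q, FlexP E F m m' p r D V n P Q → m' Q ≤ m P →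
      Dec (fun A B => FlexP E F m m' p r (C * (r ^ c)⁻¹) (hi * (p ^ c)⁻¹) (n + N + c) A B ∨
        ∃ k k', n ≤ k ∧ k ≤ n + m0 ∧ n ≤ k' ∧ k' ≤ n + m0 ∧ ExP E F m m' p r J k k' A B) P Q := by
  classical
  have p0 := h.p0
  have r0 := h.r0
  have lo0 := h.lo0
  have hi0 := h.hi0
  obtain ⟨L1, hL1⟩ := h.fraction (lo / (8 * V)) (by positivity)
  obtain ⟨J0', hJ0'⟩ := h.exists_pow_lt (x := lo / 8) (by positivity) hi
  obtain ⟨J0, hJL, hJ0⟩ : ∃ J0, L1 ≤ J0 ∧ p ^ J0 * hi < lo / 8 :=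
    ⟨max L1 J0', le_max_left _ _, hJ0' _ (le_max_right _ _)⟩
  obtain ⟨N1, hN1⟩ := exists_nat_ge (V / (p ^ J0 * lo))
  obtain ⟨J1, hJ1⟩ := h.exists_pow_lt lo0 (N1 * hi)
  replace hJ1 := hJ1 J1 le_rfl
  obtain ⟨M1, hM1⟩ := h.exists_pow_lt h.κ0 hi
  obtain ⟨M2, hM2⟩ := h.exists_pow_lt (x := lo / 8) (by positivity) (N1 * hi)
  obtain ⟨M, hMκ, hM⟩ : ∃ M, p ^ M * hi < κ ∧ p ^ M * (N1 * hi) < lo / 8 :=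
    ⟨max M1 M2, hM1 _ (le_max_left _ _), hM2 _ (le_max_right _ _)⟩
  obtain ⟨L2, hL2⟩ := h'.realize_finset (Φ.image fun φ => p ^ M * φ)
  refine ⟨max J0 (J1 + L2), J0 + J1 + M + L2, fun N hN n P Q hPQ hle => ?_⟩
  obtain ⟨⟨hP, hPne, hPd, hPV⟩, hQ, hQne, hQd, hQV⟩ := hPQ
  have hpn : 0 < p ^ n := by positivity
  set a := m P with ha
  set b := m' Q with hb
  have hblo : p ^ n * lo ≤ b := h'.pos hQ hQne
  have hb0 : 0 < b := lt_of_lt_of_le (by positivity) hblo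
  obtain ⟨G, hGP, hG, hGm⟩ := hL1 n P hP
  have hGm' : a - m G ≤ b / 8 := by
    refine hGm.trans ?_
    have : lo / (8 * V) * a ≤ lo / (8 * V) * (V * p ^ n) := by gcongr
    have e : lo / (8 * V) * (V * p ^ n) = p ^ n * lo / 8 := by field_simp
    linarith
  obtain ⟨𝓖, g1, g2, g3⟩ := h.blocks (n + J0) G (hG.1.mono h.r0 h.r1 (by omega))
  have hGs := h.sUnion 𝓖 (fun D hD => (g1 D hD).1) g2
  rw [g3] at hGs
  obtain ⟨𝓡, h𝓡, hR1, hR2⟩ := exists_subset_sum_near 𝓖 m (x := a - 7 * b / 8) (ε := b / 8)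
    (fun B hB => by
      refine ((g1 B hB).pos h).2.trans ?_
      have : p ^ (n + J0) * hi ≤ p ^ n * (lo / 8) := by rw [pow_add, mul_assoc]; gcongr
      linarith) (by linarith) (by linarith) (by positivity)
  have r1' : ∀ A ∈ 𝓡, Blk E m p r C Φ (n + J0) A := fun A hA => g1 A (h𝓡 hA)
  have r2 : (𝓡 : Set (Set α)).PairwiseDisjoint id := g2.subset (by exact_mod_cast h𝓡)
  have r3 := h.sUnion 𝓡 (fun D hD => (r1' D hD).1) r2
  set U := ⋃₀ (𝓡 : Set (Set α)) with hU
  have hUK : KSet E r (n + J0) U := KSet.sUnion fun D hD => (r1' D hD).1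
  have hUG : U ⊆ G := by rw [← g3]; exact sUnion_subset_sUnion (by exact_mod_cast h𝓡)
  have hUP : U ⊆ P := hUG.trans hGP
  rw [← r3] at hR1 hR2
  have hcard : 𝓡.card ≤ N1 := by
    have e1 := (h.card_blocks 𝓡 r1' r2).1
    have e2 : m U ≤ a := h.mono hP hUK hUP
    have : (𝓡.card : ℝ) ≤ V / (p ^ J0 * lo) := by
      rw [le_div_iff₀ (by positivity)]
      refine le_of_mul_le_mul_left ?_ hpn
      rw [pow_add] at e1
      linarith
    exact_mod_cast this.trans hN1
  obtain ⟨𝓠, q1, q2, q3⟩ := h'.blocks (n + J1) Q (hQ.mono h.r0 h.r1 (by omega))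
  have hcQ : 𝓡.card ≤ 𝓠.card := by
    refine hcard.trans ?_
    have e1 := (h'.card_blocks 𝓠 q1 q2).2
    rw [q3] at e1
    have e2 : N1 * (p ^ (n + J1) * hi) ≤ 𝓠.card * (p ^ (n + J1) * hi) := by
      refine le_trans ?_ (hblo.trans e1)
      calc N1 * (p ^ (n + J1) * hi) = p ^ n * (p ^ J1 * (N1 * hi)) := by rw [pow_add]; ring
        _ ≤ _ := by gcongr
    have := le_of_mul_le_mul_right e2 (by positivity)
    exact_mod_cast this
  obtain ⟨g⟩ : Nonempty (𝓡 ↪ 𝓠) := Function.Embedding.nonempty_of_card_le (by simpa using hcQ)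
  have hpick : ∀ A : 𝓡, ∃ B ⊆ (g A).1, GK F m' r J (n + J1 + L2) B ∧ 0 < m' B ∧
      m' B ≤ p ^ (n + J1) * (p ^ M * hi) ∧
      m A.1 * p ^ (n + J1 + M + L2) = m' B * p ^ (n + J0 + L2) := by
    rintro ⟨A, hA⟩
    have hbA := r1' A hA
    obtain ⟨φ, hφ, hmA⟩ := hbA.2.2.2
    have hφJ : φ ∈ J := by
      have : φ = (p ^ (n + J0))⁻¹ * m A := by
        rw [hmA, inv_mul_cancel_left₀ (by positivity)]
      rw [this]
      refine h.Jpow' (hG.2 _ _ ?_ hbA.1) _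
      exact (subset_sUnion_of_mem hA).trans hUG
    have hφ0 : 0 < φ := lo0.trans_le (h.Φlo φ hφ)
    obtain ⟨B, hB, hGB, hmB⟩ := hL2 (p ^ M * φ) (Finset.mem_image_of_mem _ hφ) (h.Jpow hφJ M)
      (by positivity) (lt_of_le_of_lt (by have := h.Φhi φ hφ; gcongr) hMκ) (n + J1)
      (g ⟨A, hA⟩).1 (q1 _ (g ⟨A, hA⟩).2).1 (q1 _ (g ⟨A, hA⟩).2).2.1
    refine ⟨B, hB, hGB, by rw [hmB]; positivity, ?_, ?_⟩
    · rw [hmB]; have := h.Φhi φ hφ; gcongr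
    · change m A * _ = _
      rw [hmA, hmB]; ring
  choose B hBg hBG hB0 hBm hBe using hpick
  have hBd : ((Finset.univ : Finset 𝓡) : Set 𝓡).PairwiseDisjoint B := by
    intro A _ A' _ hAA'
    refine Disjoint.mono (hBg A) (hBg A') (q2 (g A).2 (g A').2 ?_)
    exact fun hh => hAA' (g.injective (Subtype.ext hh))
  set W := ⋃ A ∈ (Finset.univ : Finset 𝓡), B A with hW
  have hWK : KSet F r (n + J1 + L2) W := KSet.biUnion fun A _ => (hBG A).1
  have hWQ : W ⊆ Q := by
    refine iUnion₂_subset fun A _ => (hBg A).trans ?_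
    rw [← q3]; exact subset_sUnion_of_mem (g A).2
  have hWm : m' W ≤ b / 8 := by
    rw [hW, h'.sum Finset.univ B (fun A _ => (hBG A).1) hBd]
    have e1 : ∑ A : 𝓡, m' (B A) ≤ (Finset.univ : Finset 𝓡).card • (p ^ (n + J1) * (p ^ M * hi)) :=
      Finset.sum_le_card_nsmul _ _ _ fun A _ => hBm A
    rw [nsmul_eq_mul, Finset.card_univ, Fintype.card_coe] at e1
    have e2 : (𝓡.card : ℝ) ≤ N1 := by exact_mod_cast hcard
    have e3 : p ^ (n + J1) ≤ p ^ n := pow_le_pow_of_le_one h.p0.le h.p1.le (by omega)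
    calc _ ≤ _ := e1
      _ ≤ N1 * (p ^ n * (p ^ M * hi)) := by gcongr
      _ = p ^ n * (p ^ M * (N1 * hi)) := by ring
      _ ≤ p ^ n * (lo / 8) := by gcongr
      _ ≤ b / 8 := by linarith
  have hW0 : 0 ≤ m' W := h'.nonneg hWK
  have decE : Dec (fun A B => FlexP E F m m' p r (C * (r ^ c)⁻¹) (hi * (p ^ c)⁻¹) (n + N + c) A B ∨
      ∃ k k', n ≤ k ∧ k ≤ n + (J0 + J1 + M + L2) ∧ n ≤ k' ∧ k' ≤ n + (J0 + J1 + M + L2) ∧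
        ExP E F m m' p r J k k' A B) U W := by
    have : U = ⋃ A ∈ (Finset.univ : Finset 𝓡), A.1 := by ext x; simp [hU]
    rw [this, hW]
    refine Dec.biUnion _ (fun A _ => .single (.inr ⟨n + J0 + L2, n + J1 + M + L2, by omega,
      by omega, by omega, by omega, ?_, (hBG A).mono h.r0 h.r1 (by omega), hBe A,
      (r1' A.1 A.2).2.1, h'.nonempty (hB0 A)⟩)) ?_ hBd
    · exact hG.subset ((subset_sUnion_of_mem A.2).trans hUG)
        ((r1' A.1 A.2).1.mono h.r0 h.r1 (by omega))
    · exact fun X _ Y _ hXY => r2 X.2 Y.2 fun hh => hXY (Subtype.ext hh)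
  rw [← union_sdiff_cancel hUP, ← union_sdiff_cancel hWQ]
  refine .union decE ?_ disjoint_sdiff_right disjoint_sdiff_right
  have hP'K : KSet E r (n + N) (P \ U) := by
    have : J0 ≤ N := (le_max_left _ _).trans hN
    exact (hP.mono h.r0 h.r1 (by omega)).diff (hUK.mono h.r0 h.r1 (by omega))
  have hQ'K : KSet F r (n + N) (Q \ W) := by
    have : J1 + L2 ≤ N := (le_max_right _ _).trans hN
    exact (hQ.mono h.r0 h.r1 (by omega)).diff (hWK.mono h.r0 h.r1 (by omega))
  have hmP' := h.diff hP hUK hUP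
  have hmQ' := h'.diff hQ hWK hWQ
  set s := p ^ (n + N) * lo with hs
  have hs0 : 0 < s := by positivity
  have hsb : s ≤ b := by
    refine le_trans ?_ hblo
    have : p ^ (n + N) ≤ p ^ n := pow_le_pow_of_le_one h.p0.le h.p1.le (by omega)
    rw [hs]; gcongr
  have hK1 : b ≤ ⌈b / s⌉₊ * s := by
    rw [← div_le_iff₀ hs0]; exact Nat.le_ceil _
  have hK2 : ⌈b / s⌉₊ * (p ^ (n + N + c) * hi) ≤ b / 2 := by
    have e1 : (⌈b / s⌉₊ : ℝ) ≤ b / s + 1 := (Nat.ceil_lt_add_one (by positivity)).le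
    have e2 : (⌈b / s⌉₊ : ℝ) * s ≤ 2 * b := by
      calc (⌈b / s⌉₊ : ℝ) * s ≤ (b / s + 1) * s := by gcongr
        _ = b + s := by field_simp
        _ ≤ _ := by linarith
    have e3 : p ^ (n + N + c) * hi ≤ s / 4 := by
      rw [pow_add, mul_assoc, hs]
      have : p ^ c * hi ≤ lo / 4 := by linarith
      calc p ^ (n + N) * (p ^ c * hi) ≤ p ^ (n + N) * (lo / 4) := by gcongr
        _ = _ := by ring
    calc (⌈b / s⌉₊ : ℝ) * (p ^ (n + N + c) * hi) ≤ ⌈b / s⌉₊ * (s / 4) := by gcongr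
      _ ≤ b / 2 := by linarith
  obtain ⟨𝓧, x1, x2, x3, x4⟩ := h.split_number (c := c) hP'K (N := ⌈b / s⌉₊) (by linarith)
    (by linarith)
  obtain ⟨𝓨, y1, y2, y3, y4⟩ := h'.split_number (c := c) hQ'K (N := ⌈b / s⌉₊) (by linarith)
    (by linarith)
  rw [← x3, ← y3]
  refine Dec.of_card_eq 𝓧 𝓨 (x1.trans y1.symm) x2 y2 fun X hX Y hY => .inl ?_
  obtain ⟨u1, u2, u3, u4⟩ := x4 X hX
  obtain ⟨v1, v2, v3, v4⟩ := y4 Y hY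
  have er : C * (r ^ c)⁻¹ * r ^ (n + N + c) = C * r ^ (n + N) := by
    rw [pow_add _ _ c]; field_simp
  have ep : hi * (p ^ c)⁻¹ * p ^ (n + N + c) = p ^ (n + N) * hi := by
    rw [pow_add _ _ c]; field_simp
  exact ⟨⟨u1, u2, by rw [er]; exact u3, by rw [ep]; exact u4⟩, v1, v2, by rw [er]; exact v3,
    by rw [ep]; exact v4⟩

end Reg

namespace Reg

variable {α β : Type*} [MetricSpace α] [MetricSpace β] {E : Set α} {F : Set β} {m : Set α → ℝ}
  {m' : Set β → ℝ} {p r : ℝ} {J : AddSubgroup ℝ} {C lo hi κ : ℝ} {Φ : Finset ℝ}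

lemma weaken (h : Reg E m p r J C lo hi κ Φ) {C' lo' hi' κ' : ℝ} {Φ' : Finset ℝ} (hC : C ≤ C')
    (hlo0 : 0 < lo') (hlo : lo' ≤ lo) (hhi : hi ≤ hi') (hκ0 : 0 < κ') (hκ : κ' ≤ κ) (hΦ : Φ ⊆ Φ')
    (hΦlo : ∀ φ ∈ Φ', lo' ≤ φ) (hΦhi : ∀ φ ∈ Φ', φ ≤ hi') : Reg E m p r J C' lo' hi' κ' Φ' where
  p0 := h.p0
  p1 := h.p1
  r0 := h.r0
  r1 := h.r1
  Jp := h.Jp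
  Jp' := h.Jp'
  C0 := h.C0.trans_le hC
  lo0 := hlo0
  lohi := hlo.trans (h.lohi.trans hhi)
  κ0 := hκ0
  Φlo := hΦlo
  Φhi := hΦhi
  add := h.add
  blocks k P hP := by
    obtain ⟨𝓑, h1, h2, h3⟩ := h.blocks k P hP
    refine ⟨𝓑, fun B hB => ?_, h2, h3⟩
    obtain ⟨b1, b2, b3, φ, hφ, hm⟩ := h1 B hB
    exact ⟨b1, b2, fun x hx y hy => (b3 x hx y hy).trans
      (mul_le_mul_of_nonneg_right hC (pow_nonneg h.r0.le _)), φ, hΦ hφ, hm⟩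
  realize z hz hz0 hz1 := h.realize z hz hz0 (hz1.trans_le hκ)
  fraction := h.fraction

lemma lipEquiv_of_common (h : Reg E m p r J C lo hi κ Φ) (h' : Reg F m' p r J C lo hi κ Φ)
    (hE : IsCompact E) (hF : IsCompact F) (hEn : E.Nonempty) (hFn : F.Nonempty) :
    LipEquiv E F := by
  have p0 := h.p0
  have r0 := h.r0
  have lo0 := h.lo0
  have hi0 := h.hi0
  obtain ⟨c, hc⟩ := h.exists_pow_lt (x := lo / 4) (by positivity) hi
  have hc4 : 4 * (p ^ c * hi) ≤ lo := by have := hc c le_rfl; linarith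
  set V : ℝ := max (max (m E) (m' F)) (hi * (p ^ c)⁻¹) with hVd
  have hV : 0 < V := lt_of_lt_of_le (by positivity) (le_max_right _ _)
  set D : ℝ := max (max (diam E) (diam F)) (C * (r ^ c)⁻¹) with hDd
  have hD : 0 < D := lt_of_lt_of_le (mul_pos h.C0 (by positivity)) (le_max_right _ _)
  obtain ⟨N1, m1, hf1⟩ := flex_step h h' hc4 D hV
  obtain ⟨N2, m2, hf2⟩ := flex_step h' h hc4 D hV
  obtain ⟨L0, hL0⟩ := full_step h h'
  set N := max (max N1 N2) (L0 + 1) with hN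
  obtain ⟨L, hL⟩ : ∃ L, L = N + c := ⟨_, rfl⟩
  have hN1 : N1 ≤ N := (le_max_left _ _).trans (le_max_left _ _)
  have hN2 : N2 ≤ N := (le_max_right _ _).trans (le_max_left _ _)
  have hNL : L0 + 1 ≤ N := le_max_right _ _
  obtain ⟨M, hM⟩ : ∃ M, M = max m1 m2 := ⟨_, rfl⟩
  set K : ℝ := max D C * (r ^ L)⁻¹ with hK
  have hrL : r ^ L ≤ 1 := pow_le_one₀ r0.le h.r1.le
  have hKD : D ≤ K := by
    rw [hK, ← div_eq_mul_inv, le_div_iff₀ (by positivity)]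
    exact (mul_le_of_le_one_right hD.le hrL).trans (le_max_left _ _)
  have hKp : ∀ x t, x ≤ D * r ^ (t * L) ∨ x ≤ C * r ^ (t * L) → x ≤ K * r ^ ((t + 1) * L) := by
    intro x t hx
    have : K * r ^ ((t + 1) * L) = max D C * r ^ (t * L) := by
      rw [hK, add_mul, one_mul, pow_add]; field_simp
    rw [this]
    rcases hx with hx | hx
    · exact hx.trans (mul_le_mul_of_nonneg_right (le_max_left _ _) (by positivity))
    · exact hx.trans (mul_le_mul_of_nonneg_right (le_max_right _ _) (by positivity))
  set X : ℕ → Set α → Set β → Prop := fun t A B => ∃ k k', t * L ≤ k ∧ k ≤ t * L + M ∧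
    t * L ≤ k' ∧ k' ≤ t * L + M ∧ ExP E F m m' p r J k k' A B ∧
    (∀ x ∈ A, ∀ y ∈ A, dist x y ≤ K * r ^ (t * L)) ∧ ∀ x ∈ B, ∀ y ∈ B, dist x y ≤ K * r ^ (t * L)
    with hX
  have flexup : ∀ t A B, FlexP E F m m' p r (C * (r ^ c)⁻¹) (hi * (p ^ c)⁻¹) (t * L + N + c) A B →
      FlexP E F m m' p r D V ((t + 1) * L) A B := by
    intro t A B hAB
    have e : t * L + N + c = (t + 1) * L := by rw [add_mul, one_mul, hL]; omega
    rw [e] at hAB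
    obtain ⟨⟨a1, a2, a3, a4⟩, b1, b2, b3, b4⟩ := hAB
    have hDr := mul_le_mul_of_nonneg_right (le_max_right (max (diam E) (diam F)) (C * (r ^ c)⁻¹))
      (pow_nonneg r0.le ((t + 1) * L))
    have hVr := mul_le_mul_of_nonneg_right (le_max_right (max (m E) (m' F)) (hi * (p ^ c)⁻¹))
      (pow_nonneg p0.le ((t + 1) * L))
    exact ⟨⟨a1, a2, fun x hx y hy => (a3 x hx y hy).trans hDr, a4.trans hVr⟩,
      b1, b2, fun x hx y hy => (b3 x hx y hy).trans hDr, b4.trans hVr⟩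
  have exup : ∀ t P Q A B, FlexP E F m m' p r D V (t * L) P Q → A ⊆ P → B ⊆ Q → ∀ k k',
      t * L ≤ k → k ≤ t * L + M → t * L ≤ k' → k' ≤ t * L + M → ExP E F m m' p r J k k' A B →
      X (t + 1) A B := by
    intro t P Q A B hPQ hA hB k k' h1 h2 h3 h4 ⟨e1, e2, e3, e4⟩
    refine ⟨k + L, k' + L, by rw [add_mul]; omega, by rw [add_mul]; omega, by rw [add_mul]; omega,
      by rw [add_mul]; omega, ⟨e1.mono h.r0 h.r1 (by omega), e2.mono h.r0 h.r1 (by omega), ?_, e4⟩,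
      fun x hx y hy => hKp _ _ (.inl (hPQ.1.2.2.1 x (hA hx) y (hA hy))),
      fun x hx y hy => hKp _ _ (.inl (hPQ.2.2.2.1 x (hB hx) y (hB hy)))⟩
    rw [pow_add, pow_add, ← mul_assoc, e3, mul_assoc]
  refine lipEquiv_of_dec hE hF (c := r ^ M) (K := K) (σ := r ^ L) (by positivity) (by positivity)
    (pow_lt_one₀ r0.le h.r1 (by omega))
    (fun t A B => FlexP E F m m' p r D V (t * L) A B ∨ X t A B) ?_ ?_ ?_ ?_ ?_ ?_ ?_ ?_
  · left
    have h1 : diam E ≤ D := (le_max_left _ (diam F)).trans (le_max_left _ _)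
    have h2 : diam F ≤ D := (le_max_right (diam E) _).trans (le_max_left _ _)
    have h3 : m E ≤ V := (le_max_left _ (m' F)).trans (le_max_left _ _)
    have h4 : m' F ≤ V := (le_max_right (m E) _).trans (le_max_left _ _)
    rw [zero_mul]
    refine ⟨⟨KSet.self, hEn, fun x hx y hy => ?_, ?_⟩, KSet.self, hFn, fun x hx y hy => ?_, ?_⟩
    · rw [pow_zero, mul_one]; exact (dist_le_diam_of_mem hE.isBounded hx hy).trans h1
    · rwa [pow_zero, mul_one]
    · rw [pow_zero, mul_one]; exact (dist_le_diam_of_mem hF.isBounded hx hy).trans h2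
    · rwa [pow_zero, mul_one]
  · rintro t P Q (hPQ | ⟨k, k', h1, h2, h3, h4, ⟨e1, e2, e3, e4, e5⟩, -, -⟩)
    · rcases le_total (m' Q) (m P) with hle | hle
      · refine (hf1 N hN1 _ _ _ hPQ hle).bind ?_
        rintro A B (hAB | ⟨k, k', h1, h2, h3, h4, hAB⟩) hA hB
        · exact .single (.inl (flexup t A B hAB))
        · exact .single (.inr (exup t P Q A B hPQ hA hB k k' h1 (h2.trans (by omega)) h3
            (h4.trans (by omega)) hAB))
      · refine (hf2 N hN2 _ _ _ ⟨hPQ.2, hPQ.1⟩ hle).swap.bind ?_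
        rintro A B (hAB | ⟨k, k', h1, h2, h3, h4, ⟨f1, f2, f3, f4, f5⟩⟩) hA hB
        · exact .single (.inl (flexup t A B ⟨hAB.2, hAB.1⟩))
        · exact .single (.inr (exup t P Q A B hPQ hA hB k' k h3 (h4.trans (by omega)) h1
            (h2.trans (by omega)) ⟨f2, f1, f3.symm, f5, f4⟩))
    · refine (hL0 k k' P Q e1 e2 e3 e4 e5).mono ?_
      rintro A B ⟨f1, f2, f3, f4, f5, f6, f7⟩
      refine .inr ⟨k + L, k' + L, by rw [add_mul]; omega, by rw [add_mul]; omega,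
        by rw [add_mul]; omega, by rw [add_mul]; omega, ⟨f1.mono h.r0 h.r1 (by omega),
        f2.mono h.r0 h.r1 (by omega), ?_, f4, f5⟩, fun x hx y hy => hKp _ _ (.inr ?_),
        fun x hx y hy => hKp _ _ (.inr ?_)⟩
      · rw [pow_add, pow_add, ← mul_assoc, f3, mul_assoc]
      · exact (f6 x hx y hy).trans (mul_le_mul_of_nonneg_left
          (pow_le_pow_of_le_one r0.le h.r1.le h1) h.C0.le)
      · exact (f7 x hx y hy).trans (mul_le_mul_of_nonneg_left
          (pow_le_pow_of_le_one r0.le h.r1.le h3) h.C0.le)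
  · rintro t A B (hAB | ⟨k, k', -, -, -, -, hAB, -⟩)
    · exact ⟨hAB.1.2.1, hAB.2.2.1⟩
    · exact ⟨hAB.2.2.2.1, hAB.2.2.2.2⟩
  · rintro t A B (hAB | ⟨k, k', -, -, -, -, hAB, -⟩)
    · exact ⟨hAB.1.1.1, hAB.2.1.1⟩
    · exact ⟨hAB.1.1.1, hAB.2.1.1.1⟩
  all_goals
    have hsep : ∀ t k, k ≤ t * L + M → r ^ M * (r ^ L) ^ t ≤ r ^ k := by
      intro t k hk
      rw [← pow_mul, ← pow_add]
      exact pow_le_pow_of_le_one r0.le h.r1.le (by rw [mul_comm L]; omega)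
    have hdi : ∀ t x, x ≤ D * r ^ (t * L) → x ≤ K * (r ^ L) ^ t := by
      intro t x hx
      rw [← pow_mul, mul_comm L]
      exact hx.trans (mul_le_mul_of_nonneg_right hKD (by positivity))
  · rintro t A B (hAB | ⟨k, k', -, h2, -, h4, hAB, -⟩) x hx y hy hyA
    · exact (hsep t (t * L) (by omega)).trans (hAB.1.1.2 x hx y hy hyA)
    · exact (hsep t k h2).trans (hAB.1.1.2 x hx y hy hyA)
  · rintro t A B (hAB | ⟨k, k', -, h2, -, h4, hAB, -⟩) x hx y hy hyA
    · exact (hsep t (t * L) (by omega)).trans (hAB.2.1.2 x hx y hy hyA)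
    · exact (hsep t k' h4).trans (hAB.2.1.1.2 x hx y hy hyA)
  · rintro t A B (hAB | ⟨k, k', -, h2, -, h4, hAB, hd, hd'⟩) x hx y hy
    · exact hdi t _ (hAB.1.2.2.1 x hx y hy)
    · rw [← pow_mul, mul_comm L]; exact hd x hx y hy
  · rintro t A B (hAB | ⟨k, k', -, h2, -, h4, hAB, hd, hd'⟩) x hx y hy
    · exact hdi t _ (hAB.2.2.2.1 x hx y hy)
    · rw [← pow_mul, mul_comm L]; exact hd' x hx y hy

/-- Two compact sets which are regular with the same value group are Lipschitz equivalent. -/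
theorem lipEquiv (h : Reg E m p r J C lo hi κ Φ) {C' lo' hi' κ' : ℝ} {Φ' : Finset ℝ}
    (h' : Reg F m' p r J C' lo' hi' κ' Φ')
    (hE : IsCompact E) (hF : IsCompact F) (hEn : E.Nonempty) (hFn : F.Nonempty) :
    LipEquiv E F := by
  classical
  have hlo : ∀ φ ∈ Φ ∪ Φ', min lo lo' ≤ φ := fun φ hφ => by
    rcases Finset.mem_union.1 hφ with hφ | hφ
    · exact (min_le_left _ _).trans (h.Φlo φ hφ)
    · exact (min_le_right _ _).trans (h'.Φlo φ hφ)
  have hhi : ∀ φ ∈ Φ ∪ Φ', φ ≤ max hi hi' := fun φ hφ => by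
    rcases Finset.mem_union.1 hφ with hφ | hφ
    · exact (h.Φhi φ hφ).trans (le_max_left _ _)
    · exact (h'.Φhi φ hφ).trans (le_max_right _ _)
  exact lipEquiv_of_common (C := max C C') (κ := min κ κ')
    (h.weaken (le_max_left _ _) (lt_min h.lo0 h'.lo0) (min_le_left _ _) (le_max_left _ _)
      (lt_min h.κ0 h'.κ0) (min_le_left _ _) Finset.subset_union_left hlo hhi)
    (h'.weaken (le_max_right _ _) (lt_min h.lo0 h'.lo0) (min_le_right _ _) (le_max_right _ _)
      (lt_min h.κ0 h'.κ0) (min_le_right _ _) Finset.subset_union_right hlo hhi) hE hF hEn hFn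

end Reg

open Polynomial in
/-- Expand the monomials of degree `n` by means of the substitution `1 ↦ ∑ i, X ^ lam i`. -/
def expandAt {ι : Type*} [Fintype ι] (lam : ι → ℕ) (n : ℕ) (P : ℤ[X]) : ℤ[X] :=
  P + C (P.coeff n) * X ^ n * (∑ i, X ^ lam i - 1)

open Polynomial in
/-- Expand successively the monomials of degrees `0, …, n - 1`. -/
def expandTo {ι : Type*} [Fintype ι] (lam : ι → ℕ) : ℕ → ℤ[X] → ℤ[X]
  | 0, P => P
  | n + 1, P => expandAt lam n (expandTo lam n P)

namespace Expand

open Polynomial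

variable {ι : Type*} [Fintype ι] {lam : ι → ℕ}

lemma expandTo_add (n : ℕ) (P P' : ℤ[X]) :
    expandTo lam n (P + P') = expandTo lam n P + expandTo lam n P' := by
  induction n with
  | zero => rfl
  | succ n ih => simp only [expandTo, ih, expandAt, coeff_add, C_add]; ring

lemma expandTo_zero (n : ℕ) : expandTo lam n 0 = 0 := by
  induction n with
  | zero => rfl
  | succ n ih => simp [expandTo, ih, expandAt]

lemma expandTo_sum {κ : Type*} (s : Finset κ) (n : ℕ) (P : κ → ℤ[X]) :
    expandTo lam n (∑ c ∈ s, P c) = ∑ c ∈ s, expandTo lam n (P c) := by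
  classical
  induction s using Finset.induction_on with
  | empty => simp [expandTo_zero]
  | insert a s ha ih => rw [Finset.sum_insert ha, Finset.sum_insert ha, expandTo_add, ih]

lemma eval_expandTo {p : ℝ} (hp : ∑ i, p ^ lam i = 1) (n : ℕ) (P : ℤ[X]) :
    aeval p (expandTo lam n P) = aeval p P := by
  induction n with
  | zero => rfl
  | succ n ih => simp [expandTo, expandAt, ih, hp]

lemma coeff_expandAt (n k : ℕ) (P : ℤ[X]) : (expandAt lam n P).coeff k =
    P.coeff k + (∑ i, (if k = n + lam i then P.coeff n else 0) - if k = n then P.coeff n else 0) := by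
  rw [expandAt, coeff_add, mul_sub, coeff_sub, mul_one, Finset.mul_sum, finsetSum_coeff]
  congr 2
  · refine Finset.sum_congr rfl fun i _ => ?_
    rw [mul_assoc, ← pow_add, coeff_C_mul_X_pow]
  · rw [coeff_C_mul_X_pow]

lemma coeff_expandTo_lt (hl : ∀ i, 0 < lam i) (P : ℤ[X]) (n k : ℕ) (hk : k < n) :
    (expandTo lam n P).coeff k = 0 := by
  induction n with
  | zero => omega
  | succ n ih =>
    rw [expandTo, coeff_expandAt, Finset.sum_eq_zero fun i _ => if_neg (by have := hl i; omega)]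
    rcases Nat.lt_succ_iff_lt_or_eq.1 hk with h | rfl
    · rw [ih h, if_neg h.ne]; rfl
    · simp

/-- The number of monomials of degree `n` met when expanding. -/
def head (lam : ι → ℕ) (P : ℤ[X]) (n : ℕ) : ℤ := (expandTo lam n P).coeff n

lemma coeff_expandTo (P : ℤ[X]) (n k : ℕ) (hk : n ≤ k) :
    (expandTo lam n P).coeff k =
      P.coeff k + ∑ i, if lam i ≤ k ∧ k < n + lam i then head lam P (k - lam i) else 0 := by
  induction n with
  | zero =>
    rw [expandTo, Finset.sum_eq_zero, add_zero]
    intro i _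
    exact if_neg (by omega)
  | succ n ih =>
    rw [expandTo, coeff_expandAt, ih (by omega), if_neg (by omega : ¬ k = n), sub_zero, add_assoc,
      ← Finset.sum_add_distrib]
    congr 1
    refine Finset.sum_congr rfl fun i _ => ?_
    by_cases h1 : k = n + lam i
    · rw [if_neg (by omega), if_pos h1, if_pos (by omega), zero_add, head, h1,
        Nat.add_sub_cancel]
    · rw [if_neg h1, add_zero]
      by_cases h2 : lam i ≤ k ∧ k < n + lam i
      · rw [if_pos h2, if_pos (by omega)]
      · rw [if_neg h2, if_neg (by omega)]

lemma head_eq (hl : ∀ i, 0 < lam i) (P : ℤ[X]) (n : ℕ) :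
    head lam P n = P.coeff n + ∑ i, if lam i ≤ n then head lam P (n - lam i) else 0 := by
  rw [head, coeff_expandTo P n n le_rfl]
  congr 1
  refine Finset.sum_congr rfl fun i _ => ?_
  have := hl i
  by_cases h : lam i ≤ n
  · rw [if_pos h, if_pos (by omega)]
  · rw [if_neg h, if_neg (by omega)]

lemma eventually_pos_of_average {p : ℝ} (hp0 : 0 < p) (hp1 : p < 1) (hl : ∀ i, 0 < lam i)
    (hsum : ∑ i, p ^ lam i = 1) (hgcd : Finset.univ.gcd lam = 1) {Λ : ℕ} (b : ℕ → ℝ) {N0 : ℕ}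
    (hΛ : ∀ i, lam i ≤ Λ) (hb : ∀ n ≥ N0, b (n + Λ) = ∑ i, p ^ lam i * b (n + Λ - lam i))
    {δ : ℝ} (hδ : 0 < δ) (hbδ : ∀ n ≥ N0, ∃ j, n ≤ j ∧ j < n + Λ ∧ δ ≤ b j) :
    ∃ N1, ∀ n ≥ N1, 0 < b n := by
  obtain ⟨K, hK⟩ : ∃ K, ∀ t ≥ K, t ∈ AddSubmonoid.closure (range lam) := by
    obtain ⟨K, hK⟩ := Nat.exists_mem_closure_of_ge (range lam)
    refine ⟨K, fun t ht => hK t ht ?_⟩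
    have h1 : Nat.setGcd (range lam) ∣ Finset.univ.gcd lam :=
      Finset.dvd_gcd fun i _ => Nat.setGcd_dvd_of_mem (mem_range_self i)
    rw [hgcd] at h1
    exact h1.trans (one_dvd t)
  have transport : ∀ (x : ℝ) (N : ℕ), (∀ n ≥ N, x ≤ b n) → ∀ t ∈ AddSubmonoid.closure (range lam),
      ∀ j ≥ N + N0 + Λ, p ^ t * (b j - x) ≤ b (j + t) - x := by
    intro x N hx t ht
    induction ht using AddSubmonoid.closure_induction with
    | mem t ht =>
      obtain ⟨i, rfl⟩ := ht
      intro j hj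
      have hi := hΛ i
      have e : b (j + lam i) - x = ∑ k, p ^ lam k * (b (j + lam i - lam k) - x) := by
        have := hb (j + lam i - Λ) (by omega)
        rw [Nat.sub_add_cancel (by omega)] at this
        simp_rw [mul_sub]
        rw [Finset.sum_sub_distrib, ← Finset.sum_mul, hsum, one_mul, ← this]
      rw [e]
      have := Finset.single_le_sum (f := fun k => p ^ lam k * (b (j + lam i - lam k) - x))
        (s := Finset.univ) (fun k _ => mul_nonneg (by positivity)
          (sub_nonneg.2 (hx _ (by have := hΛ k; omega)))) (Finset.mem_univ i)
      simpa using this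
    | zero => intro j hj; simp
    | add t t' _ _ ih ih' =>
      intro j hj
      rw [← add_assoc]
      refine le_trans ?_ (ih' (j + t) (by omega))
      rw [pow_add, mul_comm (p ^ t), mul_assoc]
      exact mul_le_mul_of_nonneg_left (ih j hj) (by positivity)
  have hstep : ∀ g : ℝ, 0 ≤ g → (∃ N, ∀ n ≥ N, δ - g ≤ b n) →
      ∃ N, ∀ n ≥ N, δ - (1 - p ^ (K + Λ)) * g ≤ b n := by
    rintro g hg ⟨N, hN⟩
    refine ⟨N + N0 + Λ + K + Λ, fun n hn => ?_⟩
    obtain ⟨j, hj1, hj2, hj⟩ := hbδ (n - K - Λ) (by omega)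
    have h1 := transport _ N hN (n - j) (hK _ (by omega)) j (by omega)
    rw [Nat.add_sub_cancel' (by omega)] at h1
    have h2 : p ^ (K + Λ) ≤ p ^ (n - j) := pow_le_pow_of_le_one hp0.le hp1.le (by omega)
    have h3 : p ^ (K + Λ) * g ≤ p ^ (n - j) * (b j - (δ - g)) := by
      apply mul_le_mul h2 (by linarith) hg (by positivity)
    linarith
  have hbase : ∃ g, 0 ≤ g ∧ ∀ n ≥ N0, δ - g ≤ b n := by
    have hS : ∀ n < N0 + Λ, - ∑ j ∈ Finset.range (N0 + Λ), |b j| ≤ b n := fun n hn => by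
      have : |b n| ≤ ∑ j ∈ Finset.range (N0 + Λ), |b j| :=
        Finset.single_le_sum (f := fun j => |b j|) (fun k _ => abs_nonneg _) (Finset.mem_range.2 hn)
      have := neg_abs_le (b n)
      linarith
    have hS0 : 0 ≤ ∑ j ∈ Finset.range (N0 + Λ), |b j| := Finset.sum_nonneg fun _ _ => abs_nonneg _
    refine ⟨δ + ∑ j ∈ Finset.range (N0 + Λ), |b j|, by positivity, fun n hn => ?_⟩
    rw [sub_add_cancel_left]
    induction n using Nat.strong_induction_on with
    | _ n ih =>
      rcases lt_or_ge n (N0 + Λ) with h | h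
      · exact hS n h
      · have := hb (n - Λ) (by omega)
        rw [Nat.sub_add_cancel (by omega)] at this
        rw [this, ← one_mul (- _), ← hsum, Finset.sum_mul]
        refine Finset.sum_le_sum fun i _ => mul_le_mul_of_nonneg_left (ih _ ?_ ?_) (by positivity)
        · have := hl i; have := hΛ i; omega
        · have := hΛ i; omega
  obtain ⟨g, hg, hgb⟩ := hbase
  have hε0 : 0 < p ^ (K + Λ) := by positivity
  have hε1 : p ^ (K + Λ) ≤ 1 := pow_le_one₀ hp0.le hp1.le
  have hiter : ∀ k : ℕ, ∃ N, ∀ n ≥ N, δ - (1 - p ^ (K + Λ)) ^ k * g ≤ b n := by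
    intro k
    induction k with
    | zero => exact ⟨N0, by simpa using hgb⟩
    | succ k ih =>
      rw [pow_succ', mul_assoc]
      exact hstep _ (mul_nonneg (pow_nonneg (by linarith) _) hg) ih
  obtain ⟨k, hk⟩ := exists_pow_lt_of_lt_one (x := δ / (g + 1)) (y := 1 - p ^ (K + Λ))
    (by positivity) (by linarith)
  obtain ⟨N, hN⟩ := hiter k
  refine ⟨N, fun n hn => lt_of_lt_of_le ?_ (hN n hn)⟩
  rw [lt_div_iff₀ (by positivity)] at hk
  have : 0 ≤ (1 - p ^ (K + Λ)) ^ k := pow_nonneg (by linarith) _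
  linarith

/-- A polynomial with positive value at `p` eventually expands with nonnegative coefficients. -/
lemma exists_coeff_expandTo_nonneg {p : ℝ} (hp0 : 0 < p) (hp1 : p < 1) (hl : ∀ i, 0 < lam i)
    (hsum : ∑ i, p ^ lam i = 1) (hgcd : Finset.univ.gcd lam = 1) (P : ℤ[X]) (hP : 0 < aeval p P) :
    ∃ N, ∀ n ≥ N, ∀ k, 0 ≤ (expandTo lam n P).coeff k := by
  obtain ⟨Λ, hΛ⟩ : ∃ Λ, ∀ i, lam i ≤ Λ :=
    ⟨∑ i, lam i, fun i => Finset.single_le_sum (fun _ _ => Nat.zero_le _) (Finset.mem_univ i)⟩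
  set N0 := P.natDegree + 1 with hN0
  have hcoeff : ∀ k ≥ N0, P.coeff k = 0 := fun k hk => coeff_eq_zero_of_natDegree_lt (by omega)
  set b : ℕ → ℝ := fun n => head lam P n * p ^ n with hb
  have hrec : ∀ n ≥ N0, b (n + Λ) = ∑ i, p ^ lam i * b (n + Λ - lam i) := by
    intro n hn
    rw [hb]
    simp only
    rw [head_eq hl, hcoeff _ (by omega), zero_add]
    push_cast
    rw [Finset.sum_mul]
    refine Finset.sum_congr rfl fun i _ => ?_
    have := hΛ i
    rw [if_pos (by omega)]
    have e : p ^ (n + Λ) = p ^ lam i * p ^ (n + Λ - lam i) := by rw [← pow_add]; congr 1; omega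
    rw [e]; ring
  have hval : ∀ n ≥ N0, ∀ x : ℝ, 0 ≤ x → (∀ j, n ≤ j → j < n + Λ → b j ≤ x) →
      aeval p P ≤ (Λ + 1 : ℕ) * (Fintype.card ι * x) := by
    intro n hn x hx hj
    rw [← eval_expandTo hsum (n + Λ) P]
    have hdeg : (expandTo lam (n + Λ) P).natDegree < (n + Λ) + (Λ + 1) := by
      have : (expandTo lam (n + Λ) P).natDegree ≤ n + Λ + Λ := by
        refine natDegree_le_iff_coeff_eq_zero.2 fun k hk => ?_
        rw [coeff_expandTo P _ _ (by omega), hcoeff k (by omega), zero_add]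
        refine Finset.sum_eq_zero fun i _ => if_neg ?_
        have := hΛ i; omega
      omega
    rw [aeval_eq_sum_range' hdeg, Finset.sum_range_add, Finset.sum_eq_zero, zero_add]
    · have : ∀ k ∈ Finset.range (Λ + 1), (expandTo lam (n + Λ) P).coeff (n + Λ + k) •
          p ^ (n + Λ + k) ≤ Fintype.card ι * x := by
        intro k _
        rw [coeff_expandTo P _ _ (by omega), hcoeff _ (by omega), zero_add, zsmul_eq_mul]
        push_cast
        rw [Finset.sum_mul, ← nsmul_eq_mul, ← Finset.card_univ]
        refine Finset.sum_le_card_nsmul _ _ _ fun i _ => ?_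
        have hi := hΛ i
        split_ifs with hc
        · have e : p ^ (n + Λ + k) = p ^ lam i * p ^ (n + Λ + k - lam i) := by
            rw [← pow_add]; congr 1; omega
          have h1 : b (n + Λ + k - lam i) ≤ x := hj _ (by omega) (by omega)
          calc _ = p ^ lam i * b (n + Λ + k - lam i) := by rw [e]; simp only [hb]; ring
            _ ≤ p ^ lam i * x := mul_le_mul_of_nonneg_left h1 (by positivity)
            _ ≤ 1 * x := mul_le_mul_of_nonneg_right (pow_le_one₀ hp0.le hp1.le) hx
            _ = x := one_mul x
        · simpa using hx
      refine (Finset.sum_le_card_nsmul _ _ _ this).trans ?_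
      rw [Finset.card_range, nsmul_eq_mul]
    · intro k hk
      rw [coeff_expandTo_lt hl P _ _ (Finset.mem_range.1 hk), zero_smul]
  obtain ⟨N1, hN1⟩ := eventually_pos_of_average hp0 hp1 hl hsum hgcd b hΛ hrec
    (δ := aeval p P / ((Λ + 1 : ℕ) * Fintype.card ι + 1)) (by positivity) (by
      intro n hn
      by_contra! hcon
      have h1 := hval n hn _ (by positivity) fun j h1 h2 => (hcon j h1 h2).le
      rw [← mul_assoc, mul_div_assoc', le_div_iff₀ (by positivity)] at h1
      nlinarith)
  refine ⟨max N0 (N1 + Λ), fun n hn k => ?_⟩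
  have hn1 : N0 ≤ n := (le_max_left _ _).trans hn
  have hn2 : N1 + Λ ≤ n := (le_max_right _ _).trans hn
  rcases lt_or_ge k n with hk | hk
  · rw [coeff_expandTo_lt hl P _ _ hk]
  · rw [coeff_expandTo P _ _ hk, hcoeff k (by omega), zero_add]
    refine Finset.sum_nonneg fun i _ => ?_
    have hi := hΛ i
    split_ifs with hc
    · have := hN1 (k - lam i) (by omega)
      have : (0 : ℝ) < head lam P (k - lam i) := by
        simp only [hb] at this
        exact pos_of_mul_pos_left this (by positivity)
      exact_mod_cast this.le
    · exact le_rfl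

end Expand

/-- Weight of a word. -/
def wt {ι : Type*} (lam : ι → ℕ) (u : List ι) : ℕ := (u.map lam).sum

open scoped Classical in
/-- The words at which the weight first reaches `k`. -/
def cut {ι : Type*} [Fintype ι] (lam : ι → ℕ) : ℕ → Finset (List ι)
  | 0 => {[]}
  | k + 1 => (cut lam k).filter (fun u => k < wt lam u) ∪
      ((cut lam k).filter (fun u => wt lam u = k) ×ˢ Finset.univ).image fun x => x.1 ++ [x.2]

section Words

variable {ι : Type*} {lam : ι → ℕ}

@[simp] lemma wt_nil : wt lam [] = 0 := rfl

@[simp] lemma wt_append (u v : List ι) : wt lam (u ++ v) = wt lam u + wt lam v := by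
  simp [wt]

@[simp] lemma wt_cons (i : ι) (v : List ι) : wt lam (i :: v) = lam i + wt lam v := by
  simp [wt]

variable [Fintype ι]

lemma mem_cut_succ {k : ℕ} {u : List ι} : u ∈ cut lam (k + 1) ↔
    (u ∈ cut lam k ∧ k < wt lam u) ∨ ∃ v ∈ cut lam k, wt lam v = k ∧ ∃ i, u = v ++ [i] := by
  simp only [cut, Finset.mem_union, Finset.mem_filter, Finset.mem_image, Finset.mem_product,
    Finset.mem_univ, and_true, Prod.exists]
  constructor
  · rintro (h | ⟨v, i, h, rfl⟩)
    · exact .inl h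
    · exact .inr ⟨v, h.1, h.2, i, rfl⟩
  · rintro (h | ⟨v, h1, h2, i, rfl⟩)
    · exact .inl h
    · exact .inr ⟨v, i, ⟨h1, h2⟩, rfl⟩

lemma le_wt_of_mem_cut (hl : ∀ i, 0 < lam i) {k : ℕ} {u : List ι} (hu : u ∈ cut lam k) :
    k ≤ wt lam u := by
  induction k generalizing u with
  | zero => exact Nat.zero_le _
  | succ k ih =>
    rcases mem_cut_succ.1 hu with h | ⟨v, hv, hvk, i, rfl⟩
    · exact h.2
    · have := hl i; simp; omega

lemma wt_le_of_mem_cut {Λ : ℕ} (hΛ : ∀ i, lam i ≤ Λ) {k : ℕ} {u : List ι} (hu : u ∈ cut lam k) :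
    wt lam u ≤ k + Λ := by
  induction k generalizing u with
  | zero =>
    rw [cut, Finset.mem_singleton] at hu
    simp [hu]
  | succ k ih =>
    rcases mem_cut_succ.1 hu with h | ⟨v, hv, hvk, i, rfl⟩
    · have := ih h.1; omega
    · have := hΛ i; simp; omega

lemma eq_of_prefix_of_mem_cut {k : ℕ} {u v : List ι} (hu : u ∈ cut lam k)
    (hv : v ∈ cut lam k) (h : u <+: v) : u = v := by
  induction k generalizing u v with
  | zero =>
    rw [cut, Finset.mem_singleton] at hu hv
    rw [hu, hv]
  | succ k ih =>
    rcases mem_cut_succ.1 hu with hu' | ⟨u, hu', huk, i, rfl⟩ <;>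
    rcases mem_cut_succ.1 hv with hv' | ⟨v, hv', hvk, j, rfl⟩
    · exact ih hu'.1 hv'.1 h
    · rcases List.prefix_concat_iff.1 h with h | h
      · exact h
      · have := ih hu'.1 hv' h
        subst this
        omega
    · have := ih hu' hv'.1 ((List.prefix_append u [i]).trans h)
      subst this
      have := h.length_le
      simp at this
    · have huv : u = v := by
        rcases List.prefix_concat_iff.1 h with h | h
        · simpa using congrArg List.dropLast h
        · exact ih hu' hv' ((List.prefix_append u [i]).trans h)
      subst huv
      exact h.eq_of_length (by simp)

lemma mem_cut_wt (hl : ∀ i, 0 < lam i) (w : List ι) : w ∈ cut lam (wt lam w) := by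
  induction w using List.reverseRecOn with
  | nil => simp [cut]
  | append_singleton w i ih =>
    have h0 : w ++ [i] ∈ cut lam (wt lam w + 1) := mem_cut_succ.2 (.inr ⟨w, ih, rfl, i, rfl⟩)
    have : ∀ j, j + 1 ≤ lam i → w ++ [i] ∈ cut lam (wt lam w + (j + 1)) := by
      intro j
      induction j with
      | zero => exact fun _ => h0
      | succ j ihj =>
        intro hj
        exact mem_cut_succ.2 (.inl ⟨ihj (by omega), by simp; omega⟩)
    have h1 := hl i
    have := this (lam i - 1) (by omega)
    rw [Nat.sub_add_cancel h1] at this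
    simpa using this

lemma append_mem_cut (hl : ∀ i, 0 < lam i) (w : List ι) {v : List ι} {k : ℕ} (hv : v ∈ cut lam k) :
    w ++ v ∈ cut lam (wt lam w + k) := by
  induction k generalizing v with
  | zero =>
    rw [cut, Finset.mem_singleton] at hv
    simpa [hv] using mem_cut_wt hl w
  | succ k ih =>
    rcases mem_cut_succ.1 hv with h | ⟨u, hu, huk, i, rfl⟩
    · exact mem_cut_succ.2 (.inl ⟨ih h.1, by simp; omega⟩)
    · exact mem_cut_succ.2 (.inr ⟨w ++ u, ih hu, by simp [huk], i, by simp⟩)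

lemma sum_cut_succ {M : Type*} [AddCommMonoid M] (k : ℕ) (g : List ι → M) :
    ∑ u ∈ cut lam (k + 1), g u = ∑ u ∈ cut lam k with k < wt lam u, g u +
      ∑ u ∈ cut lam k with wt lam u = k, ∑ i, g (u ++ [i]) := by
  classical
  rw [cut, Finset.sum_union, Finset.sum_image, Finset.sum_product]
  · rintro ⟨u, i⟩ - ⟨v, j⟩ - h
    have := List.append_inj' h rfl
    simp_all
  · rw [Finset.disjoint_left]
    intro u hu hu'
    obtain ⟨⟨v, i⟩, hv, rfl⟩ := Finset.mem_image.1 hu'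
    simp only [Finset.mem_filter, Finset.mem_product] at hu hv
    have := eq_of_prefix_of_mem_cut hv.1.1 hu.1 (List.prefix_append v [i])
    have := congrArg List.length this
    simp at this

lemma filter_le_eq_cut (hl : ∀ i, 0 < lam i) {M : Type*} [AddCommMonoid M] (k : ℕ)
    (g : List ι → M) : ∑ u ∈ cut lam k, g u = ∑ u ∈ cut lam k with k < wt lam u, g u +
      ∑ u ∈ cut lam k with wt lam u = k, g u := by
  classical
  rw [← Finset.sum_filter_add_sum_filter_not (cut lam k) (fun u => k < wt lam u)]
  congr 1
  refine Finset.sum_congr (Finset.filter_congr fun u hu => ?_) fun _ _ => rfl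
  have := le_wt_of_mem_cut hl hu
  omega

lemma sum_cut_pow {p : ℝ} (hl : ∀ i, 0 < lam i) (hsum : ∑ i, p ^ lam i = 1) (k : ℕ) :
    ∑ u ∈ cut lam k, p ^ wt lam u = 1 := by
  induction k with
  | zero => simp [cut]
  | succ k ih =>
    rw [sum_cut_succ, ← ih, filter_le_eq_cut hl k]
    congr 1
    refine Finset.sum_congr rfl fun u _ => ?_
    simp_rw [wt_append, pow_add, ← Finset.mul_sum]
    simp [hsum]

open Polynomial in
lemma expandTo_one (hl : ∀ i, 0 < lam i) (k : ℕ) :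
    expandTo lam k (1 : ℤ[X]) = ∑ u ∈ cut lam k, X ^ wt lam u := by
  classical
  induction k with
  | zero => simp [cut, expandTo]
  | succ k ih =>
    have hc : (expandTo lam k (1 : ℤ[X])).coeff k = ((cut lam k).filter (wt lam · = k)).card := by
      rw [ih, finsetSum_coeff]
      simp [coeff_X_pow, eq_comm]
    rw [expandTo, expandAt, hc, ih, sum_cut_succ, filter_le_eq_cut hl k, add_assoc]
    congr 1
    have h1 : ∑ u ∈ cut lam k with wt lam u = k, (X : ℤ[X]) ^ wt lam u =
        (((cut lam k).filter (wt lam · = k)).card : ℤ[X]) * X ^ k := by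
      rw [Finset.sum_congr rfl (g := fun _ => X ^ k)
        fun u hu => by rw [(Finset.mem_filter.1 hu).2], Finset.sum_const, nsmul_eq_mul]
    have h2 : ∑ u ∈ cut lam k with wt lam u = k, ∑ i, (X : ℤ[X]) ^ wt lam (u ++ [i]) =
        (((cut lam k).filter (wt lam · = k)).card : ℤ[X]) * (X ^ k * ∑ i, X ^ lam i) := by
      rw [Finset.sum_congr rfl (g := fun _ => X ^ k * ∑ i, X ^ lam i), Finset.sum_const,
        nsmul_eq_mul]
      intro u hu
      simp_rw [wt_append, (Finset.mem_filter.1 hu).2, pow_add, ← Finset.mul_sum]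
      simp
    rw [h1, h2]
    simp only [map_natCast]
    ring

end Words

lemma Zring.exists_aeval {p z : ℝ} (hz : z ∈ Zring p) :
    ∃ P : Polynomial ℤ, Polynomial.aeval p P = z := by
  induction hz using Subring.closure_induction with
  | mem x hx => exact ⟨.X, by rw [mem_singleton_iff.1 hx]; simp⟩
  | zero => exact ⟨0, by simp⟩
  | one => exact ⟨1, by simp⟩
  | add x y _ _ h h' => obtain ⟨P, rfl⟩ := h; obtain ⟨Q, rfl⟩ := h'; exact ⟨P + Q, by simp⟩
  | neg x _ h => obtain ⟨P, rfl⟩ := h; exact ⟨-P, by simp⟩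
  | mul x y _ _ h h' => obtain ⟨P, rfl⟩ := h; obtain ⟨Q, rfl⟩ := h'; exact ⟨P * Q, by simp⟩

lemma Finset.exists_subset_card_fiber {α : Type*} [DecidableEq α] (W : Finset α) (w : α → ℕ)
    (t : ℕ → ℕ) (ht : ∀ k, t k ≤ (W.filter (w · = k)).card) :
    ∃ U ⊆ W, ∀ k, (U.filter (w · = k)).card = t k := by
  choose V hV hVc using fun k => Finset.exists_subset_card_eq (ht k)
  refine ⟨W.filter fun x => x ∈ V (w x), Finset.filter_subset _ _, fun k => ?_⟩
  rw [← hVc k]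
  congr 1
  ext x
  simp only [Finset.mem_filter]
  constructor
  · rintro ⟨⟨_, h⟩, rfl⟩; exact h
  · intro h
    have := Finset.mem_filter.1 (hV k h)
    exact ⟨⟨this.1, by rw [this.2]; exact h⟩, this.2⟩

open Polynomial in
lemma exists_words_aux {α κ : Type*} (w : α → ℕ) (s : Finset κ) (P : κ → ℤ[X]) (P0 : ℤ[X])
    (hP0 : ∀ k, 0 ≤ P0.coeff k)
    (hP : ∀ c ∈ s, ∀ k, 0 ≤ (P c).coeff k) (W : Finset α)
    (hW : P0 + ∑ c ∈ s, P c = ∑ u ∈ W, X ^ w u) :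
    ∃ U : κ → Finset α, (∀ c ∈ s, U c ⊆ W) ∧ (s : Set κ).PairwiseDisjoint U ∧
      ∀ c ∈ s, P c = ∑ u ∈ U c, X ^ w u := by
  classical
  induction s using Finset.induction_on generalizing W with
  | empty => exact ⟨fun _ => ∅, by simp, by simp, by simp⟩
  | insert a s ha ih =>
    rw [Finset.sum_insert ha] at hW
    have hcf : ∀ (V : Finset α) k, (∑ u ∈ V, (X : ℤ[X]) ^ w u).coeff k =
        (V.filter (w · = k)).card := by
      intro V k
      rw [finsetSum_coeff]
      simp [coeff_X_pow, eq_comm]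
    have hPa := hP a (Finset.mem_insert_self a s)
    obtain ⟨V, hVW, hV⟩ := W.exists_subset_card_fiber w (fun k => ((P a).coeff k).toNat) (by
      intro k
      have h1 := congrArg (fun Q => Q.coeff k) hW
      simp only [coeff_add, hcf, finsetSum_coeff] at h1
      have h2 := hP0 k
      have h3 : 0 ≤ ∑ c ∈ s, (P c).coeff k :=
        Finset.sum_nonneg fun c hc => hP c (Finset.mem_insert_of_mem hc) k
      have := hPa k
      omega)
    have hPV : P a = ∑ u ∈ V, X ^ w u := by
      ext k
      rw [hcf, hV, Int.toNat_of_nonneg (hPa k)]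
    obtain ⟨U, hU, hUd, hUs⟩ := ih (fun c hc => hP c (Finset.mem_insert_of_mem hc)) (W \ V) (by
      rw [← Finset.sum_sdiff hVW, ← hPV] at hW
      linear_combination hW)
    refine ⟨Function.update U a V, ?_, ?_, ?_⟩
    · intro c hc
      rcases Finset.mem_insert.1 hc with rfl | hc'
      · simpa using hVW
      · rw [Function.update_of_ne (by rintro rfl; exact ha hc')]
        exact (hU c hc').trans Finset.sdiff_subset
    · rw [Finset.coe_insert]
      refine PairwiseDisjoint.insert_of_notMem ?_ (by simpa using ha) ?_
      · intro c hc c' hc' hcc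
        simp only [Function.onFun]
        rw [Function.update_of_ne (by rintro rfl; exact ha hc),
          Function.update_of_ne (by rintro rfl; exact ha hc')]
        exact hUd hc hc' hcc
      · intro c hc
        rw [Function.update_self, Function.update_of_ne (by rintro rfl; exact ha hc)]
        exact Finset.disjoint_of_subset_right (hU c hc) Finset.disjoint_sdiff
    · intro c hc
      rcases Finset.mem_insert.1 hc with rfl | hc'
      · simpa using hPV
      · rw [Function.update_of_ne (by rintro rfl; exact ha hc')]
        exact hUs c hc'

open Polynomial in
/-- Prescribed positive values of `ℤ[p]` with sum less than one are realized by disjoint families of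
words of a sufficiently deep cut. -/
theorem exists_words {ι κ : Type*} [Fintype ι] {lam : ι → ℕ} {p : ℝ} (hp0 : 0 < p) (hp1 : p < 1)
    (hl : ∀ i, 0 < lam i) (hsum : ∑ i, p ^ lam i = 1) (hgcd : Finset.univ.gcd lam = 1)
    (s : Finset κ) (q : κ → ℝ) (hq : ∀ c ∈ s, q c ∈ Zring p) (hq0 : ∀ c ∈ s, 0 < q c)
    (hq1 : ∑ c ∈ s, q c < 1) :
    ∃ N, ∀ n ≥ N, ∃ U : κ → Finset (List ι), (∀ c ∈ s, U c ⊆ cut lam n) ∧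
      (s : Set κ).PairwiseDisjoint U ∧ ∀ c ∈ s, ∑ u ∈ U c, p ^ wt lam u = q c := by
  classical
  have : ∀ c, ∃ P : ℤ[X], c ∈ s → aeval p P = q c := fun c => by
    by_cases hc : c ∈ s
    · exact (Zring.exists_aeval (hq c hc)).imp fun P hP _ => hP
    · exact ⟨0, fun h => (hc h).elim⟩
  choose P hP using this
  have hP0 : aeval p (1 - ∑ c ∈ s, P c) = 1 - ∑ c ∈ s, q c := by
    rw [map_sub, map_one, map_sum, Finset.sum_congr rfl hP]
  obtain ⟨N0, hN0⟩ := Expand.exists_coeff_expandTo_nonneg hp0 hp1 hl hsum hgcd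
    (1 - ∑ c ∈ s, P c) (by rw [hP0]; linarith)
  have : ∀ c, ∃ N, c ∈ s → ∀ n ≥ N, ∀ k, 0 ≤ (expandTo lam n (P c)).coeff k := fun c => by
    by_cases hc : c ∈ s
    · obtain ⟨N, hN⟩ := Expand.exists_coeff_expandTo_nonneg hp0 hp1 hl hsum hgcd (P c)
        (by rw [hP c hc]; exact hq0 c hc)
      exact ⟨N, fun _ => hN⟩
    · exact ⟨0, fun h => (hc h).elim⟩
  choose N hN using this
  refine ⟨max N0 (s.sup N), fun n hn => ?_⟩
  obtain ⟨U, h1, h2, h3⟩ := exists_words_aux (wt lam) s (fun c => expandTo lam n (P c))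
    (expandTo lam n (1 - ∑ c ∈ s, P c)) (hN0 n ((le_max_left _ _).trans hn))
    (fun c hc => hN c hc n ((Finset.le_sup hc).trans ((le_max_right _ _).trans hn))) (cut lam n) (by
      rw [← Expand.expandTo_sum, ← Expand.expandTo_add, sub_add_cancel, expandTo_one hl])
  refine ⟨U, h1, h2, fun c hc => ?_⟩
  have := congrArg (aeval p) (h3 c hc)
  rw [Expand.eval_expandTo hsum, hP c hc] at this
  rw [this]
  simp

namespace IFS

variable {d : ℕ}

/-- The composition of the maps of `S` along a word. -/
def g (S : IFS d) : List S.ι → EuclideanSpace ℝ (Fin d) → EuclideanSpace ℝ (Fin d)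
  | [] => id
  | i :: u => S.f i ∘ S.g u

/-- The standing geometric hypotheses on an iterated function system. -/
structure Geo (S : IFS d) (lam : S.ι → ℕ) (r : ℝ) : Prop where
  r0 : 0 < r
  r1 : r < 1
  hl : ∀ i, 0 < lam i
  hr : ∀ i, S.r i = r ^ lam i
  osc : S.OSC
  att : S.IsAttractor S.attractor

lemma g_append (S : IFS d) (u v : List S.ι) (x : EuclideanSpace ℝ (Fin d)) :
    S.g (u ++ v) x = S.g u (S.g v x) := by
  induction u with
  | nil => rfl
  | cons i u ih => simp [g, ih]

lemma g_append_image (S : IFS d) (u v : List S.ι) (A : Set (EuclideanSpace ℝ (Fin d))) :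
    S.g (u ++ v) '' A = S.g u '' (S.g v '' A) := by
  rw [image_image]; exact image_congr fun x _ => S.g_append u v x

@[simp] lemma g_nil (S : IFS d) : S.g [] = id := rfl

@[simp] lemma g_singleton (S : IFS d) (i : S.ι) : S.g [i] = S.f i := rfl

lemma f_surjective (S : IFS d) (i : S.ι) : Function.Surjective (S.f i) := by
  have hri := S.r_pos i
  have hiso : Isometry fun x => (S.r i)⁻¹ • S.f i x := Isometry.of_dist_eq fun x y => by
    rw [dist_smul₀, S.sim, Real.norm_eq_abs, abs_of_pos (by positivity)]
    field_simp
  set φ := hiso.affineIsometryOfStrictConvexSpace with hφ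
  have hs : Function.Surjective φ := by
    have h1 : Function.Surjective φ.linear :=
      LinearMap.surjective_of_injective φ.linearIsometry.injective
    exact φ.toAffineMap.linear_surjective_iff.1 h1
  intro y
  obtain ⟨x, hx⟩ := hs ((S.r i)⁻¹ • y)
  refine ⟨x, ?_⟩
  have : (S.r i)⁻¹ • S.f i x = (S.r i)⁻¹ • y := hx
  exact smul_right_injective _ (inv_ne_zero hri.ne') this

lemma g_surjective (S : IFS d) (u : List S.ι) : Function.Surjective (S.g u) := by
  induction u with
  | nil => exact Function.surjective_id
  | cons i u ih => exact (S.f_surjective i).comp ih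

lemma g_image_subset (S : IFS d) {O : Set (EuclideanSpace ℝ (Fin d))}
    (h : ∀ i, S.f i '' O ⊆ O) (u : List S.ι) : S.g u '' O ⊆ O := by
  induction u with
  | nil => simp
  | cons i u ih =>
    rw [g, image_comp]
    exact (image_mono ih).trans (h i)

namespace Geo

variable {S : IFS d} {lam : S.ι → ℕ} {r : ℝ}

lemma dist_g (h : S.Geo lam r) (u : List S.ι) (x y : EuclideanSpace ℝ (Fin d)) :
    dist (S.g u x) (S.g u y) = r ^ wt lam u * dist x y := by
  induction u with
  | nil => simp
  | cons i u ih =>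
    rw [g, Function.comp, Function.comp, S.sim, ih, h.hr, wt_cons, pow_add, mul_assoc]

lemma continuous_g (h : S.Geo lam r) (u : List S.ι) : Continuous (S.g u) :=
  (LipschitzWith.of_dist_le_mul (K := ⟨r ^ wt lam u, pow_nonneg h.r0.le _⟩)
    fun x y => (h.dist_g u x y).le).continuous

lemma g_injective (h : S.Geo lam r) (u : List S.ι) : Function.Injective (S.g u) := by
  intro x y hxy
  have := h.dist_g u x y
  rw [hxy, dist_self] at this
  have h2 := pow_pos h.r0 (wt lam u)
  exact dist_eq_zero.1 (by nlinarith [dist_nonneg (x := x) (y := y)])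

lemma g_image_ball (h : S.Geo lam r) (u : List S.ι) (x : EuclideanSpace ℝ (Fin d)) (ε : ℝ) :
    S.g u '' ball x ε = ball (S.g u x) (r ^ wt lam u * ε) := by
  have h2 := pow_pos h.r0 (wt lam u)
  ext y
  obtain ⟨y, rfl⟩ := S.g_surjective u y
  rw [(h.g_injective u).mem_set_image, mem_ball, mem_ball, h.dist_g, mul_lt_mul_iff_right₀ h2]

lemma isOpen_g_image (h : S.Geo lam r) (u : List S.ι) {O : Set (EuclideanSpace ℝ (Fin d))}
    (hO : IsOpen O) : IsOpen (S.g u '' O) := by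
  rw [Metric.isOpen_iff] at hO ⊢
  rintro _ ⟨x, hx, rfl⟩
  obtain ⟨ε, hε, hb⟩ := hO x hx
  exact ⟨r ^ wt lam u * ε, mul_pos (pow_pos h.r0 _) hε, by
    rw [← h.g_image_ball]; exact image_mono hb⟩

lemma nonempty (h : S.Geo lam r) : S.attractor.Nonempty := h.att.1

lemma isCompact (h : S.Geo lam r) : IsCompact S.attractor := h.att.2.1

lemma f_image_subset (h : S.Geo lam r) (i : S.ι) : S.f i '' S.attractor ⊆ S.attractor := by
  conv_rhs => rw [h.att.2.2]
  exact subset_iUnion (fun i => S.f i '' S.attractor) i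

lemma g_subset (h : S.Geo lam r) (u : List S.ι) : S.g u '' S.attractor ⊆ S.attractor :=
  S.g_image_subset h.f_image_subset u

lemma g_mem (h : S.Geo lam r) (u : List S.ι) {x : EuclideanSpace ℝ (Fin d)}
    (hx : x ∈ S.attractor) : S.g u x ∈ S.attractor := h.g_subset u ⟨x, hx, rfl⟩

lemma exists_mem_cut (h : S.Geo lam r) (k : ℕ) {x : EuclideanSpace ℝ (Fin d)}
    (hx : x ∈ S.attractor) : ∃ u ∈ cut lam k, x ∈ S.g u '' S.attractor := by
  induction k with
  | zero => exact ⟨[], by simp [cut], by simpa using hx⟩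
  | succ k ih =>
    obtain ⟨u, hu, y, hy, rfl⟩ := ih
    by_cases huk : wt lam u = k
    · rw [h.att.2.2] at hy
      obtain ⟨i, z, hz, rfl⟩ := mem_iUnion.1 hy
      exact ⟨u ++ [i], mem_cut_succ.2 (.inr ⟨u, hu, huk, i, rfl⟩), z, hz, S.g_append u [i] z⟩
    · have := le_wt_of_mem_cut h.hl hu
      exact ⟨u, mem_cut_succ.2 (.inl ⟨hu, by omega⟩), y, hy, rfl⟩

lemma iUnion_cut (h : S.Geo lam r) (k : ℕ) :
    ⋃ u ∈ cut lam k, S.g u '' S.attractor = S.attractor := by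
  apply Subset.antisymm
  · exact iUnion₂_subset fun u _ => h.g_subset u
  · intro x hx
    obtain ⟨u, hu, hxu⟩ := h.exists_mem_cut k hx
    exact mem_iUnion₂.2 ⟨u, hu, hxu⟩

lemma disjoint_of_not_prefix (h : S.Geo lam r) {O : Set (EuclideanSpace ℝ (Fin d))}
    (hO : S.OSCSet O) {u v : List S.ι} (huv : ¬ u <+: v) (hvu : ¬ v <+: u) :
    Disjoint (S.g u '' O) (S.g v '' O) := by
  induction u generalizing v with
  | nil => exact (huv v.nil_prefix).elim
  | cons i u ih =>
    cases v with
    | nil => exact (hvu (List.nil_prefix)).elim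
    | cons j v =>
      rw [g, g, image_comp, image_comp]
      by_cases hij : i = j
      · subst hij
        have hinj : Function.Injective (S.f i) := h.g_injective [i]
        exact (disjoint_image_iff hinj).2 (ih (by simpa using huv) (by simpa using hvu))
      · exact (hO.2.2.2.2 i j hij).mono (image_mono (S.g_image_subset hO.2.2.2.1 u))
          (image_mono (S.g_image_subset hO.2.2.2.1 v))

lemma disjoint_of_mem_cut (h : S.Geo lam r) {O : Set (EuclideanSpace ℝ (Fin d))}
    (hO : S.OSCSet O) {k : ℕ} {u v : List S.ι} (hu : u ∈ cut lam k) (hv : v ∈ cut lam k)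
    (huv : u ≠ v) : Disjoint (S.g u '' O) (S.g v '' O) :=
  h.disjoint_of_not_prefix hO (fun hp => huv (eq_of_prefix_of_mem_cut hu hv hp))
    fun hp => huv (eq_of_prefix_of_mem_cut hv hu hp).symm

lemma subset_closure (h : S.Geo lam r) {O : Set (EuclideanSpace ℝ (Fin d))}
    (hO : S.OSCSet O) : S.attractor ⊆ closure O := by
  intro x hx
  obtain ⟨a, ha⟩ := hO.1
  rw [Metric.mem_closure_iff]
  intro ε hε
  obtain ⟨D, hD⟩ := isBounded_iff.1 (h.isCompact.isBounded.insert a)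
  have hD0 : 0 ≤ D := dist_nonneg.trans (hD (mem_insert a _) (mem_insert a _))
  obtain ⟨k, hk⟩ := exists_pow_lt_of_lt_one (x := ε / (D + 1)) (by positivity) h.r1
  obtain ⟨u, hu, y, hy, rfl⟩ := h.exists_mem_cut k hx
  refine ⟨S.g u a, S.g_image_subset hO.2.2.2.1 u ⟨a, ha, rfl⟩, ?_⟩
  rw [h.dist_g]
  have h1 : r ^ wt lam u ≤ r ^ k := pow_le_pow_of_le_one h.r0.le h.r1.le (le_wt_of_mem_cut h.hl hu)
  have h2 := hD (mem_insert_of_mem a hy) (mem_insert a _)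
  rw [lt_div_iff₀ (by positivity)] at hk
  calc r ^ wt lam u * dist y a ≤ r ^ k * D := by
        apply mul_le_mul h1 h2 dist_nonneg (pow_nonneg h.r0.le _)
    _ ≤ r ^ k * (D + 1) := by have := pow_nonneg h.r0.le k; nlinarith
    _ < ε := hk

lemma exists_le (lam : S.ι → ℕ) : ∃ Λ, ∀ i, lam i ≤ Λ :=
  ⟨∑ i, lam i, fun i => Finset.single_le_sum (fun _ _ => Nat.zero_le _) (Finset.mem_univ i)⟩

end Geo

end IFS

/-- A separated subset of a ball has bounded cardinality. -/
lemma exists_card_le_of_separated {α : Type*} [PseudoMetricSpace α] [ProperSpace α] (a : α) (R : ℝ)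
    {δ : ℝ} (hδ : 0 < δ) : ∃ M : ℕ, ∀ (ι : Type) (s : Finset ι) (x : ι → α),
      (∀ i ∈ s, x i ∈ closedBall a R) → (∀ i ∈ s, ∀ j ∈ s, i ≠ j → δ ≤ dist (x i) (x j)) →
      s.card ≤ M := by
  classical
  obtain ⟨t, -, htf, ht⟩ := (isCompact_closedBall a R).finite_cover_balls (half_pos hδ)
  refine ⟨htf.toFinset.card, fun ι s x hx hs => ?_⟩
  have : ∀ i ∈ s, ∃ c ∈ t, x i ∈ ball c (δ / 2) := fun i hi => by simpa using ht (hx i hi)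
  have _ : Nonempty α := ⟨a⟩
  choose! c hc hxc using this
  refine Finset.card_le_card_of_injOn c (fun i hi => by simpa using hc i hi) ?_
  intro i hi j hj hij
  by_contra hne
  have h1 := hs i hi j hj hne
  have h2 := hxc i hi
  have h3 := hxc j hj
  rw [← hij] at h3
  have := dist_triangle_right (x i) (x j) (c i)
  rw [mem_ball] at h2 h3
  linarith

namespace IFS.Geo

variable {d : ℕ} {S : IFS d} {lam : S.ι → ℕ} {r : ℝ}

open scoped Classical in
/-- The pieces of a cut close to a given point are boundedly many. -/
lemma exists_card_near_le (h : S.Geo lam r) (C : ℝ) : ∃ M : ℕ, ∀ k x,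
    ((cut lam k).filter fun u => ∃ y ∈ S.attractor, dist (S.g u y) x ≤ C * r ^ k).card ≤ M := by
  have r0 := h.r0
  obtain ⟨O, hO⟩ := h.osc
  obtain ⟨a, ha⟩ := hO.1
  obtain ⟨ρ, hρ, hball⟩ := Metric.isOpen_iff.1 hO.2.1 a ha
  obtain ⟨Λ, hΛ⟩ := exists_le lam
  obtain ⟨D, hD⟩ := isBounded_iff.1 (h.isCompact.isBounded.insert a)
  obtain ⟨M, hM⟩ := exists_card_le_of_separated (0 : EuclideanSpace ℝ (Fin d)) (C + D)
    (δ := r ^ Λ * ρ) (by positivity)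
  refine ⟨M, fun k x => hM _ _ (fun u => (r ^ k)⁻¹ • (S.g u a - x)) ?_ ?_⟩
  · intro u hu
    obtain ⟨hu, y, hy, hyx⟩ := Finset.mem_filter.1 hu
    have h1 : r ^ wt lam u ≤ r ^ k := pow_le_pow_of_le_one r0.le h.r1.le (le_wt_of_mem_cut h.hl hu)
    have h2 := hD (mem_insert a _) (mem_insert_of_mem a hy)
    have h3 : dist (S.g u a) x ≤ (C + D) * r ^ k := by
      refine (dist_triangle _ (S.g u y) _).trans ?_
      rw [h.dist_g]
      have : r ^ wt lam u * dist a y ≤ r ^ k * D := mul_le_mul h1 h2 dist_nonneg (by positivity)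
      linarith
    rw [mem_closedBall_zero_iff, norm_smul, norm_inv, norm_pow, Real.norm_of_nonneg r0.le,
      ← dist_eq_norm, inv_mul_le_iff₀ (by positivity), mul_comm]
    exact h3
  · intro u hu v hv huv
    have hu := (Finset.mem_filter.1 hu).1
    have hv := (Finset.mem_filter.1 hv).1
    have hd := h.disjoint_of_mem_cut hO hu hv huv
    have h1 : r ^ wt lam u * ρ ≤ dist (S.g v a) (S.g u a) := by
      by_contra! hlt
      refine disjoint_left.1 hd (image_mono hball ?_) (mem_image_of_mem _ ha)
      rw [h.g_image_ball]
      exact hlt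
    have h2 : r ^ (k + Λ) ≤ r ^ wt lam u :=
      pow_le_pow_of_le_one r0.le h.r1.le (wt_le_of_mem_cut hΛ hu)
    rw [dist_smul₀, norm_inv, norm_pow, Real.norm_of_nonneg r0.le, dist_sub_right,
      le_inv_mul_iff₀ (by positivity), ← mul_assoc, ← pow_add, dist_comm]
    exact (mul_le_mul_of_nonneg_right h2 hρ.le).trans h1

end IFS.Geo

section words

variable {ι : Type*} [Fintype ι] {lam : ι → ℕ}

lemma exists_prefix_mem_cut {k n : ℕ} (hkn : k ≤ n) {v : List ι}
    (hv : v ∈ cut lam n) : ∃ u ∈ cut lam k, u <+: v := by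
  induction n, hkn using Nat.le_induction generalizing v with
  | base => exact ⟨v, hv, List.prefix_refl v⟩
  | succ n hn ih =>
    rcases mem_cut_succ.1 hv with ⟨hv, -⟩ | ⟨w, hw, -, i, rfl⟩
    · exact ih hv
    · obtain ⟨u, hu, huw⟩ := ih hw
      exact ⟨u, hu, huw.trans (List.prefix_append w [i])⟩

open scoped Classical in
lemma sum_cut_prefix_le {q : ℝ} (hq : 0 ≤ q) (hl : ∀ i, 0 < lam i) (hsum : ∑ i, q ^ lam i = 1)
    (u : List ι) (n : ℕ) :
    ∑ v ∈ cut lam n, (if u <+: v then q ^ wt lam v else 0) ≤ q ^ wt lam u := by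
  by_cases hu : u ∈ cut lam n
  · rw [Finset.sum_eq_single_of_mem u hu]
    · simp
    · intro v hv hvu
      rw [if_neg]
      exact fun h => hvu (eq_of_prefix_of_mem_cut hu hv h).symm
  induction n with
  | zero =>
    have : u ≠ [] := by simpa [cut] using hu
    simp only [cut, Finset.sum_singleton, List.prefix_nil, if_neg this]
    positivity
  | succ n ih =>
    have key : ∀ v ∈ cut lam n, wt lam v = n → ∑ i, (if u <+: v ++ [i] then
        q ^ wt lam (v ++ [i]) else 0) = if u <+: v then q ^ wt lam v else 0 := by
      intro v hv hvn
      have : ∀ i, (u <+: v ++ [i]) = (u <+: v) := by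
        intro i
        rw [List.prefix_concat_iff]
        simp only [eq_iff_iff, or_iff_right_iff_imp]
        rintro rfl
        exact (hu (mem_cut_succ.2 (.inr ⟨v, hv, hvn, i, rfl⟩))).elim
      simp_rw [this]
      split_ifs
      · simp_rw [wt_append, pow_add, ← Finset.mul_sum]
        simp [hsum]
      · simp
    rw [sum_cut_succ, Finset.sum_congr rfl fun v hv => key v (Finset.mem_filter.1 hv).1
      (Finset.mem_filter.1 hv).2, ← filter_le_eq_cut hl]
    by_cases hun : u ∈ cut lam n
    · rw [Finset.sum_eq_single_of_mem u hun]
      · simp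
      · intro v hv hvu
        rw [if_neg]
        exact fun h => hvu (eq_of_prefix_of_mem_cut hun hv h).symm
    · exact ih hun

lemma one_le_sum_of_prefix {q : ℝ} (hq : 0 ≤ q) (hl : ∀ i, 0 < lam i)
    (hsum : ∑ i, q ^ lam i = 1) {κ : Type*} (J : Finset κ) (A : κ → Finset (List ι)) (n : ℕ)
    (h : ∀ v ∈ cut lam n, ∃ j ∈ J, ∃ u ∈ A j, u <+: v) :
    1 ≤ ∑ j ∈ J, ∑ u ∈ A j, q ^ wt lam u := by
  classical
  rw [← sum_cut_pow hl hsum n]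
  calc ∑ v ∈ cut lam n, q ^ wt lam v
      ≤ ∑ v ∈ cut lam n, ∑ j ∈ J, ∑ u ∈ A j, (if u <+: v then q ^ wt lam v else 0) := by
        refine Finset.sum_le_sum fun v hv => ?_
        obtain ⟨j, hj, u, hu, huv⟩ := h v hv
        have h0 : ∀ u : List ι, 0 ≤ (if u <+: v then q ^ wt lam v else 0) := by
          intro u; split_ifs <;> positivity
        refine le_trans ?_ (Finset.single_le_sum
          (f := fun j => ∑ u ∈ A j, (if u <+: v then q ^ wt lam v else 0))
          (fun j _ => Finset.sum_nonneg fun u _ => h0 u) hj)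
        refine le_trans ?_ (Finset.single_le_sum (fun u _ => h0 u) hu)
        simp [huv]
    _ = ∑ j ∈ J, ∑ u ∈ A j, ∑ v ∈ cut lam n, (if u <+: v then q ^ wt lam v else 0) := by
        rw [Finset.sum_comm]
        exact Finset.sum_congr rfl fun j _ => Finset.sum_comm
    _ ≤ _ := Finset.sum_le_sum fun j _ => Finset.sum_le_sum fun u _ =>
        sum_cut_prefix_le hq hl hsum u n

end words

namespace IFS.Geo

variable {d : ℕ} {S : IFS d} {lam : S.ι → ℕ} {r : ℝ}

/-- A cover by balls of radii `2 r ^ k j` has weight bounded below. -/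
lemma exists_one_le_sum_of_cover (h : S.Geo lam r) {q : ℝ} (hq : 0 < q)
    (hsum : ∑ i, q ^ lam i = 1) : ∃ M : ℕ, ∀ (κ : Type) (J : Finset κ)
      (x : κ → EuclideanSpace ℝ (Fin d)) (k : κ → ℕ),
      S.attractor ⊆ ⋃ j ∈ J, ball (x j) (2 * r ^ k j) → 1 ≤ M * ∑ j ∈ J, q ^ k j := by
  classical
  obtain ⟨M, hM⟩ := h.exists_card_near_le 2
  refine ⟨M, fun κ J x k hJ => ?_⟩
  set A : κ → Finset (List S.ι) := fun j => (cut lam (k j)).filter fun u =>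
    ∃ y ∈ S.attractor, dist (S.g u y) (x j) ≤ 2 * r ^ k j
  obtain ⟨a, ha⟩ := h.nonempty
  have h1 := one_le_sum_of_prefix hq.le h.hl hsum J A (J.sup k) (fun v hv => by
    obtain ⟨j, hj, hvj⟩ := mem_iUnion₂.1 (hJ (h.g_mem v ha))
    obtain ⟨u, hu, w, rfl⟩ := exists_prefix_mem_cut (Finset.le_sup hj : k j ≤ _) hv
    refine ⟨j, hj, u, Finset.mem_filter.2 ⟨hu, S.g w a, h.g_mem w ha, ?_⟩, List.prefix_append u w⟩
    rw [← S.g_append]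
    exact (mem_ball.1 hvj).le)
  refine h1.trans ?_
  rw [Finset.mul_sum]
  refine Finset.sum_le_sum fun j _ => ?_
  have hq1 : q ≤ 1 := by
    by_contra! hlt
    have : ∀ i, 1 ≤ q ^ lam i := fun i => one_le_pow₀ hlt.le
    have hne : Nonempty S.ι := by
      rw [h.att.2.2] at ha
      exact ⟨(mem_iUnion.1 ha).choose⟩
    have h2 : q ^ lam hne.some ≤ 1 := by
      rw [← hsum]
      exact Finset.single_le_sum (f := fun i => q ^ lam i) (fun i _ => by positivity)
        (Finset.mem_univ _)
    exact absurd h2 (not_le.2 (one_lt_pow₀ hlt (h.hl _).ne'))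
  calc ∑ u ∈ A j, q ^ wt lam u ≤ (A j).card • q ^ k j := by
        refine Finset.sum_le_card_nsmul _ _ _ fun u hu => ?_
        exact pow_le_pow_of_le_one hq.le hq1 (le_wt_of_mem_cut h.hl (Finset.mem_filter.1 hu).1)
    _ ≤ M * q ^ k j := by
        rw [nsmul_eq_mul]
        gcongr
        convert hM (k j) (x j)

lemma hausdorffMeasure_ne_top (h : S.Geo lam r) {s : ℝ} (hs : 0 < s)
    (hsum : ∑ i, (r ^ s) ^ lam i = 1) : μH[s] S.attractor ≠ ⊤ := by
  have r0 := h.r0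
  obtain ⟨D, hD⟩ := isBounded_iff.1 h.isCompact.isBounded
  have hD0 : 0 ≤ D := dist_nonneg.trans (hD h.nonempty.some_mem h.nonempty.some_mem)
  have hdiam : ∀ u, ediam (S.g u '' S.attractor) ≤ ENNReal.ofReal (r ^ wt lam u * D) := by
    intro u
    refine ediam_le ?_
    rintro _ ⟨x, hx, rfl⟩ _ ⟨y, hy, rfl⟩
    rw [edist_dist, h.dist_g]
    exact ENNReal.ofReal_le_ofReal (by gcongr; exact hD hx hy)
  have hlim : Filter.Tendsto (fun n => ENNReal.ofReal (r ^ n * D)) Filter.atTop (nhds 0) := by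
    have := (tendsto_pow_atTop_nhds_zero_of_lt_one r0.le h.r1).mul_const D
    simpa using ENNReal.tendsto_ofReal this
  have key := Measure.hausdorffMeasure_le_liminf_sum s S.attractor
    (ι := fun n => cut lam n) _ hlim (fun n u => S.g u.1 '' S.attractor)
    (Filter.Eventually.of_forall fun n u => (hdiam _).trans (ENNReal.ofReal_le_ofReal (by
      gcongr ?_ * D
      exact pow_le_pow_of_le_one r0.le h.r1.le (le_wt_of_mem_cut h.hl u.2))))
    (Filter.Eventually.of_forall fun n => by
      intro x hx
      obtain ⟨u, hu, hxu⟩ := h.exists_mem_cut n hx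
      exact mem_iUnion.2 ⟨⟨u, hu⟩, hxu⟩)
  refine ne_top_of_le_ne_top (ENNReal.ofReal_ne_top (r := D ^ s)) (key.trans ?_)
  refine Filter.liminf_le_of_le (by isBoundedDefault) fun b hb => ?_
  obtain ⟨n, hn⟩ := hb.exists
  refine hn.trans ?_
  calc _ ≤ ∑ u : cut lam n, ENNReal.ofReal ((r ^ s) ^ wt lam u.1 * D ^ s) := by
        refine Finset.sum_le_sum fun u _ => ?_
        refine (ENNReal.rpow_le_rpow (hdiam _) hs.le).trans ?_
        rw [ENNReal.ofReal_rpow_of_nonneg (by positivity) hs.le, Real.mul_rpow (by positivity) hD0,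
          ← Real.rpow_natCast r, ← Real.rpow_mul r0.le, mul_comm _ s, Real.rpow_mul r0.le,
          Real.rpow_natCast]
    _ = ENNReal.ofReal (D ^ s) := by
        rw [← ENNReal.ofReal_sum_of_nonneg fun u _ => by positivity, ← Finset.sum_mul,
          Finset.sum_coe_sort (cut lam n) (fun u => (r ^ s) ^ wt lam u),
          sum_cut_pow h.hl hsum, one_mul]

lemma exists_pow_scale {r : ℝ} (hr0 : 0 < r) (hr1 : r < 1) {s : ℝ} (hs : 0 < s) {δ : ℝ}
    (hδ : 0 ≤ δ) (hδ1 : δ ≤ 1) {ε : ℝ} (hε : 0 < ε) :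
    ∃ k : ℕ, δ < 2 * r ^ k ∧ (r ^ s) ^ k ≤ (r ^ s)⁻¹ * δ ^ s + ε := by
  have hq0 : 0 < r ^ s := Real.rpow_pos_of_pos hr0 s
  have hq1 : r ^ s < 1 := Real.rpow_lt_one hr0.le hr1 hs
  rcases hδ.eq_or_lt with rfl | hpos
  · obtain ⟨k, hk⟩ := exists_pow_lt_of_lt_one hε hq1
    exact ⟨k, by positivity, by rw [Real.zero_rpow hs.ne']; linarith⟩
  · obtain ⟨k, hk1, hk2⟩ := exists_nat_pow_near_of_lt_one hpos hδ1 hr0 hr1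
    refine ⟨k, by have := pow_pos hr0 k; linarith, ?_⟩
    have h1 : (r ^ s) ^ (k + 1) ≤ δ ^ s := by
      rw [← Real.rpow_natCast, ← Real.rpow_mul hr0.le, mul_comm, Real.rpow_mul hr0.le,
        Real.rpow_natCast]
      exact Real.rpow_le_rpow (by positivity) hk1.le hs.le
    have h2 : (r ^ s) ^ k = (r ^ s)⁻¹ * (r ^ s) ^ (k + 1) := by
      rw [pow_succ]; field_simp
    rw [h2]
    have := mul_le_mul_of_nonneg_left h1 (inv_nonneg.2 hq0.le)
    linarith

open scoped ENNReal in
lemma hausdorffMeasure_ne_zero (h : S.Geo lam r) {s : ℝ} (hs : 0 < s)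
    (hsum : ∑ i, (r ^ s) ^ lam i = 1) : μH[s] S.attractor ≠ 0 := by
  classical
  have r0 := h.r0
  obtain ⟨q, hq⟩ : ∃ q, q = r ^ s := ⟨_, rfl⟩
  have hq0 : 0 < q := hq ▸ Real.rpow_pos_of_pos r0 s
  obtain ⟨M, hM⟩ := h.exists_one_le_sum_of_cover hq0 (hq ▸ hsum)
  intro hzero
  have hM0 : 0 < (M : ℝ) + 1 := by positivity
  rw [Measure.hausdorffMeasure_apply] at hzero
  have h1 := (le_iSup₂ (f := fun (r : ℝ≥0∞) (_ : 0 < r) =>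
    ⨅ (t : ℕ → Set (EuclideanSpace ℝ (Fin d))) (_ : S.attractor ⊆ ⋃ n, t n)
      (_ : ∀ n, ediam (t n) ≤ r), ∑' n, ⨆ _ : (t n).Nonempty, ediam (t n) ^ s) 1 one_pos).trans
    hzero.le
  have h2 : (0 : ℝ≥0∞) < ENNReal.ofReal (q / (4 * (M + 1))) := ENNReal.ofReal_pos.2 (by positivity)
  have h3 := h1.trans_lt h2
  simp only [iInf_lt_iff] at h3
  obtain ⟨t, htE, ht1, hts⟩ := h3
  obtain ⟨ε, hε0, hεs⟩ := posSumOfEncodable (ε := 1 / (4 * (M + 1))) (by positivity) ℕ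
  obtain ⟨a, haE⟩ := h.nonempty
  have hk : ∀ n, ∃ k : ℕ, (ediam (t n)).toReal < 2 * r ^ k ∧
      q ^ k ≤ q⁻¹ * (ediam (t n)).toReal ^ s + ε n := by
    intro n
    rw [hq]
    exact exists_pow_scale r0 h.r1 hs ENNReal.toReal_nonneg
      (ENNReal.toReal_mono ENNReal.one_ne_top (ht1 n)) (hε0 n)
  choose k hk1 hk2 using hk
  have hx : ∀ n, ∃ x, (t n).Nonempty → x ∈ t n := fun n => by
    by_cases hn : (t n).Nonempty
    · exact ⟨hn.some, fun _ => hn.some_mem⟩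
    · exact ⟨a, fun h => (hn h).elim⟩
  choose x hx using hx
  set U : ℕ → Set (EuclideanSpace ℝ (Fin d)) := fun n => {y | (t n).Nonempty ∧
    y ∈ ball (x n) (2 * r ^ k n)}
  have hUo : ∀ n, IsOpen (U n) := fun n => by
    by_cases hn : (t n).Nonempty
    · simp only [U, hn, true_and]; exact isOpen_ball
    · simp [U, hn]
  have hUE : S.attractor ⊆ ⋃ n, U n := by
    intro y hy
    obtain ⟨n, hn⟩ := mem_iUnion.1 (htE hy)
    refine mem_iUnion.2 ⟨n, ⟨y, hn⟩, ?_⟩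
    have h5 := edist_le_ediam_of_mem hn (hx n ⟨y, hn⟩)
    have h6 := ENNReal.toReal_mono (ne_top_of_le_ne_top ENNReal.one_ne_top (ht1 n)) h5
    rw [edist_dist, ENNReal.toReal_ofReal dist_nonneg] at h6
    exact h6.trans_lt (hk1 n)
  obtain ⟨J, hJ⟩ := h.isCompact.elim_finite_subcover U hUo hUE
  have hJ' : S.attractor ⊆ ⋃ j ∈ J.filter fun n => (t n).Nonempty, ball (x j) (2 * r ^ k j) := by
    intro y hy
    obtain ⟨j, hj, hyj⟩ := mem_iUnion₂.1 (hJ hy)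
    exact mem_iUnion₂.2 ⟨j, Finset.mem_filter.2 ⟨hj, hyj.1⟩, hyj.2⟩
  have h7 := hM ℕ _ x k hJ'
  obtain ⟨K, hK⟩ : ∃ K, K = J.filter fun n => (t n).Nonempty := ⟨_, rfl⟩
  rw [← hK] at h7
  have h8 : ∑ n ∈ K, (ediam (t n)).toReal ^ s ≤ q / (4 * (M + 1)) := by
    have : ∑ n ∈ K, ENNReal.ofReal ((ediam (t n)).toReal ^ s) ≤ ENNReal.ofReal (q / (4 * (M + 1))) := by
      refine le_trans ?_ hts.le
      refine le_trans (Finset.sum_le_sum fun n hn => ?_) (ENNReal.sum_le_tsum K)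
      rw [hK] at hn
      rw [iSup_pos (Finset.mem_filter.1 hn).2, ENNReal.toReal_rpow, ENNReal.ofReal_toReal]
      exact ENNReal.rpow_ne_top_of_nonneg hs.le (ne_top_of_le_ne_top ENNReal.one_ne_top (ht1 n))
    rw [← ENNReal.ofReal_sum_of_nonneg fun n _ => by positivity] at this
    exact (ENNReal.ofReal_le_ofReal_iff (by positivity)).1 this
  have h9 : ∑ n ∈ K, ε n ≤ 1 / (4 * (M + 1)) := by
    obtain ⟨c, hc, hc1⟩ := hεs
    exact (sum_le_hasSum K (fun n _ => (hε0 n).le) hc).trans hc1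
  have h10 : ∑ n ∈ K, q ^ k n ≤ q⁻¹ * (q / (4 * (M + 1))) + 1 / (4 * (M + 1)) := by
    refine (Finset.sum_le_sum fun n _ => hk2 n).trans ?_
    rw [Finset.sum_add_distrib, ← Finset.mul_sum]
    gcongr
  have h11 : q⁻¹ * (q / (4 * ((M : ℝ) + 1))) + 1 / (4 * (M + 1)) = 1 / (2 * (M + 1)) := by
    field_simp; norm_num
  rw [h11] at h10
  have h12 : 1 ≤ (M : ℝ) * (1 / (2 * (M + 1))) := h7.trans (by gcongr)
  rw [mul_one_div, le_div_iff₀ (by positivity)] at h12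
  have : (0 : ℝ) ≤ M := by positivity
  linarith

end IFS.Geo

namespace IFS

variable {d : ℕ} {S : IFS d} {lam : S.ι → ℕ} {p r : ℝ}

lemma Geo.hdim_eq (h : S.Geo lam r) {s : ℝ} (hs : 0 < s) (hsum : ∑ i, (r ^ s) ^ lam i = 1) :
    S.hdim = s := by
  have h1 := h.hausdorffMeasure_ne_zero hs hsum
  have h2 := h.hausdorffMeasure_ne_top hs hsum
  have := dimH_of_hausdorffMeasure_ne_zero_ne_top (d := ⟨s, hs.le⟩) h1 h2
  rw [hdim, this]
  rfl

lemma Geo.hdim_eq_zero_of_subsingleton (h : S.Geo lam r) [Subsingleton S.ι] : S.hdim = 0 := by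
  have hsub : S.attractor.Subsingleton := by
    have hb := h.isCompact.isBounded
    obtain ⟨a, ha⟩ := h.nonempty
    have ha' := ha
    rw [h.att.2.2] at ha'
    obtain ⟨i, -⟩ := mem_iUnion.1 ha'
    have hle : diam S.attractor ≤ S.r i * diam S.attractor := by
      refine diam_le_of_forall_dist_le (mul_nonneg (S.r_pos i).le diam_nonneg) fun x hx y hy => ?_
      rw [h.att.2.2] at hx hy
      obtain ⟨i', x, hx', rfl⟩ := mem_iUnion.1 hx
      obtain ⟨j', y, hy', rfl⟩ := mem_iUnion.1 hy
      rw [Subsingleton.elim i' i, Subsingleton.elim j' i, S.sim]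
      exact mul_le_mul_of_nonneg_left (dist_le_diam_of_mem hb hx' hy') (S.r_pos i).le
    have h0 : diam S.attractor ≤ 0 := by nlinarith [S.r_lt_one i]
    intro x hx y hy
    exact dist_le_zero.1 ((dist_le_diam_of_mem hb hx hy).trans h0)
  rw [hdim, hsub.dimH_zero]
  rfl

lemma exists_root {ι : Type*} [Fintype ι] {lam : ι → ℕ} (hl : ∀ i, 0 < lam i)
    (hc : 1 < Fintype.card ι) {r : ℝ} (hr0 : 0 < r) (hr1 : r < 1) :
    ∃ s : ℝ, 0 < s ∧ ∑ i, (r ^ s) ^ lam i = 1 := by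
  have hcont : ContinuousOn (fun q : ℝ => ∑ i, q ^ lam i) (Icc 0 1) := by fun_prop
  have h1 : (1 : ℝ) ∈ Icc (∑ i, (0 : ℝ) ^ lam i) (∑ i, (1 : ℝ) ^ lam i) := by
    constructor
    · rw [Finset.sum_eq_zero fun i _ => zero_pow (hl i).ne']; norm_num
    · simp only [one_pow, Finset.sum_const, Finset.card_univ, nsmul_eq_mul, mul_one]
      exact_mod_cast hc.le
  obtain ⟨q, ⟨hq0, hq1⟩, hq⟩ := intermediate_value_Icc zero_le_one hcont h1
  have hq0' : 0 < q := by
    refine hq0.lt_of_ne ?_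
    rintro rfl
    simp only [zero_pow (hl _).ne', Finset.sum_const_zero] at hq
    exact zero_ne_one hq
  have hq1' : q < 1 := by
    refine hq1.lt_of_ne ?_
    rintro rfl
    simp only [one_pow, Finset.sum_const, Finset.card_univ, nsmul_eq_mul, mul_one] at hq
    have : Fintype.card ι = 1 := by exact_mod_cast hq
    omega
  refine ⟨Real.logb r q, Real.logb_pos_of_base_lt_one hr0 hr1 hq0' hq1', ?_⟩
  rw [Real.rpow_logb hr0 hr1.ne hq0']
  exact hq

/-- The standing hypotheses on a totally disconnected self-similar set with commensurable
ratios, together with the positivity and finiteness of its Hausdorff measure. -/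
structure Nice (S : IFS d) (lam : S.ι → ℕ) (p r : ℝ) : Prop extends S.Geo lam r where
  p0 : 0 < p
  p1 : p < 1
  hpr : p = r ^ S.hdim
  gcd : Finset.univ.gcd lam = 1
  td : IsTotallyDisconnected S.attractor
  sum : ∑ i, p ^ lam i = 1
  hdim_pos : 0 < S.hdim
  ne_zero : μH[S.hdim] S.attractor ≠ 0
  ne_top : μH[S.hdim] S.attractor ≠ ⊤

lemma Geo.nice (h : S.Geo lam r) (hgcd : Finset.univ.gcd lam = 1)
    (htd : IsTotallyDisconnected S.attractor) (hc : 1 < Fintype.card S.ι) :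
    S.Nice lam (r ^ S.hdim) r := by
  obtain ⟨s, hs, hsum⟩ := exists_root h.hl hc h.r0 h.r1
  have he := h.hdim_eq hs hsum
  exact
    { h with
      p0 := Real.rpow_pos_of_pos h.r0 _
      p1 := Real.rpow_lt_one h.r0.le h.r1 (he ▸ hs)
      hpr := rfl
      gcd := hgcd
      td := htd
      sum := he.symm ▸ hsum
      hdim_pos := he ▸ hs
      ne_zero := he.symm ▸ h.hausdorffMeasure_ne_zero hs hsum
      ne_top := he.symm ▸ h.hausdorffMeasure_ne_top hs hsum }

lemma MemTOECpr.exists_nice (h : S.MemTOECpr p r) (hp1 : p < 1) :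
    ∃ lam, S.Nice lam p r := by
  obtain ⟨⟨hosc, -, htd⟩, ⟨hr0, hr1, lam, hl, hr, hgcd⟩, hp⟩ := h
  have hne : S.hdim ≠ 0 := by
    intro h0
    rw [h0, Real.rpow_zero] at hp
    exact hp1.ne hp
  have hatt : S.IsAttractor S.attractor := by
    by_cases hex : ∃ E, S.IsAttractor E
    · rw [attractor, dif_pos hex]
      exact hex.choose_spec
    · refine (hne ?_).elim
      rw [hdim, attractor, dif_neg hex, dimH_empty]
      rfl
  have hg : S.Geo lam r := ⟨hr0, hr1, hl, hr, hosc, hatt⟩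
  have hc : 1 < Fintype.card S.ι := by
    by_contra! hle
    have := Fintype.card_le_one_iff_subsingleton.1 hle
    exact hne hg.hdim_eq_zero_of_subsingleton
  exact ⟨lam, hp ▸ hg.nice hgcd htd hc⟩

lemma natMeasure_eq (A : Set (EuclideanSpace ℝ (Fin d))) :
    S.natMeasure A = (μH[S.hdim] A).toReal / (μH[S.hdim] S.attractor).toReal :=
  ENNReal.toReal_div _ _

lemma natMeasure_empty : S.natMeasure ∅ = 0 := by simp [natMeasure]

lemma natMeasure_nonneg (A : Set (EuclideanSpace ℝ (Fin d))) : 0 ≤ S.natMeasure A :=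
  ENNReal.toReal_nonneg

namespace Nice

variable (h : S.Nice lam p r)
include h

lemma measure_ne_top {A : Set (EuclideanSpace ℝ (Fin d))} (hA : A ⊆ S.attractor) :
    μH[S.hdim] A ≠ ⊤ := ne_top_of_le_ne_top h.ne_top (measure_mono hA)

lemma toReal_pos : 0 < (μH[S.hdim] S.attractor).toReal := ENNReal.toReal_pos h.ne_zero h.ne_top

lemma m_attractor : S.natMeasure S.attractor = 1 := by
  rw [natMeasure_eq, div_self h.toReal_pos.ne']

lemma m_mono {A B : Set (EuclideanSpace ℝ (Fin d))} (hAB : A ⊆ B) (hB : B ⊆ S.attractor) :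
    S.natMeasure A ≤ S.natMeasure B := by
  rw [natMeasure_eq, natMeasure_eq]
  exact div_le_div_of_nonneg_right
    (ENNReal.toReal_mono (h.measure_ne_top hB) (measure_mono hAB)) h.toReal_pos.le

lemma m_union_le {A B : Set (EuclideanSpace ℝ (Fin d))} (hA : A ⊆ S.attractor)
    (hB : B ⊆ S.attractor) : S.natMeasure (A ∪ B) ≤ S.natMeasure A + S.natMeasure B := by
  rw [natMeasure_eq, natMeasure_eq, natMeasure_eq, ← add_div]
  refine div_le_div_of_nonneg_right ?_ h.toReal_pos.le
  rw [← ENNReal.toReal_add (h.measure_ne_top hA) (h.measure_ne_top hB)]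
  exact ENNReal.toReal_mono (ENNReal.add_ne_top.2 ⟨h.measure_ne_top hA, h.measure_ne_top hB⟩)
    (measure_union_le A B)

lemma m_union {A B : Set (EuclideanSpace ℝ (Fin d))} (hA : A ⊆ S.attractor)
    (hB : B ⊆ S.attractor) (hd : Disjoint A B) (hm : MeasurableSet B) :
    S.natMeasure (A ∪ B) = S.natMeasure A + S.natMeasure B := by
  rw [natMeasure_eq, natMeasure_eq, natMeasure_eq, ← add_div, measure_union hd hm,
    ENNReal.toReal_add (h.measure_ne_top hA) (h.measure_ne_top hB)]

lemma m_biUnion_le {κ : Type*} (s : Finset κ) (A : κ → Set (EuclideanSpace ℝ (Fin d)))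
    (hA : ∀ i ∈ s, A i ⊆ S.attractor) :
    S.natMeasure (⋃ i ∈ s, A i) ≤ ∑ i ∈ s, S.natMeasure (A i) := by
  classical
  induction s using Finset.induction_on with
  | empty => simp [natMeasure_empty]
  | insert a s ha ih =>
    rw [Finset.set_biUnion_insert, Finset.sum_insert ha]
    have h1 := ih fun i hi => hA i (Finset.mem_insert_of_mem hi)
    have h2 : ⋃ i ∈ s, A i ⊆ S.attractor :=
      iUnion₂_subset fun i hi => hA i (Finset.mem_insert_of_mem hi)
    linarith [h.m_union_le (hA a (Finset.mem_insert_self a s)) h2]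

lemma m_image (u : List S.ι) (A : Set (EuclideanSpace ℝ (Fin d))) :
    S.natMeasure (S.g u '' A) = p ^ wt lam u * S.natMeasure A := by
  have r0 := h.r0
  have hk : (0 : ℝ) < r ^ wt lam u := pow_pos r0 _
  obtain ⟨K, hK⟩ : ∃ K : NNReal, (K : ℝ) = r ^ wt lam u := ⟨⟨_, hk.le⟩, rfl⟩
  have hK0 : K ≠ 0 := by
    rintro rfl
    exact hk.ne' (by simpa using hK.symm)
  have hKs : (K : ℝ) ^ S.hdim = p ^ wt lam u := by
    rw [hK, h.hpr, ← Real.rpow_natCast, ← Real.rpow_mul r0.le, mul_comm, Real.rpow_mul r0.le,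
      Real.rpow_natCast]
  have hL : LipschitzWith K (S.g u) :=
    LipschitzWith.of_dist_le_mul fun x y => by rw [hK, h.dist_g]
  have hA : AntilipschitzWith K⁻¹ (S.g u) := AntilipschitzWith.of_le_mul_dist fun x y => by
    rw [NNReal.coe_inv, hK, h.dist_g, inv_mul_cancel_left₀ hk.ne']
  have h1 : μH[S.hdim] (S.g u '' A) = (K : ENNReal) ^ S.hdim * μH[S.hdim] A := by
    refine le_antisymm (hL.hausdorffMeasure_image_le h.hdim_pos.le A) ?_
    have h2 := hA.le_hausdorffMeasure_image h.hdim_pos.le A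
    calc _ ≤ (K : ENNReal) ^ S.hdim * (((K⁻¹ : NNReal) : ENNReal) ^ S.hdim *
          μH[S.hdim] (S.g u '' A)) := by gcongr
      _ = _ := by
        rw [← mul_assoc, ← ENNReal.mul_rpow_of_nonneg _ _ h.hdim_pos.le, ← ENNReal.coe_mul,
          mul_inv_cancel₀ hK0]
        simp
  rw [natMeasure_eq, natMeasure_eq, h1, ENNReal.toReal_mul, ← ENNReal.toReal_rpow, ENNReal.coe_toReal, hKs,
    mul_div_assoc]

lemma m_piece (u : List S.ι) : S.natMeasure (S.g u '' S.attractor) = p ^ wt lam u := by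
  rw [h.m_image, h.m_attractor, mul_one]

lemma sum_cut (k : ℕ) : ∑ u ∈ cut lam k, p ^ wt lam u = 1 := sum_cut_pow h.hl h.sum k

lemma m_eq_sum_cut {A : Set (EuclideanSpace ℝ (Fin d))} (hA : A ⊆ S.attractor)
    (hm : MeasurableSet A) (k : ℕ) :
    S.natMeasure A = ∑ u ∈ cut lam k, S.natMeasure (A ∩ S.g u '' S.attractor) := by
  have key : ∀ B ⊆ S.attractor,
      S.natMeasure B ≤ ∑ u ∈ cut lam k, S.natMeasure (B ∩ S.g u '' S.attractor) := by
    intro B hB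
    refine le_trans (le_of_eq ?_) (h.m_biUnion_le (cut lam k) _ fun u _ => inter_subset_left.trans hB)
    rw [← inter_iUnion₂, h.iUnion_cut, inter_eq_left.2 hB]
  have hE := h.isCompact.measurableSet
  have h1 := key A hA
  have h2 := key (S.attractor \ A) sdiff_subset
  have h3 : S.natMeasure A + S.natMeasure (S.attractor \ A) = 1 := by
    rw [← h.m_union hA sdiff_subset disjoint_sdiff_right (hE.diff hm), union_sdiff_cancel hA,
      h.m_attractor]
  have h4 : ∑ u ∈ cut lam k, S.natMeasure (A ∩ S.g u '' S.attractor) +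
      ∑ u ∈ cut lam k, S.natMeasure ((S.attractor \ A) ∩ S.g u '' S.attractor) = 1 := by
    rw [← Finset.sum_add_distrib, ← h.sum_cut k]
    refine Finset.sum_congr rfl fun u _ => ?_
    have hg : MeasurableSet (S.g u '' S.attractor) :=
      (h.isCompact.image (h.continuous_g u)).measurableSet
    rw [← h.m_union (inter_subset_left.trans hA) (inter_subset_left.trans sdiff_subset)
      (disjoint_sdiff_right.mono inter_subset_left inter_subset_left) ((hE.diff hm).inter hg),
      ← union_inter_distrib_right, union_sdiff_cancel hA, inter_eq_right.2 (h.g_subset u), h.m_piece]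
  linarith

lemma m_iUnion_image {k : ℕ} {U : Finset (List S.ι)} (hU : U ⊆ cut lam k)
    (A : List S.ι → Set (EuclideanSpace ℝ (Fin d))) (hA : ∀ u ∈ U, A u ⊆ S.attractor)
    (hm : ∀ u ∈ U, MeasurableSet (S.g u '' A u)) :
    S.natMeasure (⋃ u ∈ U, S.g u '' A u) = ∑ u ∈ U, p ^ wt lam u * S.natMeasure (A u) := by
  have hs : ∀ u ∈ U, S.g u '' A u ⊆ S.attractor := fun u hu =>
    (image_mono (hA u hu)).trans (h.g_subset u)
  simp_rw [← h.m_image]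
  apply le_antisymm (h.m_biUnion_le _ _ hs)
  rw [h.m_eq_sum_cut (iUnion₂_subset hs) (U.measurableSet_biUnion hm) k]
  refine le_trans ?_ (Finset.sum_le_sum_of_subset_of_nonneg hU fun u _ _ => natMeasure_nonneg _)
  refine Finset.sum_le_sum fun u hu => h.m_mono ?_ (inter_subset_right.trans (h.g_subset u))
  exact subset_inter (subset_iUnion₂ (s := fun u _ => S.g u '' A u) u hu) (image_mono (hA u hu))

end Nice

end IFS

lemma KSet.isCompact {α : Type*} [MetricSpace α] {E P : Set α} {r : ℝ} {k : ℕ}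
    (h : KSet E r k P) (hr : 0 < r) (hE : IsCompact E) : IsCompact P :=
  hE.of_isClosed_subset (h.isClosed hr hE.isClosed) h.1

lemma exists_kset {α : Type*} [MetricSpace α] {E P : Set α} {r : ℝ} (hr1 : r < 1)
    (hPE : P ⊆ E) (hP : IsCompact P) (hP' : IsCompact (E \ P)) : ∃ k, KSet E r k P := by
  obtain ⟨δ, hδ, hd⟩ := (disjoint_sdiff_right : Disjoint P (E \ P)).exists_thickenings hP
    hP'.isClosed
  obtain ⟨k, hk⟩ := exists_pow_lt_of_lt_one hδ hr1
  refine ⟨k, hPE, fun x hx y hy hyP => ?_⟩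
  by_contra! hlt
  exact disjoint_left.1 hd (self_subset_thickening hδ P hx)
    (mem_thickening_iff.2 ⟨y, ⟨hy, hyP⟩, hlt.trans hk⟩)

/-- One step of length less than `δ` inside `X`. -/
def Step {α : Type*} [MetricSpace α] (X : Set α) (δ : ℝ) (x y : α) : Prop :=
  x ∈ X ∧ y ∈ X ∧ dist x y < δ

section chains

open Relation

variable {α : Type*} [MetricSpace α]

lemma Step.mono {X Y : Set α} {δ δ' : ℝ} (hXY : X ⊆ Y) (hδ : δ ≤ δ') {x y : α}
    (h : ReflTransGen (Step X δ) x y) : ReflTransGen (Step Y δ') x y :=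
  ReflTransGen.mono (fun _ _ hab => ⟨hXY hab.1, hXY hab.2.1, hab.2.2.trans_le hδ⟩) _ _ h

lemma Step.mem {X : Set α} {δ : ℝ} {x y : α} (h : ReflTransGen (Step X δ) x y) (hx : x ∈ X) :
    y ∈ X := by
  induction h with
  | refl => exact hx
  | tail _ h _ => exact h.2.1

lemma KSet.chain {E P : Set α} {r : ℝ} {k : ℕ} (hP : KSet E r k P) {x y : α} (hx : x ∈ P)
    (h : ReflTransGen (Step E (r ^ k)) x y) : y ∈ P := by
  induction h with
  | refl => exact hx
  | @tail b c _ h ih =>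
    by_contra hc
    exact absurd (hP.2 b ih c h.2.1 hc) (not_le.2 h.2.2)

lemma exists_chain_modulus {E : Set α} (hE : IsCompact E) (htd : IsTotallyDisconnected E) {r : ℝ}
    (hr0 : 0 < r) (hr1 : r < 1) {ε : ℝ} (hε : 0 < ε) :
    ∃ δ > 0, ∀ x y, ReflTransGen (Step E δ) x y → dist x y ≤ ε := by
  have _ : CompactSpace E := isCompact_iff_compactSpace.1 hE
  have _ : TotallyDisconnectedSpace E := totallyDisconnectedSpace_subtype_iff.2 htd
  have h1 : ∀ x : E, ∃ V : Set E, IsClopen V ∧ x ∈ V ∧ V ⊆ ball x (ε / 2) := fun x =>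
    compact_exists_isClopen_in_isOpen isOpen_ball (mem_ball_self (half_pos hε))
  choose V hV hxV hVb using h1
  have h2 : ∀ x : E, ∃ k, KSet E r k (Subtype.val '' V x) := by
    intro x
    refine exists_kset hr1 (by simp) ((hV x).1.isCompact.image continuous_subtype_val) ?_
    have : E \ Subtype.val '' V x = Subtype.val '' (V x)ᶜ := by
      ext y
      simp only [mem_sdiff, mem_image, Subtype.exists, exists_and_right, exists_eq_right, not_exists,
        mem_compl_iff]
      exact ⟨fun h => ⟨h.1, h.2 h.1⟩, fun ⟨h, h'⟩ => ⟨h, fun _ => h'⟩⟩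
    rw [this]
    exact (hV x).2.isClosed_compl.isCompact.image continuous_subtype_val
  choose k hk using h2
  obtain ⟨t, ht⟩ := isCompact_univ.elim_finite_subcover V (fun x => (hV x).2)
    fun x _ => mem_iUnion.2 ⟨x, hxV x⟩
  refine ⟨r ^ t.sup k, by positivity, fun x y hxy => ?_⟩
  rcases hxy.cases_head with rfl | ⟨c, hc, -⟩
  · simpa using hε.le
  · obtain ⟨z, hz, hxz⟩ := mem_iUnion₂.1 (ht (mem_univ ⟨x, hc.1⟩))
    have hK := (hk z).mono hr0 hr1 (Finset.le_sup hz)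
    have hx : x ∈ Subtype.val '' V z := ⟨⟨x, hc.1⟩, hxz, rfl⟩
    obtain ⟨y, hyz, rfl⟩ := hK.chain hx hxy
    have h3 := hVb z hxz
    have h4 := hVb z hyz
    rw [mem_ball, Subtype.dist_eq] at h3 h4
    have := dist_triangle_right x y z
    simp only at h3
    linarith

lemma chain_union {X Y : Set α} {δ η δX δY ε : ℝ} (hη : 0 ≤ η) (hδ : 0 < δ)
    (hX : ∀ x y, ReflTransGen (Step X δX) x y → dist x y ≤ ε)
    (hY : ∀ x y, ReflTransGen (Step Y δY) x y → dist x y ≤ η)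
    (h1 : δ ≤ δY) (h2 : η + 2 * δ ≤ δX) {x y : α} (h : ReflTransGen (Step (X ∪ Y) δ) x y) :
    dist x y ≤ ε + 2 * (η + δ) := by
  have hε : 0 ≤ ε := by simpa using hX x x .refl
  have key : ReflTransGen (Step Y δ) x y ∨ ∃ a b, a ∈ X ∧ b ∈ X ∧ dist x a ≤ η + δ ∧
      ReflTransGen (Step X δX) a b ∧ (y = b ∨ ∃ c ∈ Y, dist b c < δ ∧
        ReflTransGen (Step Y δ) c y) := by
    rcases h.cases_head with rfl | ⟨c, hc, -⟩
    · exact .inl .refl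
    have hx := hc.1
    clear hc
    by_cases hxX : x ∈ X
    · refine .inr ?_
      induction h with
      | refl => exact ⟨x, x, hxX, hxX, by simp; linarith, .refl, .inl rfl⟩
      | @tail y z _ hyz ih =>
        obtain ⟨a, b, ha, hb, hxa, hab, hby⟩ := ih
        by_cases hz : z ∈ X
        · refine ⟨a, z, ha, hz, hxa, hab.tail ⟨hb, hz, ?_⟩, .inl rfl⟩
          rcases hby with rfl | ⟨c, hc, hbc, hcy⟩
          · linarith [hyz.2.2]
          · have := hY c y (Step.mono Subset.rfl h1 hcy)
            linarith [hyz.2.2, dist_triangle4 b c y z]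
        · have hzY := hyz.2.1.resolve_left hz
          refine ⟨a, b, ha, hb, hxa, hab, .inr ?_⟩
          rcases hby with rfl | ⟨c, hc, hbc, hcy⟩
          · exact ⟨z, hzY, hyz.2.2, .refl⟩
          · exact ⟨c, hc, hbc, hcy.tail ⟨Step.mem hcy hc, hzY, hyz.2.2⟩⟩
    · have hxY := hx.resolve_left hxX
      induction h with
      | refl => exact .inl .refl
      | @tail y z _ hyz ih =>
        by_cases hz : z ∈ X
        · refine .inr ?_
          rcases ih with hxy | ⟨a, b, ha, hb, hxa, hab, hby⟩
          · have := hY x y (Step.mono Subset.rfl h1 hxy)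
            exact ⟨z, z, hz, hz, by linarith [hyz.2.2, dist_triangle x y z], .refl, .inl rfl⟩
          · refine ⟨a, z, ha, hz, hxa, hab.tail ⟨hb, hz, ?_⟩, .inl rfl⟩
            rcases hby with rfl | ⟨c, hc, hbc, hcy⟩
            · linarith [hyz.2.2]
            · have := hY c y (Step.mono Subset.rfl h1 hcy)
              linarith [hyz.2.2, dist_triangle4 b c y z]
        · have hzY := hyz.2.1.resolve_left hz
          rcases ih with hxy | ⟨a, b, ha, hb, hxa, hab, hby⟩
          · exact .inl (hxy.tail ⟨Step.mem hxy hxY, hzY, hyz.2.2⟩)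
          · refine .inr ⟨a, b, ha, hb, hxa, hab, .inr ?_⟩
            rcases hby with rfl | ⟨c, hc, hbc, hcy⟩
            · exact ⟨z, hzY, hyz.2.2, .refl⟩
            · exact ⟨c, hc, hbc, hcy.tail ⟨Step.mem hcy hc, hzY, hyz.2.2⟩⟩
  rcases key with hxy | ⟨a, b, ha, hb, hxa, hab, hby⟩
  · have := hY x y (Step.mono Subset.rfl h1 hxy)
    linarith
  · have hab' := hX a b hab
    have hbyd : dist b y ≤ η + δ := by
      rcases hby with rfl | ⟨c, hc, hbc, hcy⟩
      · simp; linarith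
      · have := hY c y (Step.mono Subset.rfl h1 hcy)
        linarith [dist_triangle b c y]
    linarith [dist_triangle4 x a b y]

end chains

namespace IFS.Geo

open Relation

variable {d : ℕ} {S : IFS d} {lam : S.ι → ℕ} {r : ℝ}

lemma chain_piece (h : S.Geo lam r) (u : List S.ι) {δ : ℝ} {x y : EuclideanSpace ℝ (Fin d)}
    (hxy : ReflTransGen (Step (S.g u '' S.attractor) (r ^ wt lam u * δ)) (S.g u x) y) :
    ∃ z, y = S.g u z ∧ ReflTransGen (Step S.attractor δ) x z := by
  have hk := pow_pos h.r0 (wt lam u)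
  induction hxy with
  | refl => exact ⟨x, rfl, .refl⟩
  | tail _ hbc ih =>
    obtain ⟨z, rfl, hz⟩ := ih
    obtain ⟨⟨b, hb, hbz⟩, ⟨c, hc, rfl⟩, hd⟩ := hbc
    rw [h.g_injective u hbz] at hb
    rw [h.dist_g, mul_lt_mul_iff_right₀ hk] at hd
    exact ⟨c, rfl, hz.tail ⟨hb, hc, hd⟩⟩

lemma exists_chain_modulus_pieces (h : S.Geo lam r) (htd : IsTotallyDisconnected S.attractor)
    (n : ℕ) : ∀ ε > 0, ∃ δ > 0, ∀ k, ∀ U ⊆ cut lam k, U.card ≤ n → ∀ x y,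
      ReflTransGen (Step (⋃ u ∈ U, S.g u '' S.attractor) (δ * r ^ k)) x y →
        dist x y ≤ ε * r ^ k := by
  classical
  have r0 := h.r0
  induction n with
  | zero =>
    intro ε hε
    refine ⟨1, one_pos, fun k U _ hU x y hxy => ?_⟩
    rw [Nat.le_zero, Finset.card_eq_zero] at hU
    subst hU
    rcases hxy.cases_head with rfl | ⟨c, hc, -⟩
    · rw [dist_self]; positivity
    · simpa using hc.1
  | succ n ih =>
    intro ε hε
    obtain ⟨Λ, hΛ⟩ := exists_le lam
    obtain ⟨δX, hδX, hX⟩ := ih (ε / 2) (by positivity)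
    obtain ⟨η, hη, hη1, hη2⟩ : ∃ η, 0 < η ∧ 4 * η ≤ ε / 2 ∧ 3 * η ≤ δX :=
      ⟨min (ε / 8) (δX / 3), by positivity, by linarith [min_le_left (ε / 8) (δX / 3)],
        by linarith [min_le_right (ε / 8) (δX / 3)]⟩
    obtain ⟨δE, hδE, hE⟩ := exists_chain_modulus h.isCompact htd r0 h.r1 hη
    obtain ⟨δ, hδ, hδ1, hδ2⟩ : ∃ δ, 0 < δ ∧ δ ≤ η ∧ δ ≤ r ^ Λ * δE :=
      ⟨min η (r ^ Λ * δE), by positivity, min_le_left _ _, min_le_right _ _⟩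
    refine ⟨δ, hδ, fun k U hUk hU x y hxy => ?_⟩
    have hk : 0 < r ^ k := by positivity
    rcases U.eq_empty_or_nonempty with rfl | ⟨v, hv⟩
    · exact (hX k ∅ (by simp) (by simp) x y (Step.mono (by simp)
        (mul_le_mul_of_nonneg_right (by linarith) hk.le) hxy)).trans (by nlinarith)
    have hw1 := le_wt_of_mem_cut h.hl (hUk hv)
    have hw2 := wt_le_of_mem_cut hΛ (hUk hv)
    have hunion : ⋃ u ∈ U, S.g u '' S.attractor =
        (⋃ u ∈ U.erase v, S.g u '' S.attractor) ∪ S.g v '' S.attractor := by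
      conv_lhs => rw [← Finset.insert_erase hv]
      rw [Finset.set_biUnion_insert, union_comm]
    rw [hunion] at hxy
    have hY : ∀ x y, ReflTransGen (Step (S.g v '' S.attractor) (r ^ wt lam v * δE)) x y →
        dist x y ≤ η * r ^ k := by
      intro x y hxy
      obtain ⟨x, rfl⟩ := S.g_surjective v x
      obtain ⟨z, rfl, hz⟩ := h.chain_piece v hxy
      rw [h.dist_g, mul_comm]
      exact mul_le_mul (hE _ _ hz) (pow_le_pow_of_le_one r0.le h.r1.le hw1) (by positivity) hη.le
    refine (chain_union (by positivity) (by positivity) (hX k (U.erase v)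
      ((Finset.erase_subset v U).trans hUk) (by rw [Finset.card_erase_of_mem hv]; omega))
      hY ?_ ?_ hxy).trans ?_
    · calc δ * r ^ k ≤ r ^ Λ * δE * r ^ k := by gcongr
        _ = r ^ (k + Λ) * δE := by ring
        _ ≤ _ := by
          gcongr ?_ * _
          exact pow_le_pow_of_le_one r0.le h.r1.le hw2
    · calc η * r ^ k + 2 * (δ * r ^ k) = (η + 2 * δ) * r ^ k := by ring
        _ ≤ δX * r ^ k := by gcongr; linarith
    · calc ε / 2 * r ^ k + 2 * (η * r ^ k + δ * r ^ k) = (ε / 2 + 2 * η + 2 * δ) * r ^ k := by ring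
        _ ≤ ε * r ^ k := by gcongr; linarith

/-- Uniform disconnectedness of a totally disconnected self-similar set. -/
lemma exists_chain_le (h : S.Geo lam r) (htd : IsTotallyDisconnected S.attractor) :
    ∃ δ > 0, ∀ k x y, ReflTransGen (Step S.attractor (δ * r ^ k)) x y → dist x y ≤ r ^ k := by
  classical
  have r0 := h.r0
  obtain ⟨M, hM⟩ := h.exists_card_near_le 2
  obtain ⟨δ, hδ, H⟩ := h.exists_chain_modulus_pieces htd M 1 one_pos
  refine ⟨min δ 1, by positivity, fun k x y hxy => ?_⟩
  have hk : 0 < r ^ k := by positivity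
  set U := (cut lam k).filter fun u => ∃ y ∈ S.attractor, dist (S.g u y) x ≤ 2 * r ^ k with hU
  have hUc : U.card ≤ M := by convert hM k x
  have hmem : ∀ z ∈ S.attractor, dist z x ≤ 2 * r ^ k → z ∈ ⋃ u ∈ U, S.g u '' S.attractor := by
    intro z hz hzx
    obtain ⟨u, hu, w, hw, rfl⟩ := h.exists_mem_cut k hz
    exact mem_iUnion₂.2 ⟨u, Finset.mem_filter.2 ⟨hu, w, hw, hzx⟩, w, hw, rfl⟩
  have key : ReflTransGen (Step (⋃ u ∈ U, S.g u '' S.attractor) (δ * r ^ k)) x y := by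
    induction hxy with
    | refl => exact .refl
    | @tail b c _ hbc ih =>
      have hb := H k U (Finset.filter_subset _ _) hUc x b ih
      rw [one_mul, dist_comm] at hb
      have h1 : min δ 1 * r ^ k ≤ r ^ k := by nlinarith [min_le_right δ 1]
      have h2 : min δ 1 * r ^ k ≤ δ * r ^ k := by nlinarith [min_le_left δ 1]
      refine ih.tail ⟨hmem b hbc.1 (by linarith), hmem c hbc.2.1 ?_, hbc.2.2.trans_le h2⟩
      have := dist_triangle_left c x b
      linarith [hbc.2.2]
  simpa using H k U (Finset.filter_subset _ _) hUc x y key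

end IFS.Geo

lemma Zring.self_mem (p : ℝ) : p ∈ Zring p := Subring.subset_closure (mem_singleton p)

open scoped Classical in
/-- The words of the `n`-th cut whose pieces are contained in `P`. -/
def IFS.inner {d : ℕ} (S : IFS d) (lam : S.ι → ℕ) (n : ℕ) (P : Set (EuclideanSpace ℝ (Fin d))) :
    Finset (List S.ι) :=
  (cut lam n).filter fun u => S.g u '' S.attractor ⊆ P

namespace IFS

variable {d : ℕ} {S : IFS d} {lam : S.ι → ℕ} {p r : ℝ}

lemma mem_inner {n : ℕ} {P : Set (EuclideanSpace ℝ (Fin d))} {u : List S.ι} :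
    u ∈ S.inner lam n P ↔ u ∈ cut lam n ∧ S.g u '' S.attractor ⊆ P := by
  classical
  simp [inner]

lemma inner_subset (n : ℕ) (P : Set (EuclideanSpace ℝ (Fin d))) : S.inner lam n P ⊆ cut lam n :=
  fun _ hu => (mem_inner.1 hu).1

namespace Geo

lemma exists_pieces (h : S.Geo lam r) : ∃ b, ∀ k n, k + b ≤ n →
    (∀ u, n ≤ wt lam u → ∀ x ∈ S.attractor, ∀ y ∈ S.attractor,
      dist (S.g u x) (S.g u y) < r ^ k) ∧ ∀ P, KSet S.attractor r k P →
    (∀ u, n ≤ wt lam u → ∀ x ∈ S.attractor, S.g u x ∈ P → S.g u '' S.attractor ⊆ P) ∧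
      ⋃ u ∈ S.inner lam n P, S.g u '' S.attractor = P := by
  have r0 := h.r0
  obtain ⟨D, hD⟩ := isBounded_iff.1 h.isCompact.isBounded
  obtain ⟨a, ha⟩ := h.nonempty
  have hD0 : 0 ≤ D := dist_nonneg.trans (hD ha ha)
  obtain ⟨b, hb⟩ := exists_pow_lt_of_lt_one (x := 1 / (D + 1)) (by positivity) h.r1
  refine ⟨b, fun k n hkn => ?_⟩
  have hdist : ∀ u, n ≤ wt lam u → ∀ x ∈ S.attractor, ∀ y ∈ S.attractor,
      dist (S.g u x) (S.g u y) < r ^ k := by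
    intro u hu x hx y hy
    rw [h.dist_g]
    have h1 : r ^ wt lam u ≤ r ^ k * r ^ b := by
      rw [← pow_add]
      exact pow_le_pow_of_le_one r0.le h.r1.le (hkn.trans hu)
    have h2 := hD hx hy
    rw [lt_div_iff₀ (by positivity)] at hb
    have hk := pow_pos r0 k
    have hbp := pow_pos r0 b
    calc r ^ wt lam u * dist x y ≤ r ^ k * r ^ b * D := by gcongr
      _ < r ^ k := by nlinarith
  refine ⟨hdist, fun P hP => ?_⟩
  have hsub : ∀ u, n ≤ wt lam u → ∀ x ∈ S.attractor, S.g u x ∈ P →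
      S.g u '' S.attractor ⊆ P := by
    rintro u hu x hx hxP _ ⟨y, hy, rfl⟩
    by_contra hyP
    exact absurd (hP.2 _ hxP _ (h.g_mem u hy) hyP) (not_le.2 (hdist u hu x hx y hy))
  refine ⟨hsub, Subset.antisymm (iUnion₂_subset fun u hu => (mem_inner.1 hu).2) fun x hx => ?_⟩
  obtain ⟨u, hu, y, hy, rfl⟩ := h.exists_mem_cut n (hP.1 hx)
  exact mem_iUnion₂.2 ⟨u, mem_inner.2 ⟨hu, hsub u (le_wt_of_mem_cut h.hl hu) y hy hx⟩, y, hy, rfl⟩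

end Geo

namespace Nice

variable (h : S.Nice lam p r)
include h

lemma m_inner {n : ℕ} {P : Set (EuclideanSpace ℝ (Fin d))}
    (hP : ⋃ u ∈ S.inner lam n P, S.g u '' S.attractor = P) :
    S.natMeasure P = ∑ u ∈ S.inner lam n P, p ^ wt lam u := by
  conv_lhs => rw [← hP]
  rw [h.m_iUnion_image (inner_subset n P) (fun _ => S.attractor) (fun _ _ => Subset.rfl)
    fun u _ => (h.isCompact.image (h.continuous_g u)).measurableSet]
  simp [h.m_attractor]

lemma measurableSet {k : ℕ} {P : Set (EuclideanSpace ℝ (Fin d))} (hP : KSet S.attractor r k P) :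
    MeasurableSet P := (hP.isClosed h.r0 h.isCompact.isClosed).measurableSet

lemma m_mem_Zring {k : ℕ} {P : Set (EuclideanSpace ℝ (Fin d))} (hP : KSet S.attractor r k P) :
    S.natMeasure P ∈ Zring p := by
  obtain ⟨b, hb⟩ := h.exists_pieces
  rw [h.m_inner (((hb k _ le_rfl).2 P hP).2)]
  exact sum_mem fun u _ => pow_mem (Zring.self_mem p) _

lemma m_pos {k : ℕ} {P : Set (EuclideanSpace ℝ (Fin d))} (hP : KSet S.attractor r k P)
    (hne : P.Nonempty) : 0 < S.natMeasure P := by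
  have p0 := h.p0
  obtain ⟨b, hb⟩ := h.exists_pieces
  have hu := ((hb k _ le_rfl).2 P hP).2
  rw [h.m_inner hu]
  refine Finset.sum_pos (fun u _ => by positivity) ?_
  rw [← hu] at hne
  obtain ⟨x, hx⟩ := hne
  obtain ⟨u, hu, -⟩ := mem_iUnion₂.1 hx
  exact ⟨u, hu⟩

lemma exists_types (C : ℝ) : ∃ Φ : Finset ℝ, (∀ φ ∈ Φ, 0 < φ) ∧ ∀ k B, KSet S.attractor r k B →
    B.Nonempty → (∀ x ∈ B, ∀ y ∈ B, dist x y ≤ C * r ^ k) → ∃ φ ∈ Φ, S.natMeasure B = p ^ k * φ := by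
  classical
  have r0 := h.r0
  have p0 := h.p0
  obtain ⟨b, hb⟩ := h.exists_pieces
  obtain ⟨Λ, hΛ⟩ := Geo.exists_le lam
  obtain ⟨M, hM⟩ := h.exists_card_near_le (C * (r ^ b)⁻¹)
  obtain ⟨Z, hZ⟩ := exists_finset_sums ((Finset.range (b + Λ + 1)).image fun j => p ^ j) M
  refine ⟨Z.filter fun φ => 0 < φ, fun φ hφ => (Finset.mem_filter.1 hφ).2,
    fun k B hB hne hd => ?_⟩
  have hu := ((hb k _ le_rfl).2 B hB).2
  have hpos := h.m_pos hB hne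
  have hm := h.m_inner hu
  obtain ⟨U, hU⟩ : ∃ U, U = S.inner lam (k + b) B := ⟨_, rfl⟩
  rw [← hU] at hm
  have hwt : ∀ u ∈ U, k + b ≤ wt lam u ∧ wt lam u ≤ k + b + Λ := fun u huU =>
    ⟨le_wt_of_mem_cut h.hl (inner_subset _ B (hU ▸ huU)),
      wt_le_of_mem_cut hΛ (inner_subset _ B (hU ▸ huU))⟩
  have hm2 : S.natMeasure B = p ^ k * ∑ u ∈ U, p ^ (wt lam u - k) := by
    rw [hm, Finset.mul_sum]
    refine Finset.sum_congr rfl fun u hu => ?_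
    rw [← pow_add]
    congr 1
    have := (hwt u hu).1
    omega
  have hsumpos : 0 < ∑ u ∈ U, p ^ (wt lam u - k) := by
    rw [hm2] at hpos
    exact pos_of_mul_pos_right hpos (by positivity)
  refine ⟨_, Finset.mem_filter.2 ⟨hZ _ U (fun u => p ^ (wt lam u - k)) ?_ fun u hu => ?_,
    hsumpos⟩, hm2⟩
  · obtain ⟨x, hx⟩ := hne
    obtain ⟨a, ha⟩ := h.nonempty
    refine le_trans (Finset.card_le_card fun u hu => ?_) (hM (k + b) x)
    rw [hU] at hu
    refine Finset.mem_filter.2 ⟨inner_subset _ B hu, a, ha, ?_⟩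
    refine (hd _ ((mem_inner.1 hu).2 ⟨a, ha, rfl⟩) x hx).trans (le_of_eq ?_)
    rw [pow_add]
    field_simp
  · have := hwt u hu
    exact Finset.mem_image.2 ⟨_, Finset.mem_range.2 (by omega), rfl⟩

open Relation in
lemma exists_blocks : ∃ C > 0, ∀ k P, KSet S.attractor r k P →
    ∃ 𝓑 : Finset (Set (EuclideanSpace ℝ (Fin d))),
      (∀ B ∈ 𝓑, KSet S.attractor r k B ∧ B.Nonempty ∧ ∀ x ∈ B, ∀ y ∈ B, dist x y ≤ C * r ^ k) ∧
      (𝓑 : Set (Set (EuclideanSpace ℝ (Fin d)))).PairwiseDisjoint id ∧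
      ⋃₀ (𝓑 : Set (Set (EuclideanSpace ℝ (Fin d)))) = P := by
  classical
  have r0 := h.r0
  have r1 := h.r1
  obtain ⟨δ, hδ, hch⟩ := h.exists_chain_le h.td
  obtain ⟨e, he⟩ := exists_pow_lt_of_lt_one hδ h.r1
  obtain ⟨D, hD⟩ := isBounded_iff.1 h.isCompact.isBounded
  obtain ⟨a, ha⟩ := h.nonempty
  have hD0 : 0 ≤ D := dist_nonneg.trans (hD ha ha)
  obtain ⟨b, hb⟩ := h.exists_pieces
  obtain ⟨C, hC, hC1, hC2⟩ : ∃ C, 0 < C ∧ 2 * (r ^ e)⁻¹ ≤ C ∧ D * (r ^ e)⁻¹ ≤ C :=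
    ⟨2 * (r ^ e)⁻¹ + D * (r ^ e)⁻¹, by positivity,
      le_add_of_nonneg_right (by positivity), le_add_of_nonneg_left (by positivity)⟩
  refine ⟨C, hC, fun k P hP => ?_⟩
  set comp : EuclideanSpace ℝ (Fin d) → Set (EuclideanSpace ℝ (Fin d)) := fun x =>
    {y | ReflTransGen (Step S.attractor (r ^ k)) x y} with hcomp
  have _ : Std.Symm (Step S.attractor (r ^ k)) := ⟨fun a b hab =>
    ⟨hab.2.1, hab.1, by rw [dist_comm]; exact hab.2.2⟩⟩
  have hsymm : ∀ x y, y ∈ comp x → x ∈ comp y := fun x y hxy =>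
    (ReflTransGen.stdSymm (r := Step S.attractor (r ^ k))).symm _ _ hxy
  have hk : ∀ x ∈ S.attractor, KSet S.attractor r k (comp x) := fun x hx =>
    ⟨fun y hy => Step.mem hy hx, fun y hy z hz hzc => by
      by_contra! hlt
      exact hzc (ReflTransGen.tail hy ⟨Step.mem hy hx, hz, hlt⟩)⟩
  refine ⟨(S.inner lam (k + b) P).image fun u => comp (S.g u a), ?_, ?_, ?_⟩
  · intro B hB
    obtain ⟨u, hu, rfl⟩ := Finset.mem_image.1 hB
    refine ⟨hk _ (h.g_mem u ha), ⟨_, ReflTransGen.refl⟩, fun x hx y hy => ?_⟩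
    by_cases hke : e ≤ k
    · obtain ⟨j, rfl⟩ := Nat.exists_eq_add_of_le hke
      have hle : r ^ (e + j) ≤ δ * r ^ j := by
        rw [pow_add]
        exact mul_le_mul_of_nonneg_right he.le (by positivity)
      have h1 := hch j _ x (Step.mono Subset.rfl hle hx)
      have h2 := hch j _ y (Step.mono Subset.rfl hle hy)
      calc dist x y ≤ 2 * r ^ j := by
            rw [dist_comm] at h1
            have := dist_triangle x (S.g u a) y
            linarith
        _ = 2 * (r ^ e)⁻¹ * r ^ (e + j) := by rw [pow_add]; field_simp
        _ ≤ _ := by gcongr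
    · refine (hD ((hk _ (h.g_mem u ha)).1 hx) ((hk _ (h.g_mem u ha)).1 hy)).trans ?_
      calc D = D * (r ^ e)⁻¹ * r ^ e := by field_simp
        _ ≤ C * r ^ k := by
          have := pow_le_pow_of_le_one r0.le r1.le (not_le.1 hke).le
          gcongr
  · intro A hA B hB hAB
    simp only [Finset.coe_image, mem_image, Finset.mem_coe] at hA hB
    obtain ⟨u, -, rfl⟩ := hA
    obtain ⟨v, -, rfl⟩ := hB
    rw [Function.onFun, id, id, disjoint_left]
    intro x hxu hxv
    refine hAB ?_
    ext y
    exact ⟨fun hy => (hxv.trans (hsymm _ _ hxu)).trans hy,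
      fun hy => (hxu.trans (hsymm _ _ hxv)).trans hy⟩
  · obtain ⟨hdist, hpc⟩ := hb k _ le_rfl
    obtain ⟨-, hU⟩ := hpc P hP
    apply Subset.antisymm
    · refine sUnion_subset fun B hB => ?_
      simp only [Finset.coe_image, mem_image, Finset.mem_coe] at hB
      obtain ⟨u, hu, rfl⟩ := hB
      exact fun y hy => hP.chain ((mem_inner.1 hu).2 ⟨a, ha, rfl⟩) hy
    · intro x hx
      rw [← hU] at hx
      obtain ⟨u, hu, y, hy, rfl⟩ := mem_iUnion₂.1 hx
      refine ⟨comp (S.g u a), by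
        simp only [Finset.coe_image, mem_image, Finset.mem_coe]
        exact ⟨u, hu, rfl⟩, ReflTransGen.single ⟨h.g_mem u ha, h.g_mem u hy, ?_⟩⟩
      exact hdist u (le_wt_of_mem_cut h.hl (mem_inner.1 hu).1) a ha y hy

end Nice

end IFS

namespace IFS

variable {d : ℕ} {S : IFS d} {lam : S.ι → ℕ} {p r : ℝ}

namespace Geo

open scoped Classical in
/-- The words of the same level whose pieces are close to the piece of `u`. -/
def near (S : IFS d) (lam : S.ι → ℕ) (r ε : ℝ) (u : List S.ι) : Finset (List S.ι) :=
  (cut lam (wt lam u)).filter fun v =>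
    ∃ x ∈ S.attractor, ∃ y ∈ S.attractor, dist (S.g v x) (S.g u y) < ε * r ^ wt lam u

lemma mem_near {ε : ℝ} {u v : List S.ι} : v ∈ near S lam r ε u ↔ v ∈ cut lam (wt lam u) ∧
    ∃ x ∈ S.attractor, ∃ y ∈ S.attractor, dist (S.g v x) (S.g u y) < ε * r ^ wt lam u := by
  classical
  simp [near]

variable (h : S.Geo lam r)
include h

lemma exists_maximal_near (ε : ℝ) :
    ∃ u, ∀ v, (near S lam r ε v).card ≤ (near S lam r ε u).card := by
  classical
  obtain ⟨D, hD⟩ := isBounded_iff.1 h.isCompact.isBounded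
  obtain ⟨a, ha⟩ := h.nonempty
  obtain ⟨M, hM⟩ := h.exists_card_near_le (ε + D)
  have hb : ∀ u, (near S lam r ε u).card ≤ M := by
    intro u
    refine le_trans (Finset.card_le_card ?_) (hM (wt lam u) (S.g u a))
    intro v hv
    obtain ⟨hv, x, hx, y, hy, hxy⟩ := mem_near.1 hv
    refine Finset.mem_filter.2 ⟨hv, x, hx, ?_⟩
    have h1 := dist_triangle (S.g v x) (S.g u y) (S.g u a)
    rw [h.dist_g u] at h1
    have h2 := mul_le_mul_of_nonneg_left (hD hy ha) (pow_pos h.r0 (wt lam u)).le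
    nlinarith
  have hbdd : BddAbove (range fun u => (near S lam r ε u).card) :=
    ⟨M, by rintro _ ⟨u, rfl⟩; exact hb u⟩
  obtain ⟨u, hu⟩ := Nat.sSup_mem (range_nonempty _) hbdd
  exact ⟨u, fun v => by rw [show (near S lam r ε u).card = _ from hu]
                        exact le_csSup hbdd ⟨v, rfl⟩⟩

/-- Schief's construction of an open set meeting the attractor. -/
lemma exists_oscSet {ε : ℝ} (hε : 0 < ε) : ∃ O u, S.OSCSet O ∧ S.g u '' S.attractor ⊆ O := by
  classical
  obtain ⟨u, hu⟩ := h.exists_maximal_near ε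
  have r0 := h.r0
  have hN : ∀ w, near S lam r ε (w ++ u) = (near S lam r ε u).image (w ++ ·) := by
    intro w
    symm
    apply Finset.eq_of_subset_of_card_le
    · intro v hv
      obtain ⟨v, hvn, rfl⟩ := Finset.mem_image.1 hv
      obtain ⟨hvc, x, hx, y, hy, hxy⟩ := mem_near.1 hvn
      refine mem_near.2 ⟨?_, x, hx, y, hy, ?_⟩
      · rw [wt_append]
        exact append_mem_cut h.hl w hvc
      · rw [g_append, g_append, h.dist_g, wt_append, pow_add]
        have := mul_lt_mul_of_pos_left hxy (pow_pos r0 (wt lam w))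
        linarith
    · rw [Finset.card_image_of_injective _ (List.append_right_injective w)]
      exact hu _
  have hth : IsOpen (thickening (ε / 2) S.attractor) := isOpen_thickening
  have hsub : ∀ w, S.g w '' thickening (ε / 2) S.attractor ⊆ thickening (ε / 2) S.attractor := by
    rintro w _ ⟨x, hx, rfl⟩
    obtain ⟨a, ha, hxa⟩ := mem_thickening_iff.1 hx
    refine mem_thickening_iff.2 ⟨S.g w a, h.g_mem w ha, ?_⟩
    rw [h.dist_g]
    exact (mul_le_of_le_one_left dist_nonneg (pow_le_one₀ r0.le h.r1.le)).trans_lt hxa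
  have key : ∀ i j w w', i ≠ j → wt lam (i :: (w ++ u)) ≤ wt lam (j :: (w' ++ u)) →
      Disjoint (S.g (i :: (w ++ u)) '' thickening (ε / 2) S.attractor)
        (S.g (j :: (w' ++ u)) '' thickening (ε / 2) S.attractor) := by
    intro i j w w' hij hle
    rw [disjoint_left]
    rintro _ ⟨x, hx, rfl⟩ ⟨x', hx', hxx⟩
    obtain ⟨a, ha, hxa⟩ := mem_thickening_iff.1 hx
    obtain ⟨a', ha', hxa'⟩ := mem_thickening_iff.1 hx'
    obtain ⟨v, hv, hvp⟩ := exists_prefix_mem_cut hle (mem_cut_wt h.hl (j :: (w' ++ u)))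
    obtain ⟨t, ht⟩ := hvp
    have hmem : v ∈ near S lam r ε ((i :: w) ++ u) := by
      refine mem_near.2 ⟨hv, S.g t a', h.g_mem t ha', a, ha, ?_⟩
      rw [← g_append, ht]
      have h1 := dist_triangle (S.g (j :: (w' ++ u)) a') (S.g (i :: (w ++ u)) x)
        (S.g (i :: (w ++ u)) a)
      rw [h.dist_g, ← hxx, h.dist_g, dist_comm a' x'] at h1
      have h2 : r ^ wt lam (j :: (w' ++ u)) * dist x' a' ≤ r ^ wt lam (i :: (w ++ u)) * dist x' a' :=
        mul_le_mul_of_nonneg_right (pow_le_pow_of_le_one r0.le h.r1.le hle) dist_nonneg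
      have h3 := pow_pos r0 (wt lam (i :: (w ++ u)))
      rw [List.cons_append]
      nlinarith
    rw [hN] at hmem
    obtain ⟨n, -, rfl⟩ := Finset.mem_image.1 hmem
    simp only [List.cons_append, List.cons.injEq] at ht
    exact hij ht.1
  refine ⟨⋃ w, S.g (w ++ u) '' thickening (ε / 2) S.attractor, u, ⟨?_, ?_, ?_, ?_, ?_⟩, ?_⟩
  · obtain ⟨a, ha⟩ := h.nonempty
    exact ⟨S.g u a, mem_iUnion.2 ⟨[], a, self_subset_thickening (by positivity) _ ha, rfl⟩⟩
  · exact isOpen_iUnion fun w => h.isOpen_g_image _ hth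
  · exact (h.isCompact.isBounded.thickening).subset (iUnion_subset fun w => hsub _)
  · intro i
    rw [image_iUnion]
    refine iUnion_subset fun w => ?_
    rw [← g_singleton, ← g_append_image, ← List.append_assoc]
    exact subset_iUnion (fun w => S.g (w ++ u) '' thickening (ε / 2) S.attractor) ([i] ++ w)
  · intro i j hij
    simp_rw [image_iUnion, ← g_singleton, ← g_append_image, disjoint_iUnion_left,
      disjoint_iUnion_right]
    intro w w'
    rcases le_total (wt lam (i :: (w ++ u))) (wt lam (j :: (w' ++ u))) with hle | hle
    · exact key i j w w' hij hle
    · exact (key j i w' w hij.symm hle).symm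
  · exact (image_mono (self_subset_thickening (by positivity) _)).trans
      (subset_iUnion (fun w => S.g (w ++ u) '' thickening (ε / 2) S.attractor) [])

lemma isIntSep_of_subset {F G : Set (EuclideanSpace ℝ (Fin d))} {k : ℕ} (hF : S.IsIntSep F)
    (hGF : G ⊆ F) (hG : KSet S.attractor r k G) : S.IsIntSep G := by
  obtain ⟨-, -, -, O, hO, hFO⟩ := hF
  exact ⟨hG.isCompact h.r0 h.isCompact, hG.1, hG.compl.isCompact h.r0 h.isCompact, O, hO,
    hGF.trans hFO⟩

lemma exists_kset_of_isIntSep {F : Set (EuclideanSpace ℝ (Fin d))} (hF : S.IsIntSep F) :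
    ∃ l, ∀ u, KSet S.attractor r (wt lam u + l) (S.g u '' F) := by
  obtain ⟨hc, hFE, hc', O, hO, hFO⟩ := hF
  have r0 := h.r0
  obtain ⟨k, hk⟩ := exists_kset h.r1 hFE hc hc'
  obtain ⟨δ, hδ, hsub⟩ := hc.exists_thickening_subset_open hO.2.1 hFO
  obtain ⟨b, hb⟩ := exists_pow_lt_of_lt_one hδ h.r1
  refine ⟨max k b, fun u => ⟨(image_mono hFE).trans (h.g_subset u), ?_⟩⟩
  rintro _ ⟨x, hx, rfl⟩ y hy hyF
  have hu := pow_pos r0 (wt lam u)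
  have h1 : r ^ max k b ≤ r ^ k := pow_le_pow_of_le_one r0.le h.r1.le (le_max_left _ _)
  have h2 : r ^ max k b ≤ r ^ b := pow_le_pow_of_le_one r0.le h.r1.le (le_max_right _ _)
  rw [pow_add]
  obtain ⟨v, hv, y, hyE, rfl⟩ := h.exists_mem_cut (wt lam u) hy
  by_cases hvu : v = u
  · subst hvu
    rw [h.dist_g]
    exact mul_le_mul_of_nonneg_left (h1.trans (hk.2 x hx y hyE fun hyF' => hyF ⟨y, hyF', rfl⟩)) hu.le
  · by_contra! hlt
    have hlt' : dist (S.g v y) (S.g u x) < r ^ wt lam u * δ := by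
      rw [dist_comm]; nlinarith
    have hball : ball (S.g u x) (r ^ wt lam u * δ) ⊆ S.g u '' O := by
      rw [← h.g_image_ball]
      exact image_mono ((ball_subset_thickening hx δ).trans hsub)
    have hycl : S.g v y ∈ closure (S.g v '' O) :=
      image_closure_subset_closure_image (h.continuous_g v) ⟨y, h.subset_closure hO hyE, rfl⟩
    obtain ⟨z, hz, hzv⟩ := mem_closure_iff.1 hycl _ (h.isOpen_g_image u hO.2.1) (hball hlt')
    exact (h.disjoint_of_mem_cut hO hv (mem_cut_wt h.hl u) hvu).le_bot ⟨hzv, hz⟩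

lemma isIntSep_image {F : Set (EuclideanSpace ℝ (Fin d))} (hF : S.IsIntSep F) (u : List S.ι) :
    S.IsIntSep (S.g u '' F) := by
  obtain ⟨l, hl⟩ := h.exists_kset_of_isIntSep hF
  obtain ⟨-, -, -, O, hO, hFO⟩ := hF
  exact ⟨(hl u).isCompact h.r0 h.isCompact, (hl u).1, (hl u).compl.isCompact h.r0 h.isCompact, O, hO,
    (image_mono hFO).trans (S.g_image_subset hO.2.2.2.1 u)⟩

end Geo

namespace Nice

variable (h : S.Nice lam p r)
include h

lemma exists_isIntSep : ∃ F, S.IsIntSep F ∧ F.Nonempty := by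
  obtain ⟨O, u, hO, hu⟩ := h.exists_oscSet one_pos
  obtain ⟨a, ha⟩ := h.nonempty
  obtain ⟨ε, hε, hb⟩ := Metric.isOpen_iff.1 hO.2.1 _ (hu ⟨a, ha, rfl⟩)
  obtain ⟨C, hC, hbl⟩ := h.exists_blocks
  obtain ⟨k, hk⟩ := exists_pow_lt_of_lt_one (x := ε / C) (by positivity) h.r1
  obtain ⟨𝓑, hB, -, hU⟩ := hbl k _ KSet.self
  obtain ⟨B, hBm, haB⟩ := mem_sUnion.1 (hU.symm ▸ h.g_mem u ha)
  obtain ⟨hBk, hBn, hBd⟩ := hB B hBm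
  refine ⟨B, ⟨hBk.isCompact h.r0 h.isCompact, hBk.1, hBk.compl.isCompact h.r0 h.isCompact, O, hO,
    fun x hx => hb ?_⟩, hBn⟩
  rw [lt_div_iff₀ hC] at hk
  exact (hBd x hx _ haB).trans_lt (by linarith)

lemma m_mem_idealSet {F : Set (EuclideanSpace ℝ (Fin d))} (hF : S.IsIntSep F) :
    S.natMeasure F ∈ idealSet (S.idealOf p) := by
  obtain ⟨k, hk⟩ := exists_kset h.r1 hF.2.1 hF.1 hF.2.2.1
  exact ⟨⟨_, h.m_mem_Zring hk⟩, Ideal.subset_span ⟨F, hF, rfl⟩, rfl⟩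

lemma idealOf_ne_bot : S.idealOf p ≠ ⊥ := by
  obtain ⟨F, hF, hn⟩ := h.exists_isIntSep
  obtain ⟨k, hk⟩ := exists_kset h.r1 hF.2.1 hF.1 hF.2.2.1
  obtain ⟨x, hx, hxe⟩ := h.m_mem_idealSet hF
  intro hbot
  rw [hbot] at hx
  have : x = 0 := hx
  rw [this] at hxe
  exact (h.m_pos hk hn).ne hxe

end Nice

end IFS

/-- The additive group of reals underlying an ideal of a subring of `ℝ`. -/
def idealGrp {R : Subring ℝ} (I : Ideal R) : AddSubgroup ℝ where
  carrier := idealSet I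
  zero_mem' := ⟨0, I.zero_mem, rfl⟩
  add_mem' := by
    rintro _ _ ⟨a, ha, rfl⟩ ⟨b, hb, rfl⟩
    exact ⟨a + b, I.add_mem ha hb, rfl⟩
  neg_mem' := by
    rintro _ ⟨a, ha, rfl⟩
    exact ⟨-a, I.neg_mem ha, rfl⟩

lemma mem_idealGrp {R : Subring ℝ} {I : Ideal R} {x : ℝ} : x ∈ idealGrp I ↔ x ∈ idealSet I := Iff.rfl

lemma mul_mem_idealSet {R : Subring ℝ} {I : Ideal R} {x y : ℝ} (hx : x ∈ R) (hy : y ∈ idealSet I) :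
    x * y ∈ idealSet I := by
  obtain ⟨b, hb, rfl⟩ := hy
  exact ⟨⟨x, hx⟩ * b, I.mul_mem_left _ hb, rfl⟩

lemma exists_shift_mem {p : ℝ} (hp0 : 0 < p) (hp1 : p < 1) (q : ℝ) {f η : ℝ} (hf : 0 < f)
    (hη : 0 < η) : ∃ t ∈ Zring p, 0 < q + t * f ∧ q + t * f < η := by
  obtain ⟨n, hn⟩ := exists_pow_lt_of_lt_one (x := η / f) (by positivity) hp1
  rw [lt_div_iff₀ hf] at hn
  obtain ⟨z, ⟨hz1, hz2⟩, -⟩ := existsUnique_add_zsmul_mem_Ioc (a := p ^ n * f) (by positivity) q 0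
  refine ⟨z * p ^ n, mul_mem (intCast_mem _ z) (pow_mem (Zring.self_mem p) n), ?_, ?_⟩
  · rw [zsmul_eq_mul] at hz1; linarith
  · rw [zsmul_eq_mul] at hz2; linarith

lemma exists_pos_coeffs {p : ℝ} (hp0 : 0 < p) (hp1 : p < 1) {n : ℕ} {f0 z : ℝ} (q f : Fin n → ℝ)
    (hf0 : 0 < f0) (hf0Z : f0 ∈ Zring p) (hf : ∀ i, 0 ≤ f i) (hfZ : ∀ i, f i ∈ Zring p)
    (hq : ∀ i, q i ∈ Zring p) (hqz : ∑ i, q i * f i = z) (hz0 : 0 < z) (hz1 : z < f0) :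
    ∃ Q : Option (Fin n) → ℝ, (∀ c, Q c ∈ Zring p) ∧ (∀ c, 0 < Q c) ∧ ∑ c, Q c < 1 ∧
      Q none * f0 + ∑ i, Q (some i) * f i = z := by
  have hS0 : 0 ≤ ∑ i, f i := Finset.sum_nonneg fun i _ => hf i
  obtain ⟨η, hη, hη1, hη2⟩ : ∃ η : ℝ, 0 < η ∧ η * ∑ i, f i < z ∧ η * n < 1 - z / f0 := by
    have hpos : 0 < 1 - z / f0 := sub_pos.2 ((div_lt_one hf0).2 hz1)
    refine ⟨min (z / (∑ i, f i + 1)) ((1 - z / f0) / (n + 1)),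
      lt_min (by positivity) (by positivity), ?_, ?_⟩
    · refine (mul_le_mul_of_nonneg_right (min_le_left _ _) hS0).trans_lt ?_
      rw [div_mul_eq_mul_div, div_lt_iff₀ (by positivity)]
      linarith
    · refine (mul_le_mul_of_nonneg_right (min_le_right _ _) (Nat.cast_nonneg n)).trans_lt ?_
      rw [div_mul_eq_mul_div, div_lt_iff₀ (by positivity)]
      linarith
  choose t ht ht0 ht1 using fun i => exists_shift_mem hp0 hp1 (q i) hf0 hη
  have hsum : (-∑ i, t i * f i) * f0 + ∑ i, (q i + t i * f0) * f i = z := by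
    rw [← hqz, neg_mul, Finset.sum_mul, ← Finset.sum_neg_distrib, ← Finset.sum_add_distrib]
    exact Finset.sum_congr rfl fun i _ => by ring
  have hle : ∑ i, (q i + t i * f0) * f i ≤ η * ∑ i, f i := by
    rw [Finset.mul_sum]
    exact Finset.sum_le_sum fun i _ => mul_le_mul_of_nonneg_right (ht1 i).le (hf i)
  have hnn : 0 ≤ ∑ i, (q i + t i * f0) * f i :=
    Finset.sum_nonneg fun i _ => mul_nonneg (ht0 i).le (hf i)
  refine ⟨fun c => c.elim (-∑ i, t i * f i) fun i => q i + t i * f0, ?_, ?_, ?_, hsum⟩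
  · rintro (_ | i)
    · exact neg_mem (sum_mem fun i _ => mul_mem (ht i) (hfZ i))
    · exact add_mem (hq i) (mul_mem (ht i) hf0Z)
  · rintro (_ | i)
    · refine pos_of_mul_pos_left (b := f0) ?_ hf0.le
      simp only [Option.elim]
      linarith
    · exact ht0 i
  · rw [Fintype.sum_option]
    simp only [Option.elim]
    have h1 : -∑ i, t i * f i ≤ z / f0 := by
      rw [le_div_iff₀ hf0]; linarith
    have h2 : ∑ i, (q i + t i * f0) ≤ n * η := by
      have := Finset.sum_le_card_nsmul Finset.univ (fun i => q i + t i * f0) η fun i _ => (ht1 i).le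
      simpa using this
    linarith

namespace IFS

variable {d : ℕ} {S : IFS d} {lam : S.ι → ℕ} {p r : ℝ}

/-- All similar copies of `G` are uniformly separated, with measures in `J`. -/
def Ok (S : IFS d) (lam : S.ι → ℕ) (r : ℝ) (J : AddSubgroup ℝ) (G : Set (EuclideanSpace ℝ (Fin d))) :
    Prop :=
  ∃ l, ∀ u, GK S.attractor S.natMeasure r J (wt lam u + l) (S.g u '' G)

namespace Nice

variable (h : S.Nice lam p r)
include h

lemma inv_mem : p⁻¹ ∈ Zring p := by
  have p0 := h.p0
  have h1 : p⁻¹ = ∑ i, p ^ (lam i - 1) := by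
    rw [inv_eq_iff_eq_inv, ← one_div, eq_div_iff (by
      intro h0
      have := h.sum
      have h2 : ∑ i, p ^ lam i = p * ∑ i, p ^ (lam i - 1) := by
        rw [Finset.mul_sum]
        exact Finset.sum_congr rfl fun i _ => by
          rw [← pow_succ', Nat.sub_add_cancel (h.hl i)]
      rw [h2, h0, mul_zero] at this
      exact zero_ne_one this), ← h.sum, Finset.mul_sum]
    exact Finset.sum_congr rfl fun i _ => by rw [← pow_succ', Nat.sub_add_cancel (h.hl i)]
  rw [h1]
  exact sum_mem fun i _ => pow_mem (Zring.self_mem p) _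

lemma m_union_kset {k l : ℕ} {P Q : Set (EuclideanSpace ℝ (Fin d))} (hP : KSet S.attractor r k P)
    (hQ : KSet S.attractor r l Q) (hd : Disjoint P Q) :
    S.natMeasure (P ∪ Q) = S.natMeasure P + S.natMeasure Q :=
  h.m_union hP.1 hQ.1 hd (h.measurableSet hQ)

lemma m_diff_kset {k l : ℕ} {P Q : Set (EuclideanSpace ℝ (Fin d))} (hP : KSet S.attractor r k P)
    (hQ : KSet S.attractor r l Q) (hQP : Q ⊆ P) :
    S.natMeasure (P \ Q) = S.natMeasure P - S.natMeasure Q := by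
  have h1 := h.m_union_kset (((hP.mono h.r0 h.r1 (le_max_left k l)).diff
    (hQ.mono h.r0 h.r1 (le_max_right k l)))) hQ disjoint_sdiff_left
  rw [sdiff_union_of_subset hQP] at h1
  linarith

variable {J : AddSubgroup ℝ}

lemma gk_union {k : ℕ} {P Q : Set (EuclideanSpace ℝ (Fin d))}
    (hP : GK S.attractor S.natMeasure r J k P) (hQ : GK S.attractor S.natMeasure r J k Q) :
    GK S.attractor S.natMeasure r J k (P ∪ Q) := by
  refine ⟨hP.1.union hQ.1, fun l A hA hAk => ?_⟩
  have h1 := hAk.mono h.r0 h.r1 (le_max_right k l)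
  have h2 := hP.1.mono h.r0 h.r1 (le_max_left k l)
  rw [← inter_union_sdiff A P, h.m_union_kset (h1.inter h2) (h1.diff h2)
    (disjoint_sdiff_right.mono_left inter_subset_right)]
  refine J.add_mem (hP.2 _ _ inter_subset_right (h1.inter h2)) (hQ.2 _ _ ?_ (h1.diff h2))
  rintro x ⟨hx, hxP⟩
  exact (hA hx).resolve_left hxP

omit h in
lemma gk_empty (k : ℕ) : GK S.attractor S.natMeasure r J k ∅ :=
  ⟨KSet.empty, fun l A hA _ => by rw [subset_empty_iff.1 hA, natMeasure_empty]; exact J.zero_mem⟩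

lemma gk_biUnion {κ : Type*} {k : ℕ} (s : Finset κ) (A : κ → Set (EuclideanSpace ℝ (Fin d)))
    (hA : ∀ i ∈ s, GK S.attractor S.natMeasure r J k (A i)) :
    GK S.attractor S.natMeasure r J k (⋃ i ∈ s, A i) := by
  classical
  induction s using Finset.induction_on with
  | empty => simpa using gk_empty k
  | insert a s ha ih =>
    rw [Finset.set_biUnion_insert]
    exact h.gk_union (hA a (s.mem_insert_self a)) (ih fun i hi => hA i (Finset.mem_insert_of_mem hi))

omit h in
lemma ok_kset {G : Set (EuclideanSpace ℝ (Fin d))} (hG : S.Ok lam r J G) :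
    ∃ k, KSet S.attractor r k G := by
  obtain ⟨l, hl⟩ := hG
  have := (hl []).1
  exact ⟨l, by simpa using this⟩

lemma ok_biUnion {κ : Type*} (s : Finset κ) (A : κ → Set (EuclideanSpace ℝ (Fin d)))
    (hA : ∀ i ∈ s, S.Ok lam r J (A i)) : S.Ok lam r J (⋃ i ∈ s, A i) := by
  classical
  choose! l hl using hA
  refine ⟨s.sup l, fun u => ?_⟩
  simp_rw [image_iUnion]
  exact h.gk_biUnion s _ fun i hi => (hl i hi u).mono h.r0 h.r1
    (Nat.add_le_add_left (Finset.le_sup hi) _)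

lemma ok_union {A B : Set (EuclideanSpace ℝ (Fin d))} (hA : S.Ok lam r J A) (hB : S.Ok lam r J B) :
    S.Ok lam r J (A ∪ B) := by
  obtain ⟨l, hl⟩ := hA
  obtain ⟨l', hl'⟩ := hB
  refine ⟨max l l', fun u => ?_⟩
  rw [image_union]
  exact h.gk_union ((hl u).mono h.r0 h.r1 (Nat.add_le_add_left (le_max_left _ _) _))
    ((hl' u).mono h.r0 h.r1 (Nat.add_le_add_left (le_max_right _ _) _))

omit h in
lemma ok_image {A : Set (EuclideanSpace ℝ (Fin d))} (hA : S.Ok lam r J A) (v : List S.ι) :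
    S.Ok lam r J (S.g v '' A) := by
  obtain ⟨l, hl⟩ := hA
  refine ⟨wt lam v + l, fun u => ?_⟩
  rw [← g_append_image, ← add_assoc, ← wt_append]
  exact hl _

lemma ok_of_isIntSep {F : Set (EuclideanSpace ℝ (Fin d))} (hF : S.IsIntSep F) :
    S.Ok lam r (idealGrp (S.idealOf p)) F := by
  obtain ⟨l, hl⟩ := h.exists_kset_of_isIntSep hF
  exact ⟨l, fun u => ⟨hl u, fun k P hP hk =>
    h.m_mem_idealSet (h.isIntSep_of_subset (h.isIntSep_image hF u) hP hk)⟩⟩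

lemma exists_ok_large (n : ℕ) {F : Set (EuclideanSpace ℝ (Fin d))} (hF : S.IsIntSep F) :
    ∃ G ⊆ S.attractor, S.Ok lam r (idealGrp (S.idealOf p)) G ∧
      1 - S.natMeasure G = (1 - S.natMeasure F) ^ n := by
  obtain ⟨k, hk⟩ := exists_kset h.r1 hF.2.1 hF.1 hF.2.2.1
  obtain ⟨b, hb⟩ := h.exists_pieces
  have hU := ((hb k _ le_rfl).2 _ hk.compl).2
  obtain ⟨U, hUe⟩ : ∃ U, U = S.inner lam (k + b) (S.attractor \ F) := ⟨_, rfl⟩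
  have hUc : U ⊆ cut lam (k + b) := hUe ▸ inner_subset _ _
  have hmU : ∑ u ∈ U, p ^ wt lam u = 1 - S.natMeasure F := by
    rw [hUe, ← h.m_inner hU, h.m_diff_kset (KSet.self (k := 0)) hk hk.1, h.m_attractor]
  rw [← hUe] at hU
  induction n with
  | zero =>
    refine ⟨∅, empty_subset _, ⟨0, fun u => ?_⟩, by simp [natMeasure_empty]⟩
    rw [image_empty]
    exact gk_empty _
  | succ n ih =>
    obtain ⟨G, hGE, hG, hGm⟩ := ih
    have hok := h.ok_biUnion U (fun u => S.g u '' G) fun u _ => ok_image hG u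
    obtain ⟨l, hl⟩ := ok_kset hok
    have hsub : ⋃ u ∈ U, S.g u '' G ⊆ S.attractor \ F := by
      rw [← hU]
      exact iUnion₂_mono fun u _ => image_mono hGE
    refine ⟨F ∪ ⋃ u ∈ U, S.g u '' G, union_subset hF.2.1 (hsub.trans sdiff_subset),
      h.ok_union (h.ok_of_isIntSep hF) hok, ?_⟩
    rw [h.m_union_kset hk hl (disjoint_sdiff_right.mono_right hsub),
      h.m_iUnion_image hUc (fun _ => G) (fun _ _ => hGE) fun u _ => ?_, ← Finset.sum_mul, hmU,
      pow_succ, ← hGm]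
    · ring
    · obtain ⟨l, hl⟩ := ok_kset (ok_image hG u)
      exact h.measurableSet hl

lemma exists_fraction {ε : ℝ} (hε : 0 < ε) : ∃ L : ℕ, ∀ k P, KSet S.attractor r k P →
    ∃ G ⊆ P, GK S.attractor S.natMeasure r (idealGrp (S.idealOf p)) (k + L) G ∧
      S.natMeasure P - S.natMeasure G ≤ ε * S.natMeasure P := by
  obtain ⟨F, hF, hFn⟩ := h.exists_isIntSep
  obtain ⟨k0, hk0⟩ := exists_kset h.r1 hF.2.1 hF.1 hF.2.2.1
  have hF0 := h.m_pos hk0 hFn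
  obtain ⟨n, hn⟩ := exists_pow_lt_of_lt_one (y := 1 - S.natMeasure F) hε (by linarith)
  obtain ⟨G, hGE, ⟨l, hl⟩, hGm⟩ := h.exists_ok_large n hF
  obtain ⟨b, hb⟩ := h.exists_pieces
  obtain ⟨Λ, hΛ⟩ := Geo.exists_le lam
  refine ⟨b + Λ + l, fun k P hP => ?_⟩
  have hU := ((hb k _ le_rfl).2 _ hP).2
  have hgk : ∀ u ∈ S.inner lam (k + b) P,
      GK S.attractor S.natMeasure r (idealGrp (S.idealOf p)) (k + (b + Λ + l)) (S.g u '' G) :=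
    fun u hu => (hl u).mono h.r0 h.r1 (by
      have := wt_le_of_mem_cut hΛ (inner_subset _ P hu)
      omega)
  refine ⟨⋃ u ∈ S.inner lam (k + b) P, S.g u '' G, ?_, h.gk_biUnion _ _ hgk, ?_⟩
  · exact iUnion₂_subset fun u hu => (image_mono hGE).trans (mem_inner.1 hu).2
  · rw [h.m_iUnion_image (inner_subset _ _) (fun _ => G) (fun _ _ => hGE)
      fun u hu => h.measurableSet (hgk u hu).1, ← Finset.sum_mul, ← h.m_inner hU]
    have := natMeasure_nonneg (S := S) P
    nlinarith

lemma exists_ok_measure {F : Set (EuclideanSpace ℝ (Fin d))} (hF : S.IsIntSep F) (hFn : F.Nonempty)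
    {z : ℝ} (hz : z ∈ idealSet (S.idealOf p)) (hz0 : 0 < z) (hz1 : z < S.natMeasure F) :
    ∃ G ⊆ S.attractor, S.Ok lam r (idealGrp (S.idealOf p)) G ∧ S.natMeasure G = z := by
  classical
  obtain ⟨k, hk⟩ := exists_kset h.r1 hF.2.1 hF.1 hF.2.2.1
  have hF0 := h.m_pos hk hFn
  obtain ⟨z', hzI, hzz⟩ := hz
  replace hzz : (z' : ℝ) = z := hzz
  obtain ⟨n, q, g, hqg⟩ := (Submodule.mem_span_set' (R := Zring p)).1 hzI
  choose A hA hAm using fun i => (g i).2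
  replace hqg : ∑ i, (q i : ℝ) * S.natMeasure (A i) = z := by
    rw [← hzz, ← hqg]
    push_cast
    exact Finset.sum_congr rfl fun i _ => by rw [← hAm]; rfl
  have hmZ : ∀ B, S.IsIntSep B → S.natMeasure B ∈ Zring p := fun B hB => by
    obtain ⟨k, hk⟩ := exists_kset h.r1 hB.2.1 hB.1 hB.2.2.1
    exact h.m_mem_Zring hk
  obtain ⟨Q, hQZ, hQ0, hQ1, hQz⟩ := exists_pos_coeffs h.p0 h.p1 (fun i => (q i : ℝ))
    (fun i => S.natMeasure (A i)) hF0 (hmZ F hF) (fun i => natMeasure_nonneg (A i))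
    (fun i => hmZ _ (hA i)) (fun i => (q i).2) hqg hz0 hz1
  obtain ⟨B, hB⟩ : ∃ B : Option (Fin n) → Set (EuclideanSpace ℝ (Fin d)),
    B = fun c => c.elim F A := ⟨_, rfl⟩
  have hBI : ∀ c, S.IsIntSep (B c) := by
    subst hB
    rintro (_ | i)
    · exact hF
    · exact hA i
  obtain ⟨N, hN⟩ := exists_words h.p0 h.p1 h.hl h.sum h.gcd Finset.univ Q (fun c _ => hQZ c)
    (fun c _ => hQ0 c) hQ1
  obtain ⟨U, hU, hUd, hUm⟩ := hN N le_rfl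
  obtain ⟨D, hD⟩ : ∃ D : List S.ι → Set (EuclideanSpace ℝ (Fin d)), ∀ c, ∀ u ∈ U c, D u = B c := by
    refine ⟨fun u => if hu : ∃ c, u ∈ U c then B hu.choose else ∅, fun c u hu => ?_⟩
    have hex : ∃ c, u ∈ U c := ⟨c, hu⟩
    simp only [dif_pos hex]
    by_contra hne
    have hcc : hex.choose ≠ c := fun he => hne (by rw [he])
    exact Finset.disjoint_left.1 (hUd (Finset.mem_coe.2 (Finset.mem_univ _))
      (Finset.mem_coe.2 (Finset.mem_univ _)) hcc) hex.choose_spec hu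
  have hmem : ∀ u ∈ Finset.univ.biUnion U, ∃ c, u ∈ U c := fun u hu => by simpa using hu
  have hDE : ∀ u ∈ Finset.univ.biUnion U, D u ⊆ S.attractor := fun u hu => by
    obtain ⟨c, hc⟩ := hmem u hu
    rw [hD c u hc]
    exact (hBI c).2.1
  have hDok : ∀ u ∈ Finset.univ.biUnion U,
      S.Ok lam r (idealGrp (S.idealOf p)) (S.g u '' D u) := fun u hu => by
    obtain ⟨c, hc⟩ := hmem u hu
    rw [hD c u hc]
    exact ok_image (h.ok_of_isIntSep (hBI c)) u
  refine ⟨⋃ u ∈ Finset.univ.biUnion U, S.g u '' D u, ?_, h.ok_biUnion _ _ hDok, ?_⟩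
  · exact iUnion₂_subset fun u hu => (image_mono (hDE u hu)).trans (h.g_subset u)
  · rw [h.m_iUnion_image (k := N) (Finset.biUnion_subset.2 hU) D hDE fun u hu => by
      obtain ⟨l, hl⟩ := ok_kset (hDok u hu)
      exact h.measurableSet hl]
    rw [Finset.sum_biUnion hUd]
    have : ∀ c ∈ Finset.univ, ∑ u ∈ U c, p ^ wt lam u * S.natMeasure (D u) =
        Q c * S.natMeasure (B c) := fun c hc => by
      rw [← hUm c hc, Finset.sum_mul]
      exact Finset.sum_congr rfl fun u hu => by rw [hD c u hu]
    rw [Finset.sum_congr rfl this, Fintype.sum_option, hB]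
    exact hQz

theorem exists_reg : ∃ C lo hi κ Φ,
    Reg S.attractor S.natMeasure p r (idealGrp (S.idealOf p)) C lo hi κ Φ := by
  classical
  have p0 := h.p0
  obtain ⟨C, hC, hbl⟩ := h.exists_blocks
  obtain ⟨Φ, hΦ, hty⟩ := h.exists_types C
  obtain ⟨lo, hi, hlo, hlohi, hΦlo, hΦhi⟩ : ∃ lo hi : ℝ, 0 < lo ∧ lo ≤ hi ∧ (∀ φ ∈ Φ, lo ≤ φ) ∧
      ∀ φ ∈ Φ, φ ≤ hi := by
    rcases Φ.eq_empty_or_nonempty with rfl | hne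
    · exact ⟨1, 1, one_pos, le_rfl, by simp, by simp⟩
    · exact ⟨Φ.min' hne, Φ.max' hne, hΦ _ (Φ.min'_mem hne), Φ.min'_le_max' hne,
        fun φ hφ => Φ.min'_le φ hφ, fun φ hφ => Φ.le_max' φ hφ⟩
  obtain ⟨F, hF, hFn⟩ := h.exists_isIntSep
  obtain ⟨k0, hk0⟩ := exists_kset h.r1 hF.2.1 hF.1 hF.2.2.1
  have hF0 := h.m_pos hk0 hFn
  obtain ⟨b, hb⟩ := h.exists_pieces
  obtain ⟨Λ, hΛ⟩ := Geo.exists_le lam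
  refine ⟨C, lo, hi, S.natMeasure F * p ^ (b + Λ), Φ,
    { p0 := h.p0, p1 := h.p1, r0 := h.r0, r1 := h.r1, C0 := hC, lo0 := hlo, lohi := hlohi,
      κ0 := by positivity, Φlo := hΦlo, Φhi := hΦhi
      Jp := fun z hz => mul_mem_idealSet (Zring.self_mem p) hz
      Jp' := fun z hz => mul_mem_idealSet h.inv_mem hz
      add := fun k P Q hP hQ hd => h.m_union_kset hP hQ hd
      blocks := fun k P hP => ?_
      realize := fun z hz hz0 hz1 => ?_
      fraction := fun ε hε => h.exists_fraction hε }⟩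
  · obtain ⟨𝓑, hB, hd, hU⟩ := hbl k P hP
    exact ⟨𝓑, fun B hBm => ⟨(hB B hBm).1, (hB B hBm).2.1, (hB B hBm).2.2,
      hty k B (hB B hBm).1 (hB B hBm).2.1 (hB B hBm).2.2⟩, hd, hU⟩
  · have hG : ∀ j : ℕ, j ≤ b + Λ → ∃ G l, G ⊆ S.attractor ∧ (∀ u, GK S.attractor S.natMeasure r
        (idealGrp (S.idealOf p)) (wt lam u + l) (S.g u '' G)) ∧ p ^ j * S.natMeasure G = z := by
      intro j hj
      have hzj : (p⁻¹) ^ j * z ∈ idealSet (S.idealOf p) :=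
        mul_mem_idealSet (pow_mem h.inv_mem j) hz
      have hpj : p ^ j * ((p⁻¹) ^ j * z) = z := by
        rw [← mul_assoc, ← mul_pow, mul_inv_cancel₀ p0.ne', one_pow, one_mul]
      obtain ⟨G, hGE, ⟨l, hl⟩, hGm⟩ := h.exists_ok_measure hF hFn hzj (by positivity) (by
        rw [inv_pow, inv_mul_lt_iff₀ (by positivity), mul_comm]
        refine hz1.trans_le ?_
        exact mul_le_mul_of_nonneg_left (pow_le_pow_of_le_one p0.le h.p1.le hj) hF0.le)
      exact ⟨G, l, hGE, hl, by rw [hGm, hpj]⟩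
    choose! G l hGE hl hGm using hG
    refine ⟨b + Λ + (Finset.range (b + Λ + 1)).sup l, fun k P hP hPn => ?_⟩
    have hU := ((hb k _ le_rfl).2 _ hP).2
    rw [← hU] at hPn
    obtain ⟨x, hx⟩ := hPn
    obtain ⟨u, hu, -⟩ := mem_iUnion₂.1 hx
    obtain ⟨huc, hus⟩ := mem_inner.1 hu
    have h1 := wt_le_of_mem_cut hΛ huc
    have h2 := le_wt_of_mem_cut h.hl huc
    have hj : wt lam u - k ≤ b + Λ := by omega
    refine ⟨S.g u '' G (wt lam u - k), (image_mono (hGE _ hj)).trans hus,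
      (hl _ hj u).mono h.r0 h.r1 ?_, ?_⟩
    · have := Finset.le_sup (f := l) (Finset.mem_range.2 (show wt lam u - k < b + Λ + 1 by omega))
      omega
    · rw [h.m_image, ← hGm _ hj, ← mul_assoc, ← pow_add]
      congr 2
      omega

end Nice

end IFS

lemma Reg.scale {α : Type*} [MetricSpace α] {E : Set α} {m : Set α → ℝ} {p r : ℝ}
    {J J' : AddSubgroup ℝ} {C lo hi κ c : ℝ} {Φ : Finset ℝ} (h : Reg E m p r J C lo hi κ Φ)
    (hc : 0 < c) (hJ : ∀ x, c * x ∈ J' ↔ x ∈ J) :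
    Reg E (fun A => c * m A) p r J' C (c * lo) (c * hi) (c * κ) (Φ.image (c * ·)) := by
  classical
  have hJ' : ∀ z, z ∈ J' ↔ c⁻¹ * z ∈ J := fun z => by
    rw [← hJ, mul_inv_cancel_left₀ hc.ne']
  have hgk : ∀ k P, GK E m r J k P → GK E (fun A => c * m A) r J' k P := fun k P hP =>
    ⟨hP.1, fun l P' hP' hk => (hJ _).2 (hP.2 l P' hP' hk)⟩
  refine
    { p0 := h.p0, p1 := h.p1, r0 := h.r0, r1 := h.r1, C0 := h.C0
      lo0 := mul_pos hc h.lo0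
      lohi := mul_le_mul_of_nonneg_left h.lohi hc.le
      κ0 := mul_pos hc h.κ0
      Jp := fun z hz => ?_
      Jp' := fun z hz => ?_
      Φlo := fun φ hφ => ?_
      Φhi := fun φ hφ => ?_
      add := fun k P Q hP hQ hd => by rw [h.add k P Q hP hQ hd, mul_add]
      blocks := fun k P hP => ?_
      realize := fun z hz hz0 hz1 => ?_
      fraction := fun ε hε => ?_ }
  · rw [hJ'] at hz ⊢
    rw [mul_left_comm]
    exact h.Jp _ hz
  · rw [hJ'] at hz ⊢
    rw [mul_left_comm]
    exact h.Jp' _ hz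
  · obtain ⟨φ, hφ', rfl⟩ := Finset.mem_image.1 hφ
    exact mul_le_mul_of_nonneg_left (h.Φlo φ hφ') hc.le
  · obtain ⟨φ, hφ', rfl⟩ := Finset.mem_image.1 hφ
    exact mul_le_mul_of_nonneg_left (h.Φhi φ hφ') hc.le
  · obtain ⟨𝓑, hB, hd, hU⟩ := h.blocks k P hP
    refine ⟨𝓑, fun B hBm => ?_, hd, hU⟩
    obtain ⟨h1, h2, h3, φ, hφ, h4⟩ := hB B hBm
    exact ⟨h1, h2, h3, c * φ, Finset.mem_image_of_mem _ hφ, by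
      change c * m B = _
      rw [h4, mul_left_comm]⟩
  · obtain ⟨L, hL⟩ := h.realize (c⁻¹ * z) ((hJ' z).1 hz) (by positivity)
      (by rwa [inv_mul_lt_iff₀ hc])
    refine ⟨L, fun k P hP hn => ?_⟩
    obtain ⟨F, hF, hg, hm⟩ := hL k P hP hn
    exact ⟨F, hF, hgk _ _ hg, by rw [hm, mul_left_comm, mul_inv_cancel_left₀ hc.ne']⟩
  · obtain ⟨L, hL⟩ := h.fraction ε hε
    refine ⟨L, fun k P hP => ?_⟩
    obtain ⟨G, hG, hg, hm⟩ := hL k P hP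
    refine ⟨G, hG, hgk _ _ hg, ?_⟩
    have := mul_le_mul_of_nonneg_left hm hc.le
    linarith

lemma abs_smul_idealSet {R : Subring ℝ} (I : Ideal R) (a : ℝ) :
    |a| • idealSet I = a • idealSet I := by
  rcases abs_choice a with h | h <;> rw [h]
  ext x
  constructor
  · rintro ⟨y, hy, rfl⟩
    exact ⟨-y, (idealGrp I).neg_mem hy, by simp⟩
  · rintro ⟨y, hy, rfl⟩
    exact ⟨-y, (idealGrp I).neg_mem hy, by simp⟩

section biLipschitz

variable {α β : Type*} [MetricSpace α] [MetricSpace β] {E : Set α} {E' : Set β} {f : α → β}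
  {L r : ℝ} {c k : ℕ}

lemma KSet.image_biLip (hr0 : 0 < r) (hL : 1 ≤ L) (hf : BijOn f E E')
    (hd : ∀ x ∈ E, ∀ y ∈ E, L⁻¹ * dist x y ≤ dist (f x) (f y) ∧ dist (f x) (f y) ≤ L * dist x y)
    (hc : r ^ c < L⁻¹) {P : Set α} (hP : KSet E r k P) : KSet E' r (k + c) (f '' P) := by
  refine ⟨(image_mono hP.1).trans hf.image_eq.subset, ?_⟩
  rintro _ ⟨x, hx, rfl⟩ y hy hyP
  obtain ⟨y, hyE, rfl⟩ := hf.surjOn hy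
  have h1 := hP.2 x hx y hyE fun h => hyP ⟨y, h, rfl⟩
  have h2 := (hd x (hP.1 hx) y hyE).1
  have hk := pow_pos hr0 k
  rw [pow_add]
  have hL0 : 0 ≤ L⁻¹ := by positivity
  nlinarith [pow_pos hr0 c]

lemma KSet.preimage_biLip (hr0 : 0 < r) (hL : 1 ≤ L) (hf : BijOn f E E')
    (hd : ∀ x ∈ E, ∀ y ∈ E, L⁻¹ * dist x y ≤ dist (f x) (f y) ∧ dist (f x) (f y) ≤ L * dist x y)
    (hc : r ^ c < L⁻¹) {P : Set β} (hP : KSet E' r k P) :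
    KSet E r (k + c) (E ∩ f ⁻¹' P) ∧ f '' (E ∩ f ⁻¹' P) = P := by
  refine ⟨⟨inter_subset_left, ?_⟩, ?_⟩
  · rintro x ⟨hx, hxP⟩ y hy hyP
    have h1 := hP.2 _ hxP (f y) (hf.mapsTo hy) fun h => hyP ⟨hy, h⟩
    have h2 := (hd x hx y hy).2
    have hk := pow_pos hr0 k
    have hL0 : 0 < L := by linarith
    rw [pow_add]
    calc r ^ k * r ^ c ≤ r ^ k * L⁻¹ := by gcongr
      _ ≤ dist x y := by
        rw [mul_inv_le_iff₀ hL0]; linarith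
  · rw [image_inter_preimage, hf.image_eq]
    exact inter_eq_right.2 hP.1

end biLipschitz

namespace IFS

variable {d d' : ℕ} {S : IFS d} {T : IFS d'} {lam : S.ι → ℕ} {lam' : T.ι → ℕ} {p r : ℝ}

lemma Geo.exists_piece_subset (h : S.Geo lam r) {k : ℕ} {P : Set (EuclideanSpace ℝ (Fin d))}
    (hP : KSet S.attractor r k P) (hn : P.Nonempty) : ∃ u, S.g u '' S.attractor ⊆ P := by
  obtain ⟨b, hb⟩ := h.exists_pieces
  have hU := ((hb k _ le_rfl).2 _ hP).2
  rw [← hU] at hn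
  obtain ⟨x, hx⟩ := hn
  obtain ⟨u, hu, -⟩ := mem_iUnion₂.1 hx
  exact ⟨u, (mem_inner.1 hu).2⟩

namespace Nice

lemma lipEquiv_of_sameIdealClass (h : S.Nice lam p r) (h' : T.Nice lam' p r)
    (hI : SameIdealClass (S.idealOf p) (T.idealOf p)) : LipEquiv S.attractor T.attractor := by
  obtain ⟨a, b, ha, hb, hab⟩ := hI
  obtain ⟨C, lo, hi, κ, Φ, hR⟩ := h.exists_reg
  obtain ⟨C', lo', hi', κ', Φ', hR'⟩ := h'.exists_reg
  have ha' : (0 : ℝ) < |(a : ℝ)| := abs_pos.2 fun h0 => ha (Subtype.ext h0)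
  have hb' : (0 : ℝ) < |(b : ℝ)| := abs_pos.2 fun h0 => hb (Subtype.ext h0)
  rw [← abs_smul_idealSet _ (a : ℝ), ← abs_smul_idealSet _ (b : ℝ)] at hab
  obtain ⟨J, hJ⟩ : ∃ J : AddSubgroup ℝ, (J : Set ℝ) = |(a : ℝ)| • idealSet (S.idealOf p) :=
    ⟨(idealGrp (S.idealOf p)).map (AddMonoidHom.mulLeft |(a : ℝ)|), by
      ext x; simp [mem_smul_set, mem_idealGrp]⟩
  refine (hR.scale (J' := J) ha' fun x => ?_).lipEquiv (hR'.scale (J' := J) hb' fun x => ?_)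
    h.isCompact h'.isCompact h.nonempty h'.nonempty
  · rw [← SetLike.mem_coe, hJ, ← smul_eq_mul, smul_mem_smul_set_iff₀ ha'.ne']
    rfl
  · rw [← SetLike.mem_coe, hJ, hab, ← smul_eq_mul, smul_mem_smul_set_iff₀ hb'.ne']
    rfl

lemma isIntSep_of_subset_kset (h : S.Nice lam p r) {F G : Set (EuclideanSpace ℝ (Fin d))} {k : ℕ}
    (hF : S.IsIntSep F) (hGF : G ⊆ F) (hG : KSet S.attractor r k G) : S.IsIntSep G :=
  h.toGeo.isIntSep_of_subset hF hGF hG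

lemma idealSet_subset {R : Subring ℝ} {I : Ideal R} {ρ : ℝ}
    (hR : R = Zring p) (hρ : ∀ F, S.IsIntSep F → ρ * S.natMeasure F ∈ idealSet I) {x : ℝ}
    (hx : x ∈ idealSet (S.idealOf p)) : ρ * x ∈ idealSet I := by
  subst hR
  obtain ⟨x, hx, rfl⟩ := hx
  induction hx using Submodule.span_induction with
  | mem x hx =>
    obtain ⟨F, hF, hx⟩ := hx
    simp only [hx]
    exact hρ F hF
  | zero =>
    change ρ * ((0 : Zring p) : ℝ) ∈ _
    rw [ZeroMemClass.coe_zero, mul_zero]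
    exact (idealGrp I).zero_mem
  | add x y _ _ hx hy =>
    have := (idealGrp I).add_mem hx hy
    rw [← mul_add] at this
    exact this
  | smul a x _ hx =>
    have := mul_mem_idealSet a.2 hx
    rw [mul_left_comm] at this
    exact this

/-- A bi-Lipschitz map between self-similar sets is measure-linear on a separated subset. -/
lemma exists_measure_linear (h : S.Nice lam p r) (h' : T.Nice lam' p r)
    {f : EuclideanSpace ℝ (Fin d) → EuclideanSpace ℝ (Fin d')} {L : ℝ} (hL : 1 ≤ L)
    (hf : BijOn f S.attractor T.attractor)
    (hd : ∀ x ∈ S.attractor, ∀ y ∈ S.attractor,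
      L⁻¹ * dist x y ≤ dist (f x) (f y) ∧ dist (f x) (f y) ≤ L * dist x y)
    {k0 : ℕ} {B0 : Set (EuclideanSpace ℝ (Fin d))} (hB0 : KSet S.attractor r k0 B0)
    (hn : B0.Nonempty) : ∃ B ⊆ B0, ∃ k ρ, KSet S.attractor r k B ∧ B.Nonempty ∧
      ∀ l P, P ⊆ B → KSet S.attractor r l P →
        T.natMeasure (f '' P) = ρ * S.natMeasure P := by
  classical
  have r0 := h.r0
  have p0 := h.p0
  have hL0 : 0 < L := by linarith
  obtain ⟨c, hc⟩ := exists_pow_lt_of_lt_one (inv_pos.2 hL0) h.r1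
  have himg : ∀ {k P}, KSet S.attractor r k P → KSet T.attractor r (k + c) (f '' P) := fun hP =>
    hP.image_biLip r0 hL hf hd hc
  obtain ⟨C, hC, hbl⟩ := h.exists_blocks
  obtain ⟨Φ, hΦ, hty⟩ := h.exists_types C
  obtain ⟨Φ', hΦ', hty'⟩ := h'.exists_types (L * C * (r ^ c)⁻¹)
  let Bl : ℕ → Set (EuclideanSpace ℝ (Fin d)) → Prop := fun k B =>
    KSet S.attractor r k B ∧ B.Nonempty ∧ ∀ x ∈ B, ∀ y ∈ B, dist x y ≤ C * r ^ k
  have hfin : ∀ k B, Bl k B → ∃ ρ ∈ (Φ ×ˢ Φ').image fun φ => p ^ c * φ.2 / φ.1,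
      T.natMeasure (f '' B) = ρ * S.natMeasure B := by
    rintro k B ⟨hB, hBn, hBd⟩
    obtain ⟨φ, hφ, hm⟩ := hty k B hB hBn hBd
    obtain ⟨φ', hφ', hm'⟩ := hty' (k + c) (f '' B) (himg hB) (hBn.image f) (by
      rintro _ ⟨x, hx, rfl⟩ _ ⟨y, hy, rfl⟩
      refine (hd x (hB.1 hx) y (hB.1 hy)).2.trans ?_
      have h1 := hBd x hx y hy
      have h2 : L * C * (r ^ c)⁻¹ * r ^ (k + c) = L * (C * r ^ k) := by
        rw [pow_add]; field_simp
      rw [h2]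
      exact mul_le_mul_of_nonneg_left h1 hL0.le)
    refine ⟨_, Finset.mem_image.2 ⟨(φ, φ'), Finset.mem_product.2 ⟨hφ, hφ'⟩, rfl⟩, ?_⟩
    have := hΦ φ hφ
    rw [hm', hm, pow_add]
    field_simp
  obtain ⟨Z, hZ⟩ : ∃ Z : Finset ℝ, ∀ ρ, ρ ∈ Z ↔
      ρ ∈ ((Φ ×ˢ Φ').image fun φ => p ^ c * φ.2 / φ.1) ∧ ∃ k B, Bl k B ∧ B ⊆ B0 ∧
        T.natMeasure (f '' B) = ρ * S.natMeasure B :=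
    ⟨((Φ ×ˢ Φ').image fun φ => p ^ c * φ.2 / φ.1).filter fun ρ => ∃ k B, Bl k B ∧ B ⊆ B0 ∧
        T.natMeasure (f '' B) = ρ * S.natMeasure B, fun ρ => Finset.mem_filter⟩
  have hZn : Z.Nonempty := by
    obtain ⟨𝓑, hB, -, hU⟩ := hbl k0 B0 hB0
    rw [← hU] at hn
    obtain ⟨x, B, hBm, -⟩ := hn
    obtain ⟨ρ, hρ, hρm⟩ := hfin k0 B (hB B hBm)
    exact ⟨ρ, (hZ ρ).2 ⟨hρ, k0, B, hB B hBm, (subset_sUnion_of_mem hBm).trans hU.subset, hρm⟩⟩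
  obtain ⟨-, k, B, hB, hBB0, hBm⟩ := (hZ _).1 (Z.max'_mem hZn)
  obtain ⟨ρ, hρ⟩ : ∃ ρ, ρ = Z.max' hZn := ⟨_, rfl⟩
  rw [← hρ] at hBm
  have hadd : ∀ {k P Q}, KSet S.attractor r k P → KSet S.attractor r k Q → Disjoint P Q →
      T.natMeasure (f '' (P ∪ Q)) = T.natMeasure (f '' P) + T.natMeasure (f '' Q) := by
    intro k P Q hP hQ hPQ
    rw [image_union, h'.m_union_kset (himg hP) (himg hQ)]
    rw [disjoint_left]
    rintro _ ⟨x, hx, rfl⟩ ⟨y, hy, hyx⟩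
    rw [hf.injOn (hQ.1 hy) (hP.1 hx) hyx] at hy
    exact disjoint_left.1 hPQ hx hy
  have hle : ∀ l P, P ⊆ B → KSet S.attractor r l P →
      T.natMeasure (f '' P) ≤ ρ * S.natMeasure P := by
    intro l P hPB hP
    obtain ⟨𝓑, h𝓑, hdis, hU⟩ := hbl l P hP
    rw [← hU] at hPB ⊢
    clear hU hP
    induction 𝓑 using Finset.induction_on with
    | empty => simp [natMeasure_empty]
    | insert A s hA ih =>
      rw [Finset.coe_insert, sUnion_insert] at hPB ⊢
      have hAB : Bl l A := h𝓑 A (Finset.mem_insert_self _ _)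
      have hsB : KSet S.attractor r l (⋃₀ (s : Set (Set (EuclideanSpace ℝ (Fin d))))) :=
        KSet.sUnion fun A hA => (h𝓑 A (Finset.mem_insert_of_mem hA)).1
      have hdj : Disjoint A (⋃₀ (s : Set (Set (EuclideanSpace ℝ (Fin d))))) := by
        rw [disjoint_sUnion_right]
        intro A' hA'
        refine hdis (by simp) (by simp [Finset.mem_coe.1 hA']) ?_
        rintro rfl
        exact hA hA'
      rw [hadd hAB.1 hsB hdj, h.m_union_kset hAB.1 hsB hdj, mul_add]
      refine add_le_add ?_ (ih (subset_union_right.trans hPB)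
        (fun A' hA' => h𝓑 A' (Finset.mem_insert_of_mem hA')) (hdis.subset (by simp)))
      obtain ⟨ρ', hρ', hm⟩ := hfin l A hAB
      rw [hm]
      refine mul_le_mul_of_nonneg_right ?_ (natMeasure_nonneg A)
      rw [hρ]
      exact Z.le_max' _ ((hZ _).2 ⟨hρ', l, A, hAB, (subset_union_left.trans hPB).trans hBB0, hm⟩)
  refine ⟨B, hBB0, k, ρ, hB.1, hB.2.1, fun l P hPB hP => (hle l P hPB hP).antisymm ?_⟩
  have h1 := hP.mono r0 h.r1 (le_max_right k l)
  have h2 := (hB.1.mono r0 h.r1 (le_max_left k l)).diff h1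
  have h3 := hle _ _ sdiff_subset h2
  have h4 := hadd h1 h2 disjoint_sdiff_right
  have h5 := h.m_union_kset h1 h2 disjoint_sdiff_right
  rw [union_sdiff_cancel hPB] at h4 h5
  rw [h4, h5] at hBm
  linarith

lemma sameIdealClass_of_lipEquiv (h : S.Nice lam p r) (h' : T.Nice lam' p r)
    (hST : LipEquiv S.attractor T.attractor) : SameIdealClass (S.idealOf p) (T.idealOf p) := by
  obtain ⟨f, L, hL, hf, hd⟩ := hST
  have r0 := h.r0
  have p0 := h.p0
  have hL0 : 0 < L := by linarith
  obtain ⟨c, hc⟩ := exists_pow_lt_of_lt_one (inv_pos.2 hL0) h.r1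
  obtain ⟨F, hF, hFn⟩ := h.exists_isIntSep
  obtain ⟨F', hF', hFn'⟩ := h'.exists_isIntSep
  obtain ⟨k, hk⟩ := exists_kset h.r1 hF.2.1 hF.1 hF.2.2.1
  obtain ⟨v, hv⟩ := h'.exists_piece_subset (hk.image_biLip r0 hL hf hd hc) (hFn.image f)
  have hvI := h'.isIntSep_image hF' v
  obtain ⟨k', hk'⟩ := exists_kset h.r1 hvI.2.1 hvI.1 hvI.2.2.1
  obtain ⟨hB0, hB0'⟩ := hk'.preimage_biLip r0 hL hf hd hc
  have hB0F : S.attractor ∩ f ⁻¹' (T.g v '' F') ⊆ F := by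
    rintro x ⟨hx, hxf⟩
    obtain ⟨y, hy, hyx⟩ := hv (image_mono hF'.2.1 hxf)
    rwa [← hf.injOn (hF.2.1 hy) hx hyx]
  obtain ⟨B0, hB0e⟩ : ∃ B0, B0 = S.attractor ∩ f ⁻¹' (T.g v '' F') := ⟨_, rfl⟩
  rw [← hB0e] at hB0 hB0' hB0F
  have hB0n : B0.Nonempty := by
    rw [← image_nonempty (f := f), hB0']
    exact hFn'.image _
  have hB0I := h.isIntSep_of_subset_kset hF hB0F hB0
  obtain ⟨B, hBB, l, ρ, hB, hBn, hlin⟩ := h.exists_measure_linear h' hL hf hd hB0 hB0n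
  have hBm := hlin l B Subset.rfl hB
  have hfB := hB.image_biLip r0 hL hf hd hc
  have hBpos := h.m_pos hB hBn
  have hBpos' := h'.m_pos hfB (hBn.image f)
  have hρ0 : ρ ≠ 0 := by
    rintro rfl
    rw [zero_mul] at hBm
    exact hBpos'.ne' hBm
  have hsub : ∀ x ∈ idealSet (S.idealOf p), ρ * x ∈ idealSet (T.idealOf p) := by
    refine fun x hx => idealSet_subset rfl (fun A hA => ?_) hx
    obtain ⟨u, hu⟩ := h.exists_piece_subset hB hBn
    obtain ⟨n, hn⟩ := h.exists_kset_of_isIntSep hA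
    have hAB : S.g u '' A ⊆ B := (image_mono hA.2.1).trans hu
    have h1 := hlin _ _ hAB (hn u)
    have h2 := h'.m_mem_idealSet (h'.isIntSep_of_subset_kset hvI
      ((image_mono (hAB.trans hBB)).trans hB0'.subset) ((hn u).image_biLip r0 hL hf hd hc))
    rw [h1, h.m_image] at h2
    have h3 := mul_mem_idealSet (pow_mem h.inv_mem (wt lam u)) h2
    convert h3 using 1
    rw [inv_pow]
    field_simp
  have hsub' : ∀ x ∈ idealSet (T.idealOf p), ρ⁻¹ * x ∈ idealSet (S.idealOf p) := by
    refine fun x hx => idealSet_subset rfl (fun A hA => ?_) hx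
    obtain ⟨u, hu⟩ := h'.exists_piece_subset hfB (hBn.image f)
    obtain ⟨n, hn⟩ := h'.exists_kset_of_isIntSep hA
    obtain ⟨hP, hPe⟩ := (hn u).preimage_biLip r0 hL hf hd hc
    have hPB : S.attractor ∩ f ⁻¹' (T.g u '' A) ⊆ B := by
      rintro x ⟨hx, hxf⟩
      obtain ⟨y, hy, hyx⟩ := hu (image_mono hA.2.1 hxf)
      rwa [← hf.injOn (hB.1 hy) hx hyx]
    have h1 := hlin _ _ hPB hP
    have h2 := h.m_mem_idealSet (h.isIntSep_of_subset_kset hB0I (hPB.trans hBB) hP)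
    rw [hPe, h'.m_image] at h1
    have h3 := mul_mem_idealSet (pow_mem h.inv_mem (wt lam' u)) h2
    convert h3 using 1
    have h4 : S.natMeasure (S.attractor ∩ f ⁻¹' (T.g u '' A)) =
        ρ⁻¹ * (p ^ wt lam' u * T.natMeasure A) := by
      rw [h1, inv_mul_cancel_left₀ hρ0]
    rw [inv_pow, h4]
    field_simp
  refine ⟨⟨_, h'.m_mem_Zring hfB⟩, ⟨_, h.m_mem_Zring hB⟩, fun h0 => hBpos'.ne' (congrArg Subtype.val h0),
    fun h0 => hBpos.ne' (congrArg Subtype.val h0), ?_⟩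
  ext x
  simp only [mem_smul_set, smul_eq_mul]
  constructor
  · rintro ⟨y, hy, rfl⟩
    exact ⟨ρ * y, hsub y hy, by rw [hBm]; ring⟩
  · rintro ⟨y, hy, rfl⟩
    exact ⟨ρ⁻¹ * y, hsub' y hy, by rw [hBm]; field_simp⟩

end Nice

end IFS

namespace IFS

variable {d : ℕ} {S : IFS d} {lam : S.ι → ℕ} {p r : ℝ}

/-- The attractor exists as soon as some nonempty compact set is mapped into itself. -/
lemma isAttractor_attractor_of_mapsTo [Nonempty S.ι] {B : Set (EuclideanSpace ℝ (Fin d))}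
    (hB : IsCompact B) (hBn : B.Nonempty) (hS : ∀ i, S.f i '' B ⊆ B) :
    S.IsAttractor S.attractor := by
  have hcont : ∀ i, Continuous (S.f i) := fun i =>
    (LipschitzWith.of_dist_le_mul (K := ⟨S.r i, (S.r_pos i).le⟩) fun x y =>
      (S.sim i x y).le).continuous
  have hinj : ∀ i, Function.Injective (S.f i) := fun i x y hxy => by
    have := S.sim i x y
    rw [hxy, dist_self, eq_comm, mul_eq_zero] at this
    exact dist_eq_zero.1 (this.resolve_left (S.r_pos i).ne')
  let H : Set (EuclideanSpace ℝ (Fin d)) → Set (EuclideanSpace ℝ (Fin d)) :=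
    fun A => ⋃ i, S.f i '' A
  have hH : Monotone H := fun A A' h => iUnion_mono fun i => image_mono h
  let K : ℕ → Set (EuclideanSpace ℝ (Fin d)) := fun n => H^[n] B
  have hKs : ∀ n, K (n + 1) = H (K n) := fun n => Function.iterate_succ_apply' H n B
  have hK1 : ∀ n, K (n + 1) ⊆ K n := fun n => by
    induction n with
    | zero => exact iUnion_subset hS
    | succ n ih => rw [hKs (n + 1)]; exact (hH ih).trans (hKs n).ge
  have hKanti : Antitone K := antitone_nat_of_succ_le hK1
  have hKc : ∀ n, IsCompact (K n) := fun n => by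
    induction n with
    | zero => exact hB
    | succ n ih => rw [hKs]; exact isCompact_iUnion fun i => ih.image (hcont i)
  have hKn : ∀ n, (K n).Nonempty := fun n => by
    induction n with
    | zero => exact hBn
    | succ n ih =>
      rw [hKs]
      obtain ⟨x, hx⟩ := ih
      exact ⟨_, mem_iUnion.2 ⟨Classical.arbitrary _, mem_image_of_mem _ hx⟩⟩
  have hE : S.IsAttractor (⋂ n, K n) := by
    refine ⟨IsCompact.nonempty_iInter_of_sequence_nonempty_isCompact_isClosed K hK1 hKn (hKc 0)
      fun n => (hKc n).isClosed, (hKc 0).of_isClosed_subset (isClosed_iInter fun n => (hKc n).isClosed) (iInter_subset K 0), Subset.antisymm ?_ ?_⟩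
    · intro x hx
      have hx' : ∀ n, ∃ i, x ∈ S.f i '' K n := fun n => by
        have := mem_iInter.1 hx (n + 1)
        rw [hKs] at this
        exact mem_iUnion.1 this
      choose i hi using hx'
      obtain ⟨j, hj⟩ := Finite.exists_infinite_fiber i
      have hj' : (i ⁻¹' {j}).Infinite := infinite_coe_iff.1 hj
      refine mem_iUnion.2 ⟨j, ?_⟩
      obtain ⟨n0, hn0⟩ := hj'.nonempty
      obtain ⟨y, -, hyx⟩ := hi n0
      rw [show i n0 = j from hn0] at hyx
      refine ⟨y, mem_iInter.2 fun n => ?_, hyx⟩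
      obtain ⟨m, hm, hnm⟩ := hj'.exists_gt n
      obtain ⟨z, hz, hzx⟩ := hi m
      rw [show i m = j from hm, ← hyx] at hzx
      rw [← hinj j hzx]
      exact hKanti hnm.le hz
    · refine iUnion_subset fun i => ?_
      rintro _ ⟨x, hx, rfl⟩
      refine mem_iInter.2 fun n => hK1 n ?_
      rw [hKs]
      exact mem_iUnion.2 ⟨i, mem_image_of_mem _ (mem_iInter.1 hx n)⟩
  have hex : ∃ E, S.IsAttractor E := ⟨_, hE⟩
  rw [attractor, dif_pos hex]
  exact hex.choose_spec

namespace Nice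

lemma m_eq_sum_preimage (h : S.Nice lam p r) {k : ℕ} {A : Set (EuclideanSpace ℝ (Fin d))}
    (hA : KSet S.attractor r k A) :
    S.natMeasure A = ∑ i, p ^ lam i * S.natMeasure (S.attractor ∩ S.f i ⁻¹' A) := by
  classical
  have hcut : cut lam 1 = Finset.univ.image fun i => [i] := by
    ext u
    rw [mem_cut_succ]
    simp only [Finset.mem_image, Finset.mem_univ, true_and]
    constructor
    · rintro (⟨hu, hu'⟩ | ⟨v, hv, -, i, rfl⟩)
      · rw [cut, Finset.mem_singleton] at hu
        subst hu
        simp at hu'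
      · rw [cut, Finset.mem_singleton] at hv
        exact ⟨i, by simp [hv]⟩
    · rintro ⟨i, rfl⟩
      exact .inr ⟨[], by simp [cut], by simp, i, rfl⟩
  rw [h.m_eq_sum_cut hA.1 (h.measurableSet hA) 1, hcut, Finset.sum_image fun i _ j _ hij => List.singleton_inj.1 hij]
  refine Finset.sum_congr rfl fun i _ => ?_
  have := h.m_image [i] (S.attractor ∩ S.f i ⁻¹' A)
  rw [g_singleton, image_inter_preimage, inter_comm] at this
  rw [g_singleton, this]
  simp [wt]

end Nice

/-- Preimages of separated sets are separated at a coarser scale. -/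
lemma Geo.kset_preimage (h : S.Geo lam r) {k : ℕ} {A : Set (EuclideanSpace ℝ (Fin d))}
    (hA : KSet S.attractor r (k + 1) A) (i : S.ι) :
    KSet S.attractor r k (S.attractor ∩ S.f i ⁻¹' A) := by
  refine ⟨inter_subset_left, ?_⟩
  rintro x ⟨hx, hxA⟩ y hy hyA
  have h1 := hA.2 _ hxA (S.f i y) (h.f_image_subset i (mem_image_of_mem _ hy)) fun h => hyA ⟨hy, h⟩
  rw [S.sim, h.hr] at h1
  have r0 := h.r0
  have h2 : r ^ lam i ≤ r := by
    simpa using pow_le_pow_of_le_one r0.le h.r1.le (h.hl i)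
  have h3 : r ^ lam i * dist x y ≤ r * dist x y := mul_le_mul_of_nonneg_right h2 dist_nonneg
  rw [pow_succ'] at h1
  exact le_of_mul_le_mul_left (h1.trans h3) r0

end IFS

/-- Data for a self-similar set made of a small copy of itself at the origin together with finitely
many clusters of small copies, the copies of one cluster sharing a vertex. -/
structure ConeData where
  M : ℕ
  κ : Type
  cl : Fin M → κ
  e : Fin M → ℕ
  n0 : ℕ
  t : κ → ℝ
  δ : ℝ
  r : ℝ
  r0 : 0 < r
  r1 : r < 1
  n0_pos : 0 < n0
  e_pos : ∀ j, 0 < e j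
  δ0 : 0 < δ
  hδ : ∀ j, r ^ e j ≤ δ
  ht1 : ∀ c, r ^ n0 / 3 + 3 * δ ≤ t c
  ht2 : ∀ c, t c ≤ 1 / 3 - 3 * δ
  ht3 : ∀ c c', c ≠ c' → 3 * δ ≤ |t c - t c'|

namespace ConeData

variable (D : ConeData)

/-- The vertex of a cluster. -/
def vtx (c : D.κ) : EuclideanSpace ℝ (Fin (D.M + 1)) := EuclideanSpace.single 0 (D.t c)

/-- The isometry exchanging the axis of the cone with another coordinate axis. -/
def sw (j : Fin D.M) :
    EuclideanSpace ℝ (Fin (D.M + 1)) ≃ₗᵢ[ℝ] EuclideanSpace ℝ (Fin (D.M + 1)) :=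
  LinearIsometryEquiv.piLpCongrLeft 2 ℝ ℝ (Equiv.swap 0 j.succ)

/-- The exponents of the contraction ratios. -/
def lam (i : Option (Fin D.M)) : ℕ := i.elim D.n0 D.e

/-- The maps of the iterated function system. -/
def map (i : Option (Fin D.M)) (x : EuclideanSpace ℝ (Fin (D.M + 1))) :
    EuclideanSpace ℝ (Fin (D.M + 1)) :=
  i.elim (D.r ^ D.n0 • x) fun j => D.vtx (D.cl j) + D.r ^ D.e j • D.sw j x

lemma lam_pos (i : Option (Fin D.M)) : 0 < D.lam i := by
  cases i with
  | none => exact D.n0_pos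
  | some j => exact D.e_pos j

/-- The iterated function system of the cone data. -/
def ifs : IFS (D.M + 1) where
  ι := Option (Fin D.M)
  fin := inferInstance
  f := D.map
  r i := D.r ^ D.lam i
  r_pos _ := pow_pos D.r0 _
  r_lt_one i := pow_lt_one₀ D.r0.le D.r1 (D.lam_pos i).ne'
  sim i x y := by
    have h := D.r0
    cases i with
    | none =>
      change dist (D.r ^ D.n0 • x) (D.r ^ D.n0 • y) = D.r ^ D.n0 * dist x y
      rw [dist_smul₀, Real.norm_of_nonneg (by positivity)]
    | some j =>
      change dist (D.vtx (D.cl j) + D.r ^ D.e j • D.sw j x)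
        (D.vtx (D.cl j) + D.r ^ D.e j • D.sw j y) = D.r ^ D.e j * dist x y
      rw [dist_add_left, dist_smul₀, Real.norm_of_nonneg (by positivity),
        LinearIsometryEquiv.dist_map]

/-- The open cone used in the open set condition. -/
def cone : Set (EuclideanSpace ℝ (Fin (D.M + 1))) :=
  {x | 0 < x 0 ∧ (∀ k, k ≠ 0 → |x k| < x 0 / 2) ∧ ‖x‖ < 1 / 3}

lemma f_none (x : EuclideanSpace ℝ (Fin (D.M + 1))) : D.ifs.f none x = D.r ^ D.n0 • x := rfl

lemma f_some (j : Fin D.M) (x : EuclideanSpace ℝ (Fin (D.M + 1))) :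
    D.ifs.f (some j) x = D.vtx (D.cl j) + D.r ^ D.e j • D.sw j x := rfl

lemma f_none_zero : D.ifs.f none 0 = 0 := smul_zero _

lemma f_some_zero (j : Fin D.M) : D.ifs.f (some j) 0 = D.vtx (D.cl j) := by
  rw [f_some, map_zero, smul_zero, add_zero]

lemma norm_f_none (x : EuclideanSpace ℝ (Fin (D.M + 1))) :
    ‖D.ifs.f none x‖ = D.r ^ D.n0 * ‖x‖ := by
  rw [f_none, norm_smul, Real.norm_of_nonneg (pow_nonneg D.r0.le _)]

lemma dist_f_some_vtx (j : Fin D.M) (x : EuclideanSpace ℝ (Fin (D.M + 1))) :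
    dist (D.ifs.f (some j) x) (D.vtx (D.cl j)) = D.r ^ D.e j * ‖x‖ := by
  rw [← f_some_zero]
  refine (D.ifs.sim (some j) x 0).trans ?_
  rw [dist_zero_right]
  rfl

lemma dist_f_some_vtx_le (j : Fin D.M) {x : EuclideanSpace ℝ (Fin (D.M + 1))}
    (hx : ‖x‖ ≤ 1 / 3) : dist (D.ifs.f (some j) x) (D.vtx (D.cl j)) ≤ D.δ := by
  rw [dist_f_some_vtx]
  have h1 := D.hδ j
  have h2 := pow_pos D.r0 (D.e j)
  have h3 := D.δ0
  nlinarith [norm_nonneg x]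

lemma abs_apply_sub_le (x y : EuclideanSpace ℝ (Fin (D.M + 1))) (k : Fin (D.M + 1)) :
    |x k - y k| ≤ dist x y := by
  rw [dist_eq_norm, ← Real.norm_eq_abs]
  exact PiLp.norm_apply_le (x - y) k

lemma vtx_zero (c : D.κ) : D.vtx c 0 = D.t c := by simp [vtx]

lemma vtx_ne (c : D.κ) {k : Fin (D.M + 1)} (hk : k ≠ 0) : D.vtx c k = 0 := by simp [vtx, hk]

lemma t_pos (c : D.κ) : 0 < D.t c := by
  have h1 := D.ht1 c
  have h2 := D.δ0
  have h3 := pow_pos D.r0 D.n0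
  linarith

lemma norm_vtx (c : D.κ) : ‖D.vtx c‖ = D.t c := by
  rw [vtx, PiLp.norm_single, Real.norm_of_nonneg (D.t_pos c).le]

lemma near_vtx {c : D.κ} {y : EuclideanSpace ℝ (Fin (D.M + 1))} (hy : dist y (D.vtx c) ≤ D.δ) :
    y ∈ D.cone ∧ D.r ^ D.n0 / 3 + 2 * D.δ ≤ ‖y‖ := by
  have h1 := D.ht1 c
  have h2 := D.ht2 c
  have h3 := D.δ0
  have h4 := pow_pos D.r0 D.n0
  have h0 := (D.abs_apply_sub_le y (D.vtx c) 0).trans hy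
  rw [vtx_zero, abs_le] at h0
  have h5 : |‖y‖ - D.t c| ≤ D.δ := by
    rw [← norm_vtx]
    exact (abs_norm_sub_norm_le y (D.vtx c)).trans (by rwa [← dist_eq_norm])
  rw [abs_le] at h5
  refine ⟨⟨by linarith, fun k hk => ?_, by linarith⟩, by linarith⟩
  have h6 := (D.abs_apply_sub_le y (D.vtx c) k).trans hy
  rw [D.vtx_ne c hk, sub_zero] at h6
  linarith

lemma cl_eq_of_near {c c' : D.κ} {y : EuclideanSpace ℝ (Fin (D.M + 1))}
    (hy : dist y (D.vtx c) ≤ D.δ) (hy' : dist y (D.vtx c') ≤ D.δ) : c = c' := by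
  by_contra hc
  have h := D.ht3 c c' hc
  have h0 := (D.abs_apply_sub_le y (D.vtx c) 0).trans hy
  have h1 := (D.abs_apply_sub_le y (D.vtx c') 0).trans hy'
  rw [vtx_zero, abs_le] at h0 h1
  have := D.δ0
  rcases le_abs.1 h with h | h <;> linarith

lemma isOpen_cone : IsOpen D.cone := by
  have : D.cone = {x | 0 < x 0} ∩ ((⋂ k : Fin (D.M + 1), {x | k ≠ 0 → |x k| < x 0 / 2}) ∩
      {x | ‖x‖ < 1 / 3}) := by
    ext x; simp [cone]
  rw [this]
  have hc : ∀ k : Fin (D.M + 1), Continuous fun x : EuclideanSpace ℝ (Fin (D.M + 1)) => x k :=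
    fun k => by fun_prop
  refine (isOpen_lt continuous_const (hc 0)).inter ((isOpen_iInter_of_finite fun k => ?_).inter
    (isOpen_lt continuous_norm continuous_const))
  by_cases hk : k = 0
  · simp [hk]
  · simpa [hk] using isOpen_lt (hc k).abs ((hc 0).div_const 2)

lemma oscSet_cone : D.ifs.OSCSet D.cone := by
  have hr := D.r0
  have hd := D.δ0
  have hn0 : 0 < D.r ^ D.n0 := pow_pos D.r0 _
  have hn1 : D.r ^ D.n0 < 1 := pow_lt_one₀ D.r0.le D.r1 D.n0_pos.ne'
  refine ⟨⟨EuclideanSpace.single 0 (1 / 6), ?_⟩, D.isOpen_cone, ?_, ?_, ?_⟩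
  · refine ⟨by simp, fun k hk => by simp [hk], ?_⟩
    rw [PiLp.norm_single, Real.norm_of_nonneg (by norm_num)]
    norm_num
  · refine (isBounded_ball (x := (0 : EuclideanSpace ℝ (Fin (D.M + 1)))) (r := 1 / 3)).subset ?_
    exact fun x hx => mem_ball_zero_iff.2 hx.2.2
  · rintro i _ ⟨x, hx, rfl⟩
    cases i with
    | none =>
      refine ⟨?_, fun k hk => ?_, ?_⟩
      · rw [f_none]; exact mul_pos hn0 hx.1
      · rw [f_none]
        change |D.r ^ D.n0 * x k| < D.r ^ D.n0 * x 0 / 2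
        rw [abs_mul, abs_of_pos hn0, mul_div_assoc]
        exact mul_lt_mul_of_pos_left (hx.2.1 k hk) hn0
      · rw [norm_f_none]
        have := hx.2.2
        nlinarith [norm_nonneg x]
    | some j => exact (D.near_vtx (D.dist_f_some_vtx_le j hx.2.2.le)).1
  · have hns : ∀ j, Disjoint (D.ifs.f none '' D.cone) (D.ifs.f (some j) '' D.cone) := by
      intro j
      rw [disjoint_left]
      rintro _ ⟨x, hx, rfl⟩ ⟨y, hy, hyx⟩
      have h1 := (D.near_vtx (D.dist_f_some_vtx_le j hy.2.2.le)).2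
      rw [hyx, norm_f_none] at h1
      have := hx.2.2
      nlinarith
    intro i i' hii
    cases i with
    | none =>
      cases i' with
      | none => exact (hii rfl).elim
      | some j => exact hns j
    | some j =>
      cases i' with
      | none => exact (hns j).symm
      | some j' =>
        have hj : j ≠ j' := fun h => hii (congrArg some h)
        rw [disjoint_left]
        rintro _ ⟨x, hx, rfl⟩ ⟨y, hy, hyx⟩
        have h1 := D.dist_f_some_vtx_le j hx.2.2.le
        have h2 := D.dist_f_some_vtx_le j' hy.2.2.le
        rw [hyx] at h2
        have hc := D.cl_eq_of_near h1 h2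
        rw [f_some, f_some, hc, add_right_inj] at hyx
        have hcoord : ∀ k, D.r ^ D.e j' * y (Equiv.swap 0 j'.succ k) =
            D.r ^ D.e j * x (Equiv.swap 0 j.succ k) := fun k =>
          congrArg (fun z : EuclideanSpace ℝ (Fin (D.M + 1)) => z k) hyx
        have hjj : j.succ ≠ j'.succ := fun h => hj (Fin.succ_injective _ h)
        have e1 := hcoord j.succ
        have e2 := hcoord j'.succ
        rw [Equiv.swap_apply_right, Equiv.swap_apply_of_ne_of_ne (Fin.succ_ne_zero _) hjj] at e1
        rw [Equiv.swap_apply_right, Equiv.swap_apply_of_ne_of_ne (Fin.succ_ne_zero _) hjj.symm] at e2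
        have g1 := hx.2.1 _ (Fin.succ_ne_zero j')
        have g2 := hy.2.1 _ (Fin.succ_ne_zero j)
        rw [abs_lt] at g1 g2
        have hx0 := hx.1
        have hy0 := hy.1
        have a1 := pow_pos hr (D.e j)
        have a2 := pow_pos hr (D.e j')
        have b1 := mul_lt_mul_of_pos_left g1.2 a1
        have b2 := mul_lt_mul_of_pos_left g2.2 a2
        have c1 := mul_pos a1 hx0
        have c2 := mul_pos a2 hy0
        linarith

lemma geo : D.ifs.Geo D.lam D.r where
  r0 := D.r0
  r1 := D.r1
  hl := D.lam_pos
  hr _ := rfl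
  osc := ⟨_, D.oscSet_cone⟩
  att := by
    have : Nonempty D.ifs.ι := ⟨(none : Option (Fin D.M))⟩
    have hn1 : D.r ^ D.n0 < 1 := pow_lt_one₀ D.r0.le D.r1 D.n0_pos.ne'
    refine IFS.isAttractor_attractor_of_mapsTo (isCompact_closedBall 0 (1 / 3)) ⟨0, by simp⟩ ?_
    rintro i _ ⟨x, hx, rfl⟩
    rw [mem_closedBall_zero_iff] at hx ⊢
    cases i with
    | none =>
      rw [norm_f_none]
      have := pow_pos D.r0 D.n0
      nlinarith [norm_nonneg x]
    | some j => exact (D.near_vtx (D.dist_f_some_vtx_le j hx)).1.2.2.le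

lemma norm_le {x : EuclideanSpace ℝ (Fin (D.M + 1))} (hx : x ∈ D.ifs.attractor) :
    ‖x‖ ≤ 1 / 3 := by
  have h1 : closure D.cone ⊆ closedBall 0 (1 / 3) :=
    closure_minimal (fun y hy => mem_closedBall_zero_iff.2 hy.2.2.le) isClosed_closedBall
  exact mem_closedBall_zero_iff.1 (h1 (D.geo.subset_closure D.oscSet_cone hx))

lemma cases_mem {x : EuclideanSpace ℝ (Fin (D.M + 1))} (hx : x ∈ D.ifs.attractor) :
    (∃ y ∈ D.ifs.attractor, D.ifs.f none y = x) ∨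
      ∃ j, ∃ y ∈ D.ifs.attractor, D.ifs.f (some j) y = x := by
  rw [D.geo.att.2.2] at hx
  obtain ⟨i, hi⟩ := mem_iUnion.1 hx
  cases i with
  | none => exact .inl hi
  | some j => exact .inr ⟨j, hi⟩

lemma zero_mem : (0 : EuclideanSpace ℝ (Fin (D.M + 1))) ∈ D.ifs.attractor := by
  obtain ⟨x, hx⟩ := D.geo.nonempty
  have hn1 : D.r ^ D.n0 < 1 := pow_lt_one₀ D.r0.le D.r1 D.n0_pos.ne'
  have h : ∀ n : ℕ, (D.r ^ D.n0) ^ n • x ∈ D.ifs.attractor := fun n => by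
    induction n with
    | zero => simpa using hx
    | succ n ih =>
      rw [pow_succ', mul_smul]
      exact D.geo.f_image_subset (none : Option (Fin D.M)) ⟨_, ih, rfl⟩
  have ht := (tendsto_pow_atTop_nhds_zero_of_lt_one (pow_pos D.r0 D.n0).le hn1).smul_const x
  rw [zero_smul] at ht
  exact D.geo.isCompact.isClosed.mem_of_tendsto ht (Filter.Eventually.of_forall h)

lemma f_mem (i : Option (Fin D.M)) {x : EuclideanSpace ℝ (Fin (D.M + 1))}
    (hx : x ∈ D.ifs.attractor) : D.ifs.f i x ∈ D.ifs.attractor :=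
  D.geo.f_image_subset i ⟨x, hx, rfl⟩

lemma mem_cone {x : EuclideanSpace ℝ (Fin (D.M + 1))} (hx : x ∈ D.ifs.attractor) (h0 : x ≠ 0) :
    x ∈ D.cone := by
  have hn1 : D.r ^ D.n0 < 1 := pow_lt_one₀ D.r0.le D.r1 D.n0_pos.ne'
  have key : ∀ n : ℕ, ∀ x ∈ D.ifs.attractor, (D.r ^ D.n0) ^ n < ‖x‖ → x ∈ D.cone := fun n => by
    induction n with
    | zero =>
      intro x hx hn
      have := D.norm_le hx
      rw [pow_zero] at hn
      linarith
    | succ n ih =>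
      intro x hx hn
      rcases D.cases_mem hx with ⟨y, hy, rfl⟩ | ⟨j, y, hy, rfl⟩
      · rw [norm_f_none, pow_succ'] at hn
        exact D.oscSet_cone.2.2.2.1 (none : Option (Fin D.M))
          ⟨y, ih y hy (lt_of_mul_lt_mul_left hn (pow_pos D.r0 D.n0).le), rfl⟩
      · exact (D.near_vtx (D.dist_f_some_vtx_le j (D.norm_le hy))).1
  obtain ⟨n, hn⟩ := exists_pow_lt_of_lt_one (norm_pos_iff.2 h0) hn1
  exact key n x hx hn

lemma f_none_ne_f_some {j : Fin D.M} {x y : EuclideanSpace ℝ (Fin (D.M + 1))}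
    (hx : x ∈ D.ifs.attractor) (hy : y ∈ D.ifs.attractor) :
    D.ifs.f none x ≠ D.ifs.f (some j) y := fun h => by
  have h1 := (D.near_vtx (D.dist_f_some_vtx_le j (D.norm_le hy))).2
  have h2 := D.norm_le hx
  have h3 := pow_pos D.r0 D.n0
  have h4 := D.δ0
  rw [← h, norm_f_none] at h1
  nlinarith

lemma cl_eq_of_f_eq {j j' : Fin D.M} {x y : EuclideanSpace ℝ (Fin (D.M + 1))}
    (hx : x ∈ D.ifs.attractor) (hy : y ∈ D.ifs.attractor)
    (h : D.ifs.f (some j) x = D.ifs.f (some j') y) : D.cl j = D.cl j' :=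
  D.cl_eq_of_near (D.dist_f_some_vtx_le j (D.norm_le hx))
    (h ▸ D.dist_f_some_vtx_le j' (D.norm_le hy))

lemma eq_zero_of_f_eq {j j' : Fin D.M} (hj : j ≠ j') {x y : EuclideanSpace ℝ (Fin (D.M + 1))}
    (hx : x ∈ D.ifs.attractor) (hy : y ∈ D.ifs.attractor)
    (h : D.ifs.f (some j) x = D.ifs.f (some j') y) : x = 0 ∧ y = 0 := by
  have hc := D.cl_eq_of_f_eq hx hy h
  have hinj : ∀ j : Fin D.M, Function.Injective (D.ifs.f (some j)) := fun j a b hab => by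
    have := D.ifs.sim (some j) a b
    rw [hab, dist_self, eq_comm, mul_eq_zero] at this
    exact dist_eq_zero.1 (this.resolve_left (D.ifs.r_pos _).ne')
  by_cases hx0 : x = 0
  · subst hx0
    rw [f_some_zero, hc, ← f_some_zero] at h
    exact ⟨rfl, (hinj j' h).symm⟩
  · by_cases hy0 : y = 0
    · subst hy0
      rw [f_some_zero, ← hc, ← f_some_zero] at h
      exact (hx0 (hinj j h)).elim
    · exact (disjoint_left.1 (D.oscSet_cone.2.2.2.2 (some j) (some j')
        fun h => hj (Option.some_injective _ h)) ⟨x, D.mem_cone hx hx0, rfl⟩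
        ⟨y, D.mem_cone hy hy0, h.symm⟩).elim

end ConeData

namespace ConeData

variable (D : ConeData)

/-- A radius at which no point of the attractor lies. -/
def gap : ℝ := D.r ^ D.n0 / 3 + D.δ

lemma gap_pos : 0 < D.gap := by
  have h1 := pow_pos D.r0 D.n0
  have h2 := D.δ0
  unfold gap
  positivity

lemma norm_ne_gap (n : ℕ) : ∀ x ∈ D.ifs.attractor, ‖x‖ ≠ D.gap * (D.r ^ D.n0) ^ n := by
  have hn0 := pow_pos D.r0 D.n0
  have hn1 : D.r ^ D.n0 ≤ 1 := pow_le_one₀ D.r0.le D.r1.le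
  have h2 := D.δ0
  have h3 := D.gap_pos
  have hg : D.gap = D.r ^ D.n0 / 3 + D.δ := rfl
  have hsome : ∀ (n : ℕ) j, ∀ y ∈ D.ifs.attractor,
      ‖D.ifs.f (some j) y‖ ≠ D.gap * (D.r ^ D.n0) ^ n := fun n j y hy h => by
    have h4 := (D.near_vtx (D.dist_f_some_vtx_le j (D.norm_le hy))).2
    have h5 := pow_le_one₀ (n := n) hn0.le hn1
    rw [h] at h4
    nlinarith
  induction n with
  | zero =>
    intro x hx
    rcases D.cases_mem hx with ⟨y, hy, rfl⟩ | ⟨j, y, hy, rfl⟩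
    · rw [norm_f_none, pow_zero, mul_one, hg]
      have := D.norm_le hy
      nlinarith
    · exact hsome 0 j y hy
  | succ n ih =>
    intro x hx
    rcases D.cases_mem hx with ⟨y, hy, rfl⟩ | ⟨j, y, hy, rfl⟩
    · rw [norm_f_none, pow_succ, ← mul_assoc, mul_comm]
      exact fun h => ih y hy (mul_right_cancel₀ hn0.ne' h)
    · exact hsome _ j y hy

lemma f_injective (i : Option (Fin D.M)) : Function.Injective (D.ifs.f i) := fun a b hab => by
  have := D.ifs.sim i a b
  rw [hab, dist_self, eq_comm, mul_eq_zero] at this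
  exact dist_eq_zero.1 (this.resolve_left (D.ifs.r_pos _).ne')

lemma f_continuous (i : Option (Fin D.M)) : Continuous (D.ifs.f i) :=
  (LipschitzWith.of_dist_le_mul (K := ⟨D.ifs.r i, (D.ifs.r_pos i).le⟩) fun x y =>
    (D.ifs.sim i x y).le).continuous

lemma f_some_eq_vtx {j : Fin D.M} {c : D.κ} {x : EuclideanSpace ℝ (Fin (D.M + 1))}
    (hx : x ∈ D.ifs.attractor) (h : D.ifs.f (some j) x = D.vtx c) : D.cl j = c ∧ x = 0 := by
  have hc : D.cl j = c := D.cl_eq_of_near (D.dist_f_some_vtx_le j (D.norm_le hx))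
    (by rw [h, dist_self]; exact D.δ0.le)
  refine ⟨hc, D.f_injective (some j) ?_⟩
  rw [h, f_some_zero, hc]

lemma f_none_ne_vtx {c : D.κ} {x : EuclideanSpace ℝ (Fin (D.M + 1))}
    (hx : x ∈ D.ifs.attractor) : D.ifs.f none x ≠ D.vtx c := fun h => by
  have h1 := (D.near_vtx (c := c) (y := D.vtx c) (by rw [dist_self]; exact D.δ0.le)).2
  have h2 := D.norm_le hx
  have h3 := pow_pos D.r0 D.n0
  have h4 := D.δ0
  rw [← h, norm_f_none] at h1
  nlinarith

lemma isClosed_image (i : Option (Fin D.M)) {A : Set (EuclideanSpace ℝ (Fin (D.M + 1)))}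
    (hA : IsClosed A) : IsClosed (D.ifs.f i '' (D.ifs.attractor ∩ A)) :=
  ((D.geo.isCompact.inter_right hA).image (D.f_continuous i)).isClosed

lemma dist_vtx_le_of_isPreconnected {t : Set (EuclideanSpace ℝ (Fin (D.M + 1)))}
    (ht : t ⊆ D.ifs.attractor) (htc : IsPreconnected t) {c : D.κ} (hc : D.vtx c ∈ t) (n : ℕ) :
    ∀ x ∈ t, dist x (D.vtx c) ≤ D.gap * (D.r ^ D.n0) ^ n := by
  obtain ⟨ρ, hρ⟩ : ∃ ρ, ρ = D.gap * (D.r ^ D.n0) ^ n := ⟨_, rfl⟩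
  have hρ0 : 0 < ρ := hρ ▸ mul_pos D.gap_pos (pow_pos (pow_pos D.r0 _) _)
  have hρn : ∀ x ∈ D.ifs.attractor, ‖x‖ ≠ ρ := hρ ▸ D.norm_ne_gap n
  rw [← hρ]
  have h1 := isPreconnected_iff_subset_of_disjoint_closed.1 htc
    (⋃ j : Fin D.M, D.ifs.f (some j) '' (D.ifs.attractor ∩ {x | ‖x‖ ≤ ρ ∧ D.cl j = c}))
    (D.ifs.f none '' (D.ifs.attractor ∩ univ) ∪
      ⋃ j : Fin D.M, D.ifs.f (some j) '' (D.ifs.attractor ∩ {x | ρ ≤ ‖x‖ ∨ D.cl j ≠ c}))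
    (isClosed_iUnion_of_finite fun j => D.isClosed_image _
      ((isClosed_le continuous_norm continuous_const).and isClosed_const))
    ((D.isClosed_image _ isClosed_univ).union (isClosed_iUnion_of_finite fun j =>
      D.isClosed_image _ ((isClosed_le continuous_const continuous_norm).union isClosed_const)))
    (fun x hx => by
      rcases D.cases_mem (ht hx) with ⟨y, hy, rfl⟩ | ⟨j, y, hy, rfl⟩
      · exact .inr (.inl ⟨y, ⟨hy, trivial⟩, rfl⟩)
      · by_cases hj : D.cl j = c
        · rcases le_total ‖y‖ ρ with h | h
          · exact .inl (mem_iUnion.2 ⟨j, y, ⟨hy, h, hj⟩, rfl⟩)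
          · exact .inr (.inr (mem_iUnion.2 ⟨j, y, ⟨hy, .inl h⟩, rfl⟩))
        · exact .inr (.inr (mem_iUnion.2 ⟨j, y, ⟨hy, .inr hj⟩, rfl⟩)))
    (by
      rw [eq_empty_iff_forall_notMem]
      rintro x ⟨-, hx1, hx2⟩
      obtain ⟨j, a, ⟨ha, han, haj⟩, rfl⟩ := mem_iUnion.1 hx1
      rcases hx2 with ⟨b, ⟨hb, -⟩, hba⟩ | hx2
      · exact D.f_none_ne_f_some hb ha hba
      · obtain ⟨j', b, ⟨hb, hb'⟩, hba⟩ := mem_iUnion.1 hx2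
        have hcl := D.cl_eq_of_f_eq hb ha hba
        have hb'' := hb'.resolve_right fun h => h (hcl.trans haj)
        by_cases hjj : j' = j
        · subst hjj
          rw [D.f_injective _ hba] at hb''
          exact hρn a ha (le_antisymm han hb'')
        · have := (D.eq_zero_of_f_eq hjj hb ha hba).1
          rw [this, norm_zero] at hb''
          exact hρ0.not_ge hb'')
  rcases h1 with h1 | h1
  · intro x hx
    obtain ⟨j, a, ⟨ha, han, haj⟩, rfl⟩ := mem_iUnion.1 (h1 hx)
    rw [← haj, dist_f_some_vtx]
    have := pow_le_one₀ (n := D.e j) D.r0.le D.r1.le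
    have h0 := pow_pos D.r0 (D.e j)
    have hn : ‖a‖ ≤ ρ := han
    nlinarith [norm_nonneg a]
  · exfalso
    rcases h1 hc with ⟨b, ⟨hb, -⟩, hbc⟩ | h2
    · exact D.f_none_ne_vtx hb hbc
    · obtain ⟨j, b, ⟨hb, hb'⟩, hbc⟩ := mem_iUnion.1 h2
      obtain ⟨h3, h4⟩ := D.f_some_eq_vtx hb hbc
      have hb'' := hb'.resolve_right fun h => h h3
      rw [h4, norm_zero] at hb''
      exact hρ0.not_ge hb''

lemma eq_vtx_of_isPreconnected {t : Set (EuclideanSpace ℝ (Fin (D.M + 1)))}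
    (ht : t ⊆ D.ifs.attractor) (htc : IsPreconnected t) {c : D.κ} (hc : D.vtx c ∈ t) :
    ∀ x ∈ t, x = D.vtx c := fun x hx => by
  have hn1 : D.r ^ D.n0 < 1 := pow_lt_one₀ D.r0.le D.r1 D.n0_pos.ne'
  have h := (tendsto_pow_atTop_nhds_zero_of_lt_one (pow_pos D.r0 D.n0).le hn1).const_mul D.gap
  rw [mul_zero] at h
  exact dist_le_zero.1 (ge_of_tendsto' h fun n =>
    D.dist_vtx_le_of_isPreconnected ht htc hc n x hx)

lemma subsingleton_or_image {t : Set (EuclideanSpace ℝ (Fin (D.M + 1)))}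
    (ht : t ⊆ D.ifs.attractor) (htc : IsPreconnected t) :
    t.Subsingleton ∨ ∃ i, ∃ t' ⊆ D.ifs.attractor, IsPreconnected t' ∧ t = D.ifs.f i '' t' := by
  by_cases hv : ∃ c, D.vtx c ∈ t
  · obtain ⟨c, hc⟩ := hv
    have h := D.eq_vtx_of_isPreconnected ht htc hc
    exact .inl fun x hx y hy => (h x hx).trans (h y hy).symm
  rcases t.eq_empty_or_nonempty with rfl | ⟨x, hx⟩
  · exact .inl subsingleton_empty
  have hmem : ∀ x ∈ t, ∃ i : Option (Fin D.M), x ∈ D.ifs.f i '' (D.ifs.attractor ∩ univ) :=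
    fun x hx => by
      rcases D.cases_mem (ht hx) with ⟨y, hy, rfl⟩ | ⟨j, y, hy, rfl⟩
      · exact ⟨none, y, ⟨hy, trivial⟩, rfl⟩
      · exact ⟨some j, y, ⟨hy, trivial⟩, rfl⟩
  obtain ⟨i, hi⟩ := hmem x hx
  have hdis : ∀ i i' : Option (Fin D.M), i ≠ i' → ∀ a ∈ D.ifs.attractor, ∀ b ∈ D.ifs.attractor,
      D.ifs.f i a ∈ t → D.ifs.f i a ≠ D.ifs.f i' b := by
    intro i i' hii a ha b hb hat hab
    cases i with
    | none =>
      cases i' with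
      | none => exact hii rfl
      | some j => exact D.f_none_ne_f_some ha hb hab
    | some j =>
      cases i' with
      | none => exact D.f_none_ne_f_some hb ha hab.symm
      | some j' =>
        have h0 := (D.eq_zero_of_f_eq (fun h => hii (congrArg some h)) ha hb hab).1
        rw [h0, f_some_zero] at hat
        exact hv ⟨_, hat⟩
  have h1 := isPreconnected_iff_subset_of_disjoint_closed.1 htc
    (D.ifs.f i '' (D.ifs.attractor ∩ univ))
    (⋃ k : Option (Fin D.M), D.ifs.f k '' (D.ifs.attractor ∩ {_x | i ≠ k}))
    (D.isClosed_image i isClosed_univ)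
    (isClosed_iUnion_of_finite fun i' => D.isClosed_image i' isClosed_const)
    (fun y hy => by
      obtain ⟨i', z, hz, rfl⟩ := hmem y hy
      by_cases hii : i = i'
      · subst hii; exact .inl ⟨z, hz, rfl⟩
      · exact .inr (mem_iUnion.2 ⟨i', z, ⟨hz.1, hii⟩, rfl⟩))
    (by
      rw [eq_empty_iff_forall_notMem]
      rintro y ⟨hyt, ⟨a, ⟨ha, -⟩, rfl⟩, hy2⟩
      obtain ⟨i', b, ⟨hb, hii⟩, hba⟩ := mem_iUnion.1 hy2
      exact hdis i i' hii a ha b hb hyt hba.symm)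
  have h2 : t ⊆ D.ifs.f i '' (D.ifs.attractor ∩ univ) := by
    refine h1.resolve_right fun h => ?_
    obtain ⟨a, ⟨ha, -⟩, rfl⟩ := hi
    obtain ⟨i', b, ⟨hb, hii⟩, hba⟩ := mem_iUnion.1 (h hx)
    exact hdis i i' hii a ha b hb hx hba.symm
  have h3 : D.ifs.f i '' (D.ifs.attractor ∩ D.ifs.f i ⁻¹' t) = t := by
    rw [image_inter_preimage]
    exact inter_eq_right.2 (by simpa using h2)
  refine .inr ⟨i, _, inter_subset_left, ?_, h3.symm⟩
  have hind : Topology.IsInducing (D.ifs.f i) := by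
    have hpos := D.ifs.r_pos i
    refine (AntilipschitzWith.of_le_mul_dist (K := ⟨(D.ifs.r i)⁻¹, (inv_pos.2 hpos).le⟩)
      fun x y => ?_).isUniformInducing (LipschitzWith.of_dist_le_mul
        (K := ⟨D.ifs.r i, hpos.le⟩) fun x y => (D.ifs.sim i x y).le).uniformContinuous
        |>.isInducing
    exact (inv_mul_cancel_left₀ hpos.ne' (dist x y)).ge.trans_eq
      (congrArg (fun z => (D.ifs.r i)⁻¹ * z) (D.ifs.sim i x y).symm)
  rw [← hind.isPreconnected_image, h3]
  exact htc

lemma isTotallyDisconnected : IsTotallyDisconnected D.ifs.attractor := by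
  have key : ∀ n : ℕ, ∀ t ⊆ D.ifs.attractor, IsPreconnected t → ∀ x ∈ t, ∀ y ∈ t,
      dist x y ≤ D.r ^ n := fun n => by
    induction n with
    | zero =>
      intro t ht _ x hx y hy
      have h1 := D.norm_le (ht hx)
      have h2 := D.norm_le (ht hy)
      have h3 := dist_le_norm_add_norm x y
      rw [pow_zero]
      linarith
    | succ n ih =>
      intro t ht htc x hx y hy
      rcases D.subsingleton_or_image ht htc with h | ⟨i, t', ht', htc', rfl⟩
      · rw [h hx hy, dist_self]; exact pow_nonneg D.r0.le _
      · obtain ⟨a, ha, rfl⟩ := hx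
        obtain ⟨b, hb, rfl⟩ := hy
        rw [pow_succ']
        refine (D.ifs.sim i a b).trans_le ?_
        have h1 : D.ifs.r i ≤ D.r := by
          have : D.r ^ D.lam i ≤ D.r ^ 1 := pow_le_pow_of_le_one D.r0.le D.r1.le (D.lam_pos i)
          rwa [pow_one] at this
        exact mul_le_mul h1 (ih t' ht' htc' a ha b hb) dist_nonneg D.r0.le
  intro t ht htc x hx y hy
  exact dist_le_zero.1 (ge_of_tendsto' (tendsto_pow_atTop_nhds_zero_of_lt_one D.r0.le D.r1)
    fun n => key n t ht htc x hx y hy)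

end ConeData

lemma IFS.Nice.memTOECpr {d : ℕ} {S : IFS d} {lam : S.ι → ℕ} {p r : ℝ} (h : S.Nice lam p r) :
    S.MemTOECpr p r := by
  have h1 : S.IsRatioRoot r := ⟨h.r0, h.r1, lam, h.hl, h.hr, h.gcd⟩
  exact ⟨⟨h.osc, ⟨r, h1⟩, h.td⟩, h1, h.hpr⟩

namespace ConeData

variable (D : ConeData) {p : ℝ}

lemma nice {s : ℝ} (hs : 0 < s) (hp : p = D.r ^ s) (hsum : p ^ D.n0 + ∑ j, p ^ D.e j = 1)
    (hgcd : Finset.univ.gcd D.e = 1) : D.ifs.Nice D.lam p D.r := by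
  have hlam : ∑ i : Option (Fin D.M), p ^ D.lam i = 1 := by
    rw [Fintype.sum_option]; exact hsum
  have h1 : D.ifs.hdim = s := D.geo.hdim_eq hs (hp ▸ hlam)
  rw [hp, ← h1]
  refine D.geo.nice ?_ D.isTotallyDisconnected ?_
  · exact Nat.dvd_one.1 ((Finset.dvd_gcd fun j _ =>
      Finset.gcd_dvd (f := D.lam) (Finset.mem_univ (some j))).trans hgcd.dvd)
  · change 1 < Fintype.card (Option (Fin D.M))
    rw [Fintype.card_option, Fintype.card_fin]
    rcases Nat.eq_zero_or_pos D.M with h0 | h0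
    · have : IsEmpty (Fin D.M) := by rw [h0]; infer_instance
      rw [Finset.univ_eq_empty, Finset.gcd_empty] at hgcd
      exact absurd hgcd (by norm_num)
    · omega

open scoped Classical in
/-- The total weight of a cluster. -/
def weight (p : ℝ) (c : D.κ) : ℝ := ∑ j with D.cl j = c, p ^ D.e j

lemma weight_mem (c : D.κ) : D.weight p c ∈ Zring p :=
  sum_mem fun _ _ => pow_mem (Zring.self_mem p) _

/-- The ideal generated by the weights of the clusters. -/
def weightIdeal (p : ℝ) : Ideal (Zring p) := Ideal.span {x | ∃ c, (x : ℝ) = D.weight p c}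

lemma weight_mem_idealSet (c : D.κ) : D.weight p c ∈ idealSet (D.weightIdeal p) :=
  ⟨⟨_, D.weight_mem c⟩, Ideal.subset_span ⟨c, rfl⟩, rfl⟩

lemma zero_notMem_of_isIntSep {j j' : Fin D.M} (hj : j ≠ j') (hc : D.cl j = D.cl j')
    {F : Set (EuclideanSpace ℝ (Fin (D.M + 1)))} (hF : D.ifs.IsIntSep F) :
    (0 : EuclideanSpace ℝ (Fin (D.M + 1))) ∉ F := fun h0 => by
  obtain ⟨-, -, -, O, hO, hFO⟩ := hF
  refine disjoint_left.1 (hO.2.2.2.2 (some j) (some j') fun h => hj (Option.some_injective _ h))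
    ⟨0, hFO h0, rfl⟩ ⟨0, hFO h0, ?_⟩
  rw [f_some_zero, f_some_zero, hc]

lemma natMeasure_mem (h : D.ifs.Nice D.lam p D.r) (k : ℕ) :
    ∀ F, KSet D.ifs.attractor D.r k F → (0 : EuclideanSpace ℝ (Fin (D.M + 1))) ∉ F →
      D.ifs.natMeasure F ∈ idealGrp (D.weightIdeal p) := by
  classical
  induction k with
  | zero =>
    intro F hF h0
    have : F = ∅ := eq_empty_of_forall_notMem fun x hx => by
      have h1 := hF.2 x hx 0 D.zero_mem h0
      rw [pow_zero, dist_zero_right] at h1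
      linarith [D.norm_le (hF.1 hx)]
    rw [this, IFS.natMeasure_empty]
    exact (idealGrp _).zero_mem
  | succ k ih =>
    intro F hF h0
    have hmul : ∀ n : ℕ, ∀ x ∈ idealGrp (D.weightIdeal p),
        p ^ n * x ∈ idealGrp (D.weightIdeal p) := fun n x hx =>
      mul_mem_idealSet (pow_mem (Zring.self_mem p) n) hx
    have hk : ∀ i : Option (Fin D.M), KSet D.ifs.attractor D.r k
      (D.ifs.attractor ∩ D.ifs.f i ⁻¹' F) := fun i => D.geo.kset_preimage hF i
    rw [h.m_eq_sum_preimage hF]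
    change ∑ i : Option (Fin D.M), _ ∈ _
    rw [Fintype.sum_option]
    refine add_mem (hmul _ _ (ih _ (hk none) fun hz => h0 ?_)) ?_
    · have := hz.2
      rwa [mem_preimage, f_none_zero] at this
    rw [← Finset.sum_fiberwise_of_maps_to (t := Finset.univ.image D.cl)
      fun j hj => Finset.mem_image_of_mem D.cl hj]
    refine sum_mem fun c _ => ?_
    by_cases hc : D.vtx c ∈ F
    · have h1 : ∀ j : Fin D.M, D.ifs.natMeasure (D.ifs.attractor ∩ D.ifs.f (some j) ⁻¹' F) =
          1 - D.ifs.natMeasure (D.ifs.attractor \ (D.ifs.attractor ∩ D.ifs.f (some j) ⁻¹' F)) :=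
        fun j => by
          rw [h.m_diff_kset (KSet.self (k := k)) (hk (some j)) inter_subset_left, h.m_attractor]
          ring
      have h2 : ∑ j with D.cl j = c, p ^ D.lam (some j) *
          D.ifs.natMeasure (D.ifs.attractor ∩ D.ifs.f (some j) ⁻¹' F) = D.weight p c -
          ∑ j with D.cl j = c, p ^ D.lam (some j) *
          D.ifs.natMeasure (D.ifs.attractor \ (D.ifs.attractor ∩ D.ifs.f (some j) ⁻¹' F)) := by
        rw [weight, ← Finset.sum_sub_distrib]
        refine Finset.sum_congr rfl fun j _ => ?_
        rw [h1 j, mul_sub, mul_one]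
        rfl
      rw [h2]
      refine sub_mem (D.weight_mem_idealSet c) (sum_mem fun j hj => hmul _ _ (ih _ ?_ ?_))
      · exact (KSet.self (k := k)).diff (hk (some j))
      · rintro ⟨-, hz⟩
        refine hz ⟨D.zero_mem, ?_⟩
        rw [mem_preimage, f_some_zero, (Finset.mem_filter.1 hj).2]
        exact hc
    · refine sum_mem fun j hj => hmul _ _ (ih _ (hk (some j)) fun hz => hc ?_)
      have := hz.2
      rwa [mem_preimage, f_some_zero, (Finset.mem_filter.1 hj).2] at this

lemma exists_isIntSep_weight (h : D.ifs.Nice D.lam p D.r) (c : D.κ) :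
    ∃ F, D.ifs.IsIntSep F ∧ D.weight p c = D.ifs.natMeasure F := by
  classical
  obtain ⟨F, hF⟩ : ∃ F, F = ⋃ j : Fin D.M, D.ifs.f (some j) '' {x | x ∈ D.ifs.attractor ∧
    D.cl j = c} := ⟨_, rfl⟩
  have hmem : ∀ x, x ∈ F ↔ ∃ j, D.cl j = c ∧ ∃ y ∈ D.ifs.attractor, D.ifs.f (some j) y = x := by
    intro x
    rw [hF, mem_iUnion]
    exact exists_congr fun j => ⟨fun ⟨y, hy, hyx⟩ => ⟨hy.2, y, hy.1, hyx⟩,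
      fun ⟨hj, y, hy, hyx⟩ => ⟨y, ⟨hy, hj⟩, hyx⟩⟩
  have hcomp : ∀ (i : Option (Fin D.M)) (P : Prop),
      IsCompact (D.ifs.f i '' {x | x ∈ D.ifs.attractor ∧ P}) := fun i P =>
    (D.geo.isCompact.inter_right (isClosed_const (p := P))).image (D.f_continuous i)
  have hFE : F ⊆ D.ifs.attractor := fun x hx => by
    obtain ⟨j, -, y, hy, rfl⟩ := (hmem x).1 hx
    exact D.f_mem _ hy
  have hFc : IsCompact F := hF ▸ isCompact_iUnion fun j => hcomp _ _
  have hdiff : D.ifs.attractor \ F = D.ifs.f none '' {x | x ∈ D.ifs.attractor ∧ True} ∪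
      ⋃ j : Fin D.M, D.ifs.f (some j) '' {x | x ∈ D.ifs.attractor ∧ D.cl j ≠ c} := by
    ext x
    constructor
    · rintro ⟨hx, hxF⟩
      rcases D.cases_mem hx with ⟨y, hy, rfl⟩ | ⟨j, y, hy, rfl⟩
      · exact .inl ⟨y, ⟨hy, trivial⟩, rfl⟩
      · exact .inr (mem_iUnion.2 ⟨j, y, ⟨hy, fun hj => hxF ((hmem _).2 ⟨j, hj, y, hy, rfl⟩)⟩, rfl⟩)
    · rintro (⟨y, hy, rfl⟩ | hx)
      · refine ⟨D.f_mem _ hy.1, fun hyF => ?_⟩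
        obtain ⟨j, -, z, hz, hzy⟩ := (hmem _).1 hyF
        exact D.f_none_ne_f_some hy.1 hz hzy.symm
      · obtain ⟨j, y, ⟨hy, hj⟩, rfl⟩ := mem_iUnion.1 hx
        refine ⟨D.f_mem _ hy, fun hyF => hj ?_⟩
        obtain ⟨j', hj', z, hz, hzy⟩ := (hmem _).1 hyF
        rw [← hj', D.cl_eq_of_f_eq hz hy hzy]
  have hFd : IsCompact (D.ifs.attractor \ F) :=
    hdiff ▸ (hcomp _ _).union (isCompact_iUnion fun j => hcomp _ _)
  refine ⟨F, ⟨hFc, hFE, hFd, D.cone, D.oscSet_cone, fun x hx => ?_⟩, ?_⟩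
  · obtain ⟨j, -, y, hy, rfl⟩ := (hmem x).1 hx
    exact (D.near_vtx (D.dist_f_some_vtx_le j (D.norm_le hy))).1
  obtain ⟨k, hk⟩ := exists_kset D.r1 hFE hFc hFd
  rw [h.m_eq_sum_preimage hk]
  change _ = ∑ i : Option (Fin D.M), _
  rw [Fintype.sum_option]
  have h1 : D.ifs.attractor ∩ D.ifs.f (none : Option (Fin D.M)) ⁻¹' F = ∅ := by
    refine eq_empty_of_forall_notMem fun y hy => ?_
    obtain ⟨j, -, z, hz, hzy⟩ := (hmem _).1 hy.2
    exact D.f_none_ne_f_some hy.1 hz hzy.symm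
  rw [h1, IFS.natMeasure_empty, mul_zero, zero_add, weight, Finset.sum_filter]
  refine Finset.sum_congr rfl fun j _ => ?_
  split_ifs with hj
  · have h2 : D.ifs.attractor ∩ D.ifs.f (some j) ⁻¹' F = D.ifs.attractor :=
      inter_eq_left.2 fun y hy => (hmem _).2 ⟨j, hj, y, hy, rfl⟩
    rw [h2, h.m_attractor, mul_one]
    rfl
  · have h2 : D.ifs.attractor ∩ D.ifs.f (some j) ⁻¹' F = ∅ := by
      refine eq_empty_of_forall_notMem fun y hy => ?_
      obtain ⟨j', hj', z, hz, hzy⟩ := (hmem _).1 hy.2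
      exact hj (by rw [← hj', D.cl_eq_of_f_eq hz hy.1 hzy])
    rw [h2, IFS.natMeasure_empty, mul_zero]

/-- The ideal of the iterated function system of the cone data. -/
lemma idealOf_eq (h : D.ifs.Nice D.lam p D.r) {j j' : Fin D.M} (hj : j ≠ j')
    (hc : D.cl j = D.cl j') : D.ifs.idealOf p = D.weightIdeal p := by
  refine le_antisymm (Ideal.span_le.2 ?_) (Ideal.span_mono ?_)
  · rintro x ⟨F, hF, hx⟩
    obtain ⟨k, hk⟩ := exists_kset D.r1 hF.2.1 hF.1 hF.2.2.1
    obtain ⟨y, hy, hyx⟩ := D.natMeasure_mem h k F hk (D.zero_notMem_of_isIntSep hj hc hF)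
    rw [← hx] at hyx
    rwa [← Subtype.ext hyx]
  · rintro x ⟨c, hx⟩
    obtain ⟨F, hF, hcF⟩ := D.exists_isIntSep_weight h c
    exact ⟨F, hF, hx.trans hcF⟩

end ConeData

lemma exists_separated_points (κ : Type*) [Finite κ] {a b : ℝ} (hab : a < b) :
    ∃ (t : κ → ℝ) (δ : ℝ), 0 < δ ∧ (∀ c, a + 3 * δ ≤ t c) ∧ (∀ c, t c ≤ b - 3 * δ) ∧
      ∀ c c', c ≠ c' → 3 * δ ≤ |t c - t c'| := by
  obtain ⟨N, ⟨f⟩⟩ := Finite.exists_equiv_fin κ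
  obtain ⟨η, hη⟩ : ∃ η, η = (b - a) / (N + 1) := ⟨_, rfl⟩
  have hN : (0 : ℝ) < N + 1 := by positivity
  have hη0 : 0 < η := hη ▸ div_pos (sub_pos.2 hab) hN
  have hba : b = a + η * (N + 1) := by rw [hη]; field_simp; ring
  have h3 : 3 * (η / 3) = η := by ring
  refine ⟨fun c => a + η * ((f c : ℕ) + 1), η / 3, by positivity, fun c => ?_, fun c => ?_,
    fun c c' hc => ?_⟩
  · rw [h3]
    have : (0 : ℝ) ≤ (f c : ℕ) := Nat.cast_nonneg _
    nlinarith
  · rw [h3, hba]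
    have : ((f c : ℕ) : ℝ) + 1 ≤ N := by exact_mod_cast (f c).2
    nlinarith
  · have h1 : (f c : ℕ) ≠ f c' := fun h => hc (f.injective (Fin.ext h))
    have h2 : (1 : ℝ) ≤ |((f c : ℕ) : ℝ) - (f c' : ℕ)| := by
      have : (1 : ℤ) ≤ |((f c : ℕ) : ℤ) - (f c' : ℕ)| :=
        Int.one_le_abs (sub_ne_zero.2 (by exact_mod_cast h1))
      exact_mod_cast this
    rw [h3, show a + η * ((f c : ℕ) + 1) - (a + η * ((f c' : ℕ) + 1)) =
      η * (((f c : ℕ) : ℝ) - (f c' : ℕ)) by ring, abs_mul, abs_of_pos hη0]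
    nlinarith

open scoped Classical in
lemma exists_exponents {ι κ : Type} [Fintype ι] [Fintype κ] {lam : ι → ℕ} {p : ℝ} (hp0 : 0 < p)
    (hp1 : p < 1) (hl : ∀ i, 0 < lam i) (hsum : ∑ i, p ^ lam i = 1)
    (hgcd : Finset.univ.gcd lam = 1) (c0 : κ) (X : κ → ℝ) (hX : ∀ c, X c ∈ Zring p)
    (hX0 : ∀ c, 0 < X c) (hX1 : ∑ c, X c < 1) (n : ℕ) :
    ∃ (M : ℕ) (cl : Fin M → κ) (e : Fin M → ℕ), (∀ j, n ≤ e j) ∧ Finset.univ.gcd e = 1 ∧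
      (∀ c, ∑ j with cl j = c, p ^ e j = X c) ∧ ∃ j j', j ≠ j' ∧ cl j = cl j' := by
  obtain ⟨i0⟩ : Nonempty ι := by
    by_contra hι
    rw [not_nonempty_iff] at hι
    simp at hsum
  obtain ⟨n2, hn2⟩ := exists_pow_lt_of_lt_one (half_pos (hX0 c0)) hp1
  obtain ⟨n1, hn1⟩ : ∃ n1, n1 = max n n2 := ⟨_, rfl⟩
  have hn1n : n ≤ n1 := hn1 ▸ le_max_left _ _
  have hpn : p ^ n1 < X c0 / 2 :=
    (pow_le_pow_of_le_one hp0.le hp1.le (hn1 ▸ le_max_right _ _)).trans_lt hn2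
  have hpn0 : 0 < p ^ n1 := pow_pos hp0 _
  have hpZ : p ^ n1 ∈ Zring p := pow_mem (Zring.self_mem p) _
  obtain ⟨q, hq⟩ : ∃ q : κ → ℝ, q = fun c => X c - if c = c0 then 2 * p ^ n1 else 0 := ⟨_, rfl⟩
  have hqZ : ∀ c, q c ∈ Zring p := fun c => by
    rw [hq]
    refine sub_mem (hX c) ?_
    split_ifs
    · rw [two_mul]; exact add_mem hpZ hpZ
    · exact zero_mem _
  have hq0 : ∀ c, 0 < q c := fun c => by
    rw [hq]
    by_cases hc : c = c0
    · simp only [hc, if_true]; linarith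
    · simpa only [hc, if_false, sub_zero] using hX0 c
  have hq1 : ∑ c, q c < 1 := by
    refine lt_of_le_of_lt (Finset.sum_le_sum fun c _ => ?_) hX1
    rw [hq]
    simp only
    split_ifs <;> linarith
  obtain ⟨N, hN⟩ := exists_words hp0 hp1 hl hsum hgcd Finset.univ q (fun c _ => hqZ c)
    (fun c _ => hq0 c) hq1
  obtain ⟨U, hU, -, hUq⟩ := hN (max N n) (le_max_left _ _)
  let J := (Σ c, {u // u ∈ U c}) ⊕ Option ι
  let cl : J → κ := Sum.elim (fun x => x.1) fun _ => c0
  let e : J → ℕ := Sum.elim (fun x => wt lam x.2.1) fun o => n1 + o.elim 0 lam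
  let f : Fin (Fintype.card J) ≃ J := (Fintype.equivFin J).symm
  refine ⟨Fintype.card J, cl ∘ f, e ∘ f, fun j => ?_, ?_, fun c => ?_, f.symm (.inr none),
    f.symm (.inr (some i0)), fun h => ?_, by simp [cl]⟩
  · change n ≤ e (f j)
    rcases f j with x | o
    · exact (le_max_right N n).trans (le_wt_of_mem_cut hl (hU x.1 (Finset.mem_univ _) x.2.2))
    · exact hn1n.trans (Nat.le_add_right _ _)
  · have hdvd : ∀ x, Finset.univ.gcd (e ∘ f) ∣ e x := fun x => by
      have := Finset.gcd_dvd (f := e ∘ f) (Finset.mem_univ (f.symm x))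
      rwa [Function.comp_apply, Equiv.apply_symm_apply] at this
    refine Nat.dvd_one.1 ((Finset.dvd_gcd fun i _ => ?_).trans hgcd.dvd)
    exact (Nat.dvd_add_right (hdvd (.inr none))).1 (hdvd (.inr (some i)))
  · rw [Finset.sum_filter]
    refine (Equiv.sum_comp f fun x => if cl x = c then p ^ e x else 0).trans ?_
    rw [Fintype.sum_sum_type, Fintype.sum_sigma, Fintype.sum_option]
    have h1 : ∀ c', ∑ u : {u // u ∈ U c'}, (if c' = c then p ^ wt lam u.1 else 0) =
        if c' = c then q c' else 0 := fun c' => by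
      split_ifs with h
      · rw [← hUq c' (Finset.mem_univ _)]
        exact Finset.sum_coe_sort (U c') fun u => p ^ wt lam u
      · simp
    have h2 : ∑ c', ∑ u : {u // u ∈ U c'}, (if cl (.inl ⟨c', u⟩) = c then
        p ^ e (.inl ⟨c', u⟩) else 0) = q c := by
      refine (Finset.sum_congr rfl fun c' _ => h1 c').trans ?_
      simp
    rw [h2]
    have h3 : ∑ i, p ^ (n1 + lam i) = p ^ n1 := by
      simp_rw [pow_add]
      rw [← Finset.mul_sum, hsum, mul_one]
    by_cases hc : c = c0
    · have h4 : ∀ o, cl (.inr o) = c := fun o => hc.symm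
      simp only [h4, if_true]
      change q c + (p ^ (n1 + 0) + ∑ i, p ^ (n1 + lam i)) = X c
      rw [h3, hq]
      simp only [hc, if_true]
      ring
    · have h4 : ∀ o, ¬ cl (.inr o) = c := fun o h => hc h.symm
      simp only [h4, if_false]
      rw [hq]
      simp [hc]
  · exact Option.some_ne_none i0 (Sum.inr.inj (f.symm.injective h)).symm

section OrderOfFiniteType

variable {A : Type*} [CommRing A] [IsDomain A] [Module.Finite ℤ A] [Module.Free ℤ A]

lemma exists_common_multiplier : ∃ m : A, m ≠ 0 ∧ ∀ I : Ideal A, I ≠ ⊥ →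
    ∃ b ∈ I, b ≠ 0 ∧ ∀ a ∈ I, b ∣ m * a := by
  classical
  let bS := Module.Free.chooseBasis ℤ A
  have hint : Algebra.IsIntegral ℤ A := Algebra.IsIntegral.of_finite ℤ A
  have hinj : Function.Injective (algebraMap ℤ A) := bS.algebraMap_injective
  have halg : Algebra.IsAlgebraic ℤ A := inferInstance
  let adm := AbsoluteValue.absIsAdmissible
  refine ⟨_, ClassGroup.prod_finsetApprox_ne_zero bS adm, fun I hI => ?_⟩
  obtain ⟨b, hb, hb0, hmin⟩ := ClassGroup.exists_min (R := ℤ) AbsoluteValue.abs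
    ⟨I, mem_nonZeroDivisors_of_ne_zero hI⟩
  refine ⟨b, hb, hb0, fun a ha => ?_⟩
  obtain ⟨q, s, hs, hlt⟩ := ClassGroup.exists_mem_finset_approx' bS adm a hb0
  have h0 := hmin (s • a - q * b) (sub_mem (by rw [zsmul_eq_mul]; exact I.mul_mem_left _ ha)
    (I.mul_mem_left _ hb)) hlt
  have h1 : b ∣ algebraMap ℤ A s * a := by
    rw [← Algebra.smul_def, sub_eq_zero.1 h0]
    exact dvd_mul_left _ _
  exact h1.trans (mul_dvd_mul_right (map_dvd _ (Finset.dvd_prod_of_mem _ hs)) a)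

lemma finite_ideal_mem {m : A} (hm : m ≠ 0) : Finite {J : Ideal A // m ∈ J} := by
  have hfin : Finite (A ⧸ Ideal.span {m}) := Ideal.finiteQuotientOfFreeOfNeBot _ (by
    rwa [Ne, Ideal.span_singleton_eq_bot])
  refine Finite.of_injective (fun J : {J : Ideal A // m ∈ J} =>
    (Ideal.Quotient.mk (Ideal.span {m}) '' (J.1 : Set A) : Set (A ⧸ Ideal.span {m}))) ?_
  have key : ∀ J J' : {J : Ideal A // m ∈ J}, Ideal.Quotient.mk (Ideal.span {m}) '' (J.1 : Set A) =
      Ideal.Quotient.mk (Ideal.span {m}) '' (J'.1 : Set A) → J.1 ≤ J'.1 := fun J J' h x hx => by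
    obtain ⟨y, hy, hyx⟩ : Ideal.Quotient.mk (Ideal.span {m}) x ∈
      Ideal.Quotient.mk (Ideal.span {m}) '' (J'.1 : Set A) := h ▸ ⟨x, hx, rfl⟩
    obtain ⟨c, hc⟩ := Ideal.mem_span_singleton.1 (Ideal.Quotient.eq.1 hyx)
    rw [show x = y - m * c by rw [← hc]; ring]
    exact sub_mem hy (J'.1.mul_mem_right _ J'.2)
  exact fun J J' h => Subtype.ext (le_antisymm (key J J' h) (key J' J h.symm))

end OrderOfFiniteType

section Zring

variable {p : ℝ}

lemma isIntegral_inv_of_mem_Zring (hp : p ≠ 0) (h : p⁻¹ ∈ Zring p) : IsIntegral ℤ p⁻¹ := by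
  obtain ⟨P, hP⟩ := Zring.exists_aeval h
  have hinv : Invertible p := invertibleOfNonzero hp
  have h1 := Polynomial.eval₂_reverse_mul_pow (algebraMap ℤ ℝ) p P
  rw [invOf_eq_inv, ← Polynomial.aeval_def p P, hP] at h1
  refine ⟨Polynomial.X ^ (P.natDegree + 1) - P.reverse, Polynomial.monic_X_pow_sub ?_, ?_⟩
  · exact (Polynomial.degree_le_natDegree).trans_lt
      (by exact_mod_cast Nat.lt_succ_of_le P.reverse_natDegree_le)
  · rw [Polynomial.eval₂_sub, Polynomial.eval₂_X_pow, sub_eq_zero, pow_succ']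
    nth_rewrite 1 [← h1]
    rw [inv_pow, mul_assoc, mul_inv_cancel₀ (pow_ne_zero _ hp), mul_one]

/-- The ring `ℤ[p⁻¹]`. -/
def invRing (p : ℝ) : Subalgebra ℤ ℝ := Algebra.adjoin ℤ {p⁻¹}

lemma inv_mem_invRing : p⁻¹ ∈ invRing p := Algebra.subset_adjoin rfl

lemma invRing_finite (hp : p ≠ 0) (h : p⁻¹ ∈ Zring p) : Module.Finite ℤ (invRing p) :=
  Module.Finite.iff_fg.2 (isIntegral_inv_of_mem_Zring hp h).fg_adjoin_singleton

lemma mem_Zring_of_mem_invRing (h : p⁻¹ ∈ Zring p) {x : ℝ} (hx : x ∈ invRing p) :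
    x ∈ Zring p := by
  have : invRing p ≤ subalgebraOfSubring (Zring p) := Algebra.adjoin_le (by simpa using h)
  exact this hx

lemma exists_mul_inv_pow_mem (hp : p ≠ 0) {z : ℝ} (hz : z ∈ Zring p) :
    ∃ n : ℕ, z * p⁻¹ ^ n ∈ invRing p := by
  obtain ⟨P, rfl⟩ := Zring.exists_aeval hz
  refine ⟨P.natDegree, ?_⟩
  rw [Polynomial.aeval_eq_sum_range, Finset.sum_mul]
  refine sum_mem fun i hi => ?_
  have hi : i ≤ P.natDegree := Nat.lt_succ_iff.1 (Finset.mem_range.1 hi)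
  rw [smul_mul_assoc]
  refine Subalgebra.smul_mem _ ?_ _
  obtain ⟨k, hk⟩ := Nat.exists_eq_add_of_le hi
  rw [hk, pow_add, ← mul_assoc, ← mul_pow, mul_inv_cancel₀ hp, one_pow, one_mul]
  exact pow_mem inv_mem_invRing _

/-- The inclusion of `ℤ[p⁻¹]` in `ℤ[p]`. -/
def invRingHom (h : p⁻¹ ∈ Zring p) : invRing p →+* Zring p :=
  (invRing p).val.toRingHom.codRestrict (Zring p) fun x => mem_Zring_of_mem_invRing h x.2

lemma exists_dvd_one_sub_pow (hp : p ≠ 0) (h : p⁻¹ ∈ Zring p) {y : Zring p} (hy : y ≠ 0) :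
    ∃ n > 0, ∃ w : Zring p, (1 : ℝ) - p ^ n = y * w := by
  have hfin := invRing_finite hp h
  obtain ⟨N, hN⟩ := exists_mul_inv_pow_mem hp y.2
  obtain ⟨z, hz⟩ : ∃ z : invRing p, (z : ℝ) = y * p⁻¹ ^ N := ⟨⟨_, hN⟩, rfl⟩
  have hz0 : z ≠ 0 := fun h0 => by
    rw [h0, ZeroMemClass.coe_zero, eq_comm, mul_eq_zero] at hz
    exact hz.elim (fun h1 => hy (Subtype.ext h1)) (pow_ne_zero _ (inv_ne_zero hp))
  have hquot : Finite (invRing p ⧸ Ideal.span {z}) := Ideal.finiteQuotientOfFreeOfNeBot _ (by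
    rwa [Ne, Ideal.span_singleton_eq_bot])
  obtain ⟨i, j, hij, hEq⟩ := Finite.exists_ne_map_eq_of_infinite fun n : ℕ =>
    Ideal.Quotient.mk (Ideal.span {z}) ((⟨p⁻¹, inv_mem_invRing⟩ : invRing p) ^ n)
  wlog hlt : i < j generalizing i j
  · exact this j i hij.symm hEq.symm (lt_of_le_of_ne (not_lt.1 hlt) hij.symm)
  obtain ⟨c, hc⟩ := Ideal.mem_span_singleton.1 (Ideal.Quotient.eq.1 hEq.symm)
  have hc' : p⁻¹ ^ j - p⁻¹ ^ i = z * c := congrArg Subtype.val hc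
  refine ⟨j - i, Nat.sub_pos_of_lt hlt, ⟨p⁻¹ ^ N * c * p ^ j, mul_mem (mul_mem (pow_mem h _)
    (mem_Zring_of_mem_invRing h c.2)) (pow_mem (Zring.self_mem p) _)⟩, ?_⟩
  change _ = (y : ℝ) * (p⁻¹ ^ N * c * p ^ j)
  rw [show (y : ℝ) * (p⁻¹ ^ N * c * p ^ j) = (z * c) * p ^ j by rw [hz]; ring, ← hc', sub_mul,
    ← mul_pow, inv_mul_cancel₀ hp, one_pow]
  obtain ⟨k, rfl⟩ := Nat.exists_eq_add_of_le hlt.le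
  rw [pow_add, ← mul_assoc, ← mul_pow, inv_mul_cancel₀ hp, one_pow, one_mul, Nat.add_sub_cancel_left]

lemma isNoetherianRing_Zring : IsNoetherianRing (Zring p) := by
  have hm : ∀ P : Polynomial ℤ, Polynomial.aeval p P ∈ Zring p := fun P => by
    rw [Polynomial.aeval_eq_sum_range]
    exact sum_mem fun i _ => zsmul_mem (pow_mem (Zring.self_mem p) _) _
  exact isNoetherianRing_of_surjective (Polynomial ℤ) (Zring p)
    ((Polynomial.aeval p).toRingHom.codRestrict (Zring p) hm) fun z => by
      obtain ⟨P, hP⟩ := Zring.exists_aeval z.2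
      exact ⟨P, Subtype.ext hP⟩

lemma sameIdealClass_trans {R : Subring ℝ} {I J K : Ideal R} (h1 : SameIdealClass I J)
    (h2 : SameIdealClass J K) : SameIdealClass I K := by
  obtain ⟨a, b, ha, hb, hab⟩ := h1
  obtain ⟨c, e, hc, he, hce⟩ := h2
  refine ⟨c * a, b * e, mul_ne_zero hc ha, mul_ne_zero hb he, ?_⟩
  rw [Subring.coe_mul, Subring.coe_mul, mul_smul, hab, smul_comm, hce, mul_smul]

lemma sameIdealClass_symm {R : Subring ℝ} {I J : Ideal R} (h : SameIdealClass I J) :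
    SameIdealClass J I := by
  obtain ⟨a, b, ha, hb, hab⟩ := h
  exact ⟨b, a, hb, ha, hab.symm⟩

lemma sameIdealClass_refl {R : Subring ℝ} (I : Ideal R) : SameIdealClass I I :=
  ⟨1, 1, one_ne_zero, one_ne_zero, rfl⟩

lemma smul_idealSet_subset (hp : p ≠ 0) (h : p⁻¹ ∈ Zring p) {I I' : Ideal (Zring p)}
    {b b' : invRing p} (hI : ∀ x : invRing p, invRingHom h x ∈ I →
      ∃ x' : invRing p, invRingHom h x' ∈ I' ∧ b' * x = b * x') :
    (b' : ℝ) • idealSet I ⊆ (b : ℝ) • idealSet I' := by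
  rintro _ ⟨_, ⟨z, hz, rfl⟩, rfl⟩
  obtain ⟨n, hn⟩ := exists_mul_inv_pow_mem hp z.2
  obtain ⟨x', hx', hx⟩ := hI ⟨_, hn⟩ (by
    have : invRingHom h ⟨_, hn⟩ = z * ⟨p⁻¹ ^ n, pow_mem h n⟩ := rfl
    rw [this]
    exact I.mul_mem_right _ hz)
  refine ⟨p ^ n * x', mul_mem_idealSet (pow_mem (Zring.self_mem p) n) ⟨_, hx', rfl⟩, ?_⟩
  have hx2 : (b' : ℝ) * (z * p⁻¹ ^ n) = b * x' := congrArg Subtype.val hx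
  change (b : ℝ) * (p ^ n * x') = b' * z
  rw [mul_left_comm, ← hx2, show p ^ n * ((b' : ℝ) * (z * p⁻¹ ^ n)) =
    b' * z * (p * p⁻¹) ^ n by rw [mul_pow]; ring, mul_inv_cancel₀ hp, one_pow, mul_one]

theorem finite_idealClasses (hp : p ≠ 0) (h : p⁻¹ ∈ Zring p) :
    Finite (Quot (fun I J : {I : Ideal (Zring p) // I ≠ ⊥} => SameIdealClass I.1 J.1)) := by
  have hfin := invRing_finite hp h
  obtain ⟨m, hm0, hm⟩ := exists_common_multiplier (A := invRing p)
  have hI0 : ∀ I : {I : Ideal (Zring p) // I ≠ ⊥}, I.1.comap (invRingHom h) ≠ ⊥ := fun I => by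
    obtain ⟨y, hy, hy0⟩ := Submodule.exists_mem_ne_zero_of_ne_bot I.2
    obtain ⟨n, hn⟩ := exists_mul_inv_pow_mem hp y.2
    refine (Submodule.ne_bot_iff _).2 ⟨⟨_, hn⟩, ?_, fun h0 => ?_⟩
    · have : invRingHom h ⟨_, hn⟩ = y * ⟨p⁻¹ ^ n, pow_mem h n⟩ := rfl
      rw [Ideal.mem_comap, this]
      exact I.1.mul_mem_right _ hy
    · have := congrArg Subtype.val h0
      exact (mul_eq_zero.1 this).elim (fun h1 => hy0 (Subtype.ext h1))
        (pow_ne_zero _ (inv_ne_zero hp))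
  choose b hb hb0 hdvd using fun I => hm _ (hI0 I)
  have hfinJ := finite_ideal_mem hm0
  let Φ : {I : Ideal (Zring p) // I ≠ ⊥} → {J : Ideal (invRing p) // m ∈ J} := fun I =>
    ⟨Submodule.comap (LinearMap.mulLeft (invRing p) (b I))
      (Submodule.map (LinearMap.mulLeft (invRing p) m) (I.1.comap (invRingHom h))),
      ⟨b I, hb I, mul_comm _ _⟩⟩
  have hΦ : ∀ I x, x ∈ (Φ I).1 ↔ ∃ y : invRing p, invRingHom h y ∈ I.1 ∧ m * y = b I * x :=
    fun I x => Iff.rfl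
  have key : ∀ I I', Φ I = Φ I' → ∀ x : invRing p, invRingHom h x ∈ I.1 →
      ∃ x' : invRing p, invRingHom h x' ∈ I'.1 ∧ b I' * x = b I * x' := fun I I' hII x hx => by
    obtain ⟨w, hw⟩ := hdvd I x hx
    obtain ⟨x', hx', hw'⟩ := (hΦ I' w).1 (hII ▸ (hΦ I w).2 ⟨x, hx, hw⟩)
    refine ⟨x', hx', mul_left_cancel₀ hm0 ?_⟩
    rw [mul_left_comm, hw, mul_left_comm m, hw', mul_left_comm]
  refine Finite.of_injective (fun c => Φ c.out) fun c c' hcc => ?_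
  rw [← Quot.out_eq c, ← Quot.out_eq c']
  refine Quot.sound ⟨⟨b c'.out, mem_Zring_of_mem_invRing h (b c'.out).2⟩,
    ⟨b c.out, mem_Zring_of_mem_invRing h (b c.out).2⟩,
    fun h0 => hb0 c'.out (Subtype.ext (congrArg (fun z : Zring p => (z : ℝ)) h0)),
    fun h0 => hb0 c.out (Subtype.ext (congrArg (fun z : Zring p => (z : ℝ)) h0)), ?_⟩
  exact Subset.antisymm (smul_idealSet_subset hp h (key _ _ hcc))
    (smul_idealSet_subset hp h (key _ _ hcc.symm))

end Zring

lemma mem_of_coe_mem_idealSet {R : Subring ℝ} {I : Ideal R} {x : R} (h : (x : ℝ) ∈ idealSet I) :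
    x ∈ I := by
  obtain ⟨y, hy, hyx⟩ := h
  rwa [← Subtype.ext hyx]

lemma abs_mem_idealSet {R : Subring ℝ} {I : Ideal R} {x : ℝ} :
    |x| ∈ idealSet I ↔ x ∈ idealSet I := by
  rcases abs_choice x with h | h
  · rw [h]
  · rw [h]
    exact neg_mem_iff (H := idealGrp I)

lemma sameIdealClass_span_singleton_mul {R : Subring ℝ} (I : Ideal R) {w : R} (hw : w ≠ 0) :
    SameIdealClass I (Ideal.span {w} * I) := by
  refine ⟨w, 1, hw, one_ne_zero, Subset.antisymm ?_ ?_⟩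
  · rintro _ ⟨_, ⟨z, hz, rfl⟩, rfl⟩
    exact ⟨w * z, ⟨w * z, Ideal.mem_span_singleton_mul.2 ⟨z, hz, rfl⟩, rfl⟩, one_mul _⟩
  · rintro _ ⟨_, ⟨z, hz, rfl⟩, rfl⟩
    obtain ⟨y, hy, rfl⟩ := Ideal.mem_span_singleton_mul.1 hz
    exact ⟨y, ⟨y, hy, rfl⟩, (one_mul _).symm⟩

/-- Every ideal class contains an ideal generated by the weights of a subprobability vector. -/
lemma exists_weights {p : ℝ} (hp0 : 0 < p) (hp1 : p < 1) (h : p⁻¹ ∈ Zring p) {I : Ideal (Zring p)}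
    (hI : I ≠ ⊥) : ∃ (n0 : ℕ) (κ : Type) (_ : Fintype κ) (_ : Nonempty κ) (X : κ → ℝ), 0 < n0 ∧
      (∀ c, X c ∈ Zring p) ∧ (∀ c, 0 < X c) ∧ p ^ n0 + ∑ c, X c = 1 ∧
      SameIdealClass I (Ideal.span {x | ∃ c, (x : ℝ) = X c}) := by
  classical
  obtain ⟨y, hy, hy0⟩ := Submodule.exists_mem_ne_zero_of_ne_bot hI
  obtain ⟨n0, hn0, w, hw⟩ := exists_dvd_one_sub_pow hp0.ne' h hy0
  have hn1 : 0 < 1 - p ^ n0 := sub_pos.2 (pow_lt_one₀ hp0.le hp1 hn0.ne')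
  have hw0 : w ≠ 0 := fun h0 => hn1.ne' (by rw [hw, h0, ZeroMemClass.coe_zero, mul_zero])
  obtain ⟨I', hI'⟩ : ∃ I', I' = Ideal.span {w} * I := ⟨_, rfl⟩
  obtain ⟨s, hs⟩ : I'.FG := (isNoetherianRing_iff_ideal_fg _).1 isNoetherianRing_Zring I'
  let κ := {g // g ∈ s.erase 0}
  have hB : 0 < ∑ g : κ, |(g.1 : ℝ)| + 1 :=
    add_pos_of_nonneg_of_pos (Finset.sum_nonneg fun _ _ => abs_nonneg _) one_pos
  obtain ⟨k, hk⟩ := exists_pow_lt_of_lt_one (div_pos hn1 hB) hp1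
  have hpk : 0 < p ^ k := pow_pos hp0 k
  rw [lt_div_iff₀ hB] at hk
  let X : Option κ → ℝ := fun c => c.elim (1 - p ^ n0 - ∑ g : κ, p ^ k * |(g.1 : ℝ)|)
    fun g => p ^ k * |(g.1 : ℝ)|
  have habs : ∀ g : Zring p, |(g : ℝ)| ∈ Zring p := fun g => by
    rcases abs_choice (g : ℝ) with hg | hg <;> rw [hg]
    · exact g.2
    · exact neg_mem g.2
  have hXs : ∀ g : κ, p ^ k * |(g.1 : ℝ)| ∈ Zring p := fun g =>
    mul_mem (pow_mem (Zring.self_mem p) k) (habs g.1)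
  have hXs' : ∀ g : κ, p ^ k * |(g.1 : ℝ)| ∈ idealGrp I' := fun g =>
    mul_mem_idealSet (pow_mem (Zring.self_mem p) k) (abs_mem_idealSet.2
      ⟨g.1, hs ▸ Ideal.subset_span (Finset.mem_of_mem_erase g.2), rfl⟩)
  have hX : ∀ c : Option κ, X c ∈ Zring p := by
    rintro (_ | g)
    · exact sub_mem (sub_mem (one_mem _) (pow_mem (Zring.self_mem p) _))
        (sum_mem fun g _ => hXs g)
    · exact hXs g
  refine ⟨n0, Option κ, inferInstance, inferInstance, X, hn0, hX, fun c => ?_, ?_, ?_⟩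
  · rcases c with _ | g
    · change 0 < 1 - p ^ n0 - ∑ g : κ, p ^ k * |(g.1 : ℝ)|
      rw [← Finset.mul_sum]
      linarith
    · refine mul_pos hpk (abs_pos.2 fun h0 => ?_)
      exact (Finset.mem_erase.1 g.2).1 (Subtype.ext h0)
  · rw [Fintype.sum_option]
    change p ^ n0 + (1 - p ^ n0 - ∑ g : κ, p ^ k * |(g.1 : ℝ)| + ∑ g : κ, p ^ k * |(g.1 : ℝ)|) = 1
    ring
  · have hspan : Ideal.span {x : Zring p | ∃ c, (x : ℝ) = X c} = I' := by
      refine le_antisymm (Ideal.span_le.2 ?_) ?_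
      · rintro x ⟨c, hx⟩
        refine mem_of_coe_mem_idealSet ?_
        rw [hx]
        rcases c with _ | g
        · refine sub_mem (H := idealGrp I') ?_ (sum_mem fun g _ => hXs' g)
          refine ⟨w * y, ?_, (mul_comm _ _).trans hw.symm⟩
          rw [hI']
          exact Ideal.mem_span_singleton_mul.2 ⟨y, hy, rfl⟩
        · exact hXs' g
      · rw [← hs]
        refine Ideal.span_le.2 fun g hg => ?_
        by_cases hg0 : g = 0
        · rw [hg0]; exact zero_mem _
        · let c : κ := ⟨g, Finset.mem_erase.2 ⟨hg0, hg⟩⟩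
          refine mem_of_coe_mem_idealSet (abs_mem_idealSet.1 ?_)
          have : |(g : ℝ)| = p⁻¹ ^ k * X (some c) := by
            change _ = p⁻¹ ^ k * (p ^ k * |(g : ℝ)|)
            rw [← mul_assoc, ← mul_pow, inv_mul_cancel₀ hp0.ne', one_pow, one_mul]
          rw [this]
          exact mul_mem_idealSet (pow_mem h k)
            ⟨⟨_, hX (some c)⟩, Ideal.subset_span ⟨some c, rfl⟩, rfl⟩
    rw [hspan, hI']
    exact sameIdealClass_span_singleton_mul I hw0

/-- Every ideal class is the class of the ideal of an iterated function system. -/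
theorem IFS.Nice.exists_memTOECpr {d : ℕ} {S : IFS d} {lam : S.ι → ℕ} {p r : ℝ}
    (h : S.Nice lam p r) {I : Ideal (Zring p)} (hI : I ≠ ⊥) :
    ∃ (d' : ℕ) (T : IFS d'), T.MemTOECpr p r ∧ SameIdealClass I (T.idealOf p) := by
  classical
  obtain ⟨n0, κ, hκ, ⟨c0⟩, X, hn0, hX, hX0, hsum, hIX⟩ := exists_weights h.p0 h.p1 h.inv_mem hI
  have hr1 : r ^ n0 / 3 < 1 / 3 := by
    have := pow_lt_one₀ h.r0.le h.r1 hn0.ne'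
    linarith
  obtain ⟨t, δ, hδ, ht1, ht2, ht3⟩ := exists_separated_points κ hr1
  obtain ⟨n, hn⟩ := exists_pow_lt_of_lt_one hδ h.r1
  obtain ⟨M, cl, e, he, hgcd, hcl, j, j', hjj, hcj⟩ := exists_exponents h.p0 h.p1 h.hl h.sum h.gcd
    c0 X hX hX0 (by linarith [pow_pos h.p0 n0]) (n + 1)
  let D : ConeData :=
    { M := M, κ := κ, cl := cl, e := e, n0 := n0, t := t, δ := δ, r := r, r0 := h.r0, r1 := h.r1
      n0_pos := hn0
      e_pos := fun j => n.succ_pos.trans_le (he j)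
      δ0 := hδ
      hδ := fun j => (pow_le_pow_of_le_one h.r0.le h.r1.le (n.le_succ.trans (he j))).trans hn.le
      ht1 := ht1, ht2 := ht2, ht3 := ht3 }
  have hw : ∀ c, D.weight p c = X c := hcl
  have hD : D.ifs.Nice D.lam p D.r := by
    refine D.nice h.hdim_pos h.hpr ?_ hgcd
    rw [← hsum]
    congr 1
    rw [← Finset.sum_fiberwise_of_maps_to (t := Finset.univ) fun j _ => Finset.mem_univ (cl j)]
    exact Finset.sum_congr rfl fun c _ => hcl c
  refine ⟨_, D.ifs, hD.memTOECpr, ?_⟩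
  rw [D.idealOf_eq hD hjj hcj, ConeData.weightIdeal]
  simp_rw [hw]
  exact hIX

/-- **Theorem (Lipschitz classes ↔ ideal classes; finiteness).**
Suppose `TOEC(p,r) ≠ ∅`. Then:
(a) for `S, T ∈ TOEC(p,r)`, `E_S ≃ E_T` iff `I_S` and `I_T` are in the same ideal class
of `ℤ[p]`; (b) every ideal class of `ℤ[p]` contains `I_S` for some `S ∈ TOEC(p,r)`;
consequently there is a bijection between Lipschitz equivalence classes of
`{E_S : S ∈ TOEC(p,r)}` and ideal classes of `ℤ[p]` sending the class of `E_S` to the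
class of `I_S`, and the number of Lipschitz equivalence classes is finite. -/
theorem lipschitzClasses_equiv_idealClasses (p r : ℝ)
    (hp0 : 0 < p) (hp1 : p < 1) (hr0 : 0 < r) (hr1 : r < 1)
    (hne : ∃ (d : ℕ) (S : IFS d), S.MemTOECpr p r) :
    (∀ (d d' : ℕ) (S : IFS d) (T : IFS d'), S.MemTOECpr p r → T.MemTOECpr p r →
        (LipEquiv S.attractor T.attractor ↔ SameIdealClass (S.idealOf p) (T.idealOf p))) ∧
    (∀ I : Ideal (Zring p), I ≠ ⊥ →
        ∃ (d : ℕ) (S : IFS d), S.MemTOECpr p r ∧ SameIdealClass I (S.idealOf p)) ∧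
    (∃ e : Quot (fun S T : {S : Σ d : ℕ, IFS d // S.2.MemTOECpr p r} =>
              LipEquiv S.1.2.attractor T.1.2.attractor) ≃
            Quot (fun I J : {I : Ideal (Zring p) // I ≠ ⊥} => SameIdealClass I.1 J.1),
        ∀ (S : {S : Σ d : ℕ, IFS d // S.2.MemTOECpr p r}) (h : S.1.2.idealOf p ≠ ⊥),
          e (Quot.mk _ S) = Quot.mk _ ⟨S.1.2.idealOf p, h⟩) ∧
    Finite (Quot (fun S T : {S : Σ d : ℕ, IFS d // S.2.MemTOECpr p r} =>
        LipEquiv S.1.2.attractor T.1.2.attractor)) := by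
  obtain ⟨d0, S0, hS0⟩ := hne
  obtain ⟨lam0, h0⟩ := hS0.exists_nice hp1
  have ha : ∀ (d d' : ℕ) (S : IFS d) (T : IFS d'), S.MemTOECpr p r → T.MemTOECpr p r →
      (LipEquiv S.attractor T.attractor ↔ SameIdealClass (S.idealOf p) (T.idealOf p)) := by
    intro d d' S T hS hT
    obtain ⟨lam, h⟩ := hS.exists_nice hp1
    obtain ⟨lam', h'⟩ := hT.exists_nice hp1
    exact ⟨h.sameIdealClass_of_lipEquiv h', h.lipEquiv_of_sameIdealClass h'⟩
  have hb : ∀ I : Ideal (Zring p), I ≠ ⊥ →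
      ∃ (d : ℕ) (S : IFS d), S.MemTOECpr p r ∧ SameIdealClass I (S.idealOf p) :=
    fun I hI => h0.exists_memTOECpr hI
  have hbot : ∀ S : {S : Σ d : ℕ, IFS d // S.2.MemTOECpr p r}, S.1.2.idealOf p ≠ ⊥ := fun S => by
    obtain ⟨lam, h⟩ := S.2.exists_nice hp1
    exact h.idealOf_ne_bot
  let φ : Quot (fun S T : {S : Σ d : ℕ, IFS d // S.2.MemTOECpr p r} =>
      LipEquiv S.1.2.attractor T.1.2.attractor) →
      Quot (fun I J : {I : Ideal (Zring p) // I ≠ ⊥} => SameIdealClass I.1 J.1) :=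
    Quot.map (fun S => ⟨S.1.2.idealOf p, hbot S⟩) fun S T hST => (ha _ _ _ _ S.2 T.2).1 hST
  have heqv : Equivalence fun I J : {I : Ideal (Zring p) // I ≠ ⊥} => SameIdealClass I.1 J.1 :=
    ⟨fun I => sameIdealClass_refl I.1, sameIdealClass_symm, sameIdealClass_trans⟩
  have hφ : Function.Bijective φ := by
    constructor
    · rintro ⟨S⟩ ⟨T⟩ hST
      exact Quot.sound ((ha _ _ _ _ S.2 T.2).2 (heqv.quot_mk_eq_iff _ _ |>.1 hST))
    · rintro ⟨I⟩
      obtain ⟨d, S, hS, hIS⟩ := hb I.1 I.2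
      exact ⟨Quot.mk _ ⟨⟨d, S⟩, hS⟩, Quot.sound (sameIdealClass_symm hIS)⟩
  have hfin := finite_idealClasses hp0.ne' h0.inv_mem
  exact ⟨ha, hb, ⟨Equiv.ofBijective φ hφ, fun S h => rfl⟩, Finite.of_injective φ hφ.1⟩

end
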